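/- Let R be a reduced commutative Noetherian ring of dimension n, M a Φ-simplicial monoid in C(Φ), A = R[M], and P a finitely generated projective A[T]-module of constant rank n whose determinant is extended from R. Let J̃ = J(A[T], P) ∩ R, where J(A[T], P) is the Quillen ideal of P. Then ht(J̃) ≥ 2. -/

import Mathlib

set_option synthInstance.maxHeartbeats 1000000
set_option maxHeartbeats 1000000

section

open MvPolynomial

/-- The coordinatewise cast `ℕ^r → ℤ^r` as an additive monoid hom. -/
def natCast (r : ℕ) : (Fin r → ℕ) →+ (Fin r → ℤ) where
  toFun x i := (x i : ℤ)
  map_zero' := by funext i; simp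
  map_add' x y := by funext i; simp

/-- A `Φ`-simplicial monoid of rank `r`: a finitely generated submonoid `M ⊆ ℤ₊^r`
such that the extension `M ⊆ ℤ₊^r` is integral. -/
def PhiSimplicial {r : ℕ} (M : AddSubmonoid (Fin r → ℕ)) : Prop :=
  M.FG ∧ ∀ x : Fin r → ℕ, ∃ n : ℕ, 0 < n ∧ n • x ∈ M

/-- Seminormality of a submonoid `M ⊆ ℤ₊^r`: if `x ∈ gp(M)` and `2x, 3x ∈ M`,
then `x ∈ M`. -/
def MonoidSeminormal {r : ℕ} (M : AddSubmonoid (Fin r → ℕ)) : Prop :=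
  ∀ x : Fin r → ℤ, x ∈ AddSubgroup.closure (M.map (natCast r) : Set (Fin r → ℤ)) →
    2 • x ∈ M.map (natCast r) → 3 • x ∈ M.map (natCast r) → x ∈ M.map (natCast r)

/-- The truncation `M_m` of `M`: elements supported on the coordinates `≤ m`. -/
def truncMonoid {r : ℕ} (M : AddSubmonoid (Fin r → ℕ)) (m : Fin r) :
    Set (Fin r → ℕ) := {x | x ∈ M ∧ ∀ i : Fin r, m < i → x i = 0}

/-- The monomial of `MvPolynomial (Fin r) R` with exponent vector `x`. -/
noncomputable def monomialOf {r : ℕ} (R : Type*) [CommRing R] (x : Fin r → ℕ) :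
    MvPolynomial (Fin r) R :=
  MvPolynomial.monomial (Finsupp.equivFunOnFinite.symm x) 1

/-- The subalgebra `R[M_m]` of `R[t₁,…,t_r]` spanned by the monomials of the
truncation `M_m`. -/
noncomputable def truncAlgebra {r : ℕ} (M : AddSubmonoid (Fin r → ℕ)) (m : Fin r)
    (R : Type*) [CommRing R] : Subalgebra R (MvPolynomial (Fin r) R) :=
  Algebra.adjoin R (monomialOf R '' truncMonoid M m)

/-- The substitution `t_i ↦ t_i + t_m^{c_i}` for `i < m`, fixing the other variables. -/
noncomputable def subst {r : ℕ} (m : Fin r) (cs : Fin r → ℕ) (R : Type*) [CommRing R] :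
    MvPolynomial (Fin r) R →ₐ[R] MvPolynomial (Fin r) R :=
  MvPolynomial.aeval (fun i => if i < m then X i + X m ^ cs i else X i)

/-- The class `C(Φ)`: `M` is seminormal and each truncation `M_m` satisfies the
automorphism condition: for every `c` there are `c_i > c` such that for every
commutative ring `R` the substitution `t_i ↦ t_i + t_m^{c_i}` (for `i < m`)
restricts to an `R`-automorphism of `R[M_m]`. -/
def InClassCPhi {r : ℕ} (M : AddSubmonoid (Fin r → ℕ)) : Prop :=
  MonoidSeminormal M ∧
  ∀ (m : Fin r) (c : ℕ), ∃ cs : Fin r → ℕ, (∀ i : Fin r, i < m → c < cs i) ∧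
    ∀ (R : Type) (_ : CommRing R),
      Subalgebra.map (subst m cs R) (truncAlgebra M m R) = truncAlgebra M m R

/-- A unimodular element of a module. -/
def IsUnimodular {R P : Type*} [CommRing R] [AddCommGroup P] [Module R P] (p : P) : Prop :=
  ∃ φ : P →ₗ[R] R, φ p = 1

/-- The height of an ideal: the infimum of the heights of primes containing it. -/
noncomputable def idealHeight {A : Type*} [CommRing A] (I : Ideal A) : ℕ∞ :=
  ⨅ p : {p : PrimeSpectrum A // I ≤ p.asIdeal}, Order.height p.1

end

/-- Two square matrices are isomorphic if they are of the form `U * V` and `V * U`. For idempotent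
matrices this says that their images are isomorphic modules. -/
def IdemIso {B ι κ : Type*} [CommRing B] [Fintype ι] [Fintype κ]
    (E : Matrix ι ι B) (F : Matrix κ κ B) : Prop :=
  ∃ (U : Matrix ι κ B) (V : Matrix κ ι B), U * V = E ∧ V * U = F

namespace IdemIso

variable {B ι κ l : Type*} [CommRing B] [Fintype ι] [Fintype κ] [Fintype l]

theorem symm {E : Matrix ι ι B} {F : Matrix κ κ B} (h : IdemIso E F) : IdemIso F E := by
  obtain ⟨U, V, h1, h2⟩ := h
  exact ⟨V, U, h2, h1⟩

theorem trans {E : Matrix ι ι B} {F : Matrix κ κ B} {G : Matrix l l B}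
    (h : IdemIso E F) (h' : IdemIso F G) (hE : E * E = E) (hG : G * G = G) : IdemIso E G := by
  obtain ⟨U, V, h1, h2⟩ := h
  obtain ⟨U', V', h3, h4⟩ := h'
  refine ⟨U * U', V' * V, ?_, ?_⟩
  · calc U * U' * (V' * V) = U * (U' * V') * V := by simp only [Matrix.mul_assoc]
      _ = (U * V) * (U * V) := by rw [h3, ← h2]; simp only [Matrix.mul_assoc]
      _ = E := by rw [h1, hE]
  · calc V' * V * (U * U') = V' * (V * U) * U' := by simp only [Matrix.mul_assoc]
      _ = (V' * U') * (V' * U') := by rw [h2, ← h3]; simp only [Matrix.mul_assoc]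
      _ = G := by rw [h4, hG]

theorem map {C : Type*} [CommRing C] {E : Matrix ι ι B} {F : Matrix κ κ B} (h : IdemIso E F)
    (φ : B →+* C) : IdemIso (E.map φ) (F.map φ) := by
  obtain ⟨U, V, h1, h2⟩ := h
  exact ⟨U.map φ, V.map φ, by rw [← h1, Matrix.map_mul], by rw [← h2, Matrix.map_mul]⟩

end IdemIso

/-- The image of the idempotent matrix `E` is free of rank `n`. -/
def IdemFree {B ι : Type*} [CommRing B] [Fintype ι] (n : ℕ) (E : Matrix ι ι B) : Prop :=
  IdemIso E (1 : Matrix (Fin n) (Fin n) B)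

theorem IdemFree.map {B C ι : Type*} [CommRing B] [CommRing C] [Fintype ι] {n : ℕ}
    {E : Matrix ι ι B} (h : IdemFree n E) (φ : B →+* C) : IdemFree n (E.map φ) := by
  have := IdemIso.map h φ
  rwa [Matrix.map_one _ (map_zero φ) (map_one φ)] at this

/-- An idempotent matrix of constant rank `n` with free determinant: the `n × n` minors generate
the unit ideal and form a matrix of the form `v f * w g`. -/
def OrientedIdem {B ι : Type*} [CommRing B] [Fintype ι] (n : ℕ)
    (E : Matrix ι ι B) : Prop :=
  E * E = E ∧
  (∃ v w : (Fin n → ι) → B, ∀ f g, (E.submatrix f g).det = v f * w g) ∧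
  ∃ c : (Fin n → ι) → (Fin n → ι) → B, ∑ f, ∑ g, c f g * (E.submatrix f g).det = 1

namespace OrientedIdem

variable {B ι : Type*} [CommRing B] [Fintype ι] {n : ℕ} {E : Matrix ι ι B}

theorem map {C : Type*} [CommRing C] (h : OrientedIdem n E) (φ : B →+* C) :
    OrientedIdem n (E.map φ) := by
  obtain ⟨hE, ⟨v, w, hvw⟩, c, hc⟩ := h
  have hdet : ∀ f g : Fin n → ι, ((E.map φ).submatrix f g).det = φ (E.submatrix f g).det := by
    intro f g
    rw [RingHom.map_det]
    rfl
  refine ⟨by rw [← Matrix.map_mul, hE], ⟨φ ∘ v, φ ∘ w, fun f g => ?_⟩,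
    fun f g => φ (c f g), ?_⟩
  · rw [hdet, hvw, map_mul]; rfl
  · simp only [hdet, ← map_mul, ← map_sum, hc, map_one]

theorem exists_minor_notMem (h : OrientedIdem n E) (q : Ideal B) (hq : q ≠ ⊤) :
    ∃ f g : Fin n → ι, (E.submatrix f g).det ∉ q := by
  by_contra! H
  obtain ⟨c, hc⟩ := h.2.2
  exact hq ((Ideal.eq_top_iff_one q).2 (hc ▸ Ideal.sum_mem _ fun f _ => Ideal.sum_mem _ fun g _ =>
    Ideal.mul_mem_left _ _ (H f g)))

end OrientedIdem

theorem exists_sum_minors_eq_one {B ι : Type*} [CommRing B] [Fintype ι] {n : ℕ}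
    {E : Matrix ι ι B}
    (h : ∀ q : Ideal B, q.IsMaximal → ∃ f g : Fin n → ι, (E.submatrix f g).det ∉ q) :
    ∃ c : (Fin n → ι) → (Fin n → ι) → B, ∑ f, ∑ g, c f g * (E.submatrix f g).det = 1 := by
  have : Ideal.span (Set.range fun x : (Fin n → ι) × (Fin n → ι) =>
      (E.submatrix x.1 x.2).det) = ⊤ := by
    by_contra H
    obtain ⟨q, hq, hle⟩ := Ideal.exists_le_maximal _ H
    obtain ⟨f, g, hfg⟩ := h q hq
    exact hfg (hle (Ideal.subset_span ⟨(f, g), rfl⟩))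
  rw [Ideal.eq_top_iff_one, Ideal.span, Submodule.mem_span_range_iff_exists_fun] at this
  obtain ⟨c, hc⟩ := this
  refine ⟨fun f g => c (f, g), ?_⟩
  rw [← hc, Fintype.sum_prod_type]
  simp only [smul_eq_mul]

/-- Row expansion of a determinant of a product of non-square matrices. -/
theorem Matrix.det_mul_eq_sum_submatrix {B ι : Type*} [CommRing B] [Fintype ι] {n : ℕ}
    (A : Matrix (Fin n) ι B) (Y : Matrix ι (Fin n) B) :
    (A * Y).det = ∑ f : Fin n → ι, (∏ k, A k (f k)) * (Y.submatrix f id).det := by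
  classical
  have h1 : A * Y = fun k => ∑ i, A k i • Y i := by
    funext k j
    simp [Matrix.mul_apply]
  have h2 := MultilinearMap.map_sum
    (Matrix.detRowAlternating (n := Fin n) (R := B)).toMultilinearMap (fun k i => A k i • Y i)
  change (Matrix.detRowAlternating (n := Fin n) (R := B)).toMultilinearMap (A * Y) = _
  rw [h1, h2]
  refine Finset.sum_congr rfl fun f _ => ?_
  rw [MultilinearMap.map_smul_univ]
  rfl

/-- Column expansion of a determinant of a product of non-square matrices. -/
theorem Matrix.det_mul_eq_sum_submatrix_right {B ι : Type*} [CommRing B] [Fintype ι] {n : ℕ}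
    (A : Matrix (Fin n) ι B) (Y : Matrix ι (Fin n) B) :
    (A * Y).det = ∑ g : Fin n → ι, (A.submatrix id g).det * ∏ k, Y (g k) k := by
  rw [← Matrix.det_transpose, Matrix.transpose_mul, Matrix.det_mul_eq_sum_submatrix]
  refine Finset.sum_congr rfl fun g _ => ?_
  rw [mul_comm, ← Matrix.det_transpose (A.submatrix id g)]
  rfl

theorem OrientedIdem.det_mul_mul {B ι : Type*} [CommRing B] [Fintype ι] {n : ℕ}
    {E : Matrix ι ι B} {v w : (Fin n → ι) → B} (h : ∀ f g, (E.submatrix f g).det = v f * w g)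
    (A : Matrix (Fin n) ι B) (Y : Matrix ι (Fin n) B) :
    (A * E * Y).det = (∑ f, (∏ k, A k (f k)) * v f) * ∑ g, w g * ∏ k, Y (g k) k := by
  rw [Matrix.mul_assoc, Matrix.det_mul_eq_sum_submatrix, Finset.sum_mul]
  refine Finset.sum_congr rfl fun f _ => ?_
  have : (E * Y).submatrix f id = E.submatrix f id * Y := by
    ext; simp [Matrix.mul_apply]
  rw [this, Matrix.det_mul_eq_sum_submatrix_right, mul_assoc, Finset.mul_sum _ _ (v f)]
  congr 1
  refine Finset.sum_congr rfl fun g _ => ?_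
  rw [Matrix.submatrix_submatrix, ← mul_assoc]
  exact congrArg (· * _) (h f g)

/-- If all submaximal minors of `A` vanish, a rank one perturbation of `A` is singular. -/
theorem Matrix.det_add_vecMulVec_eq_zero {K : Type*} [CommRing K] {n : ℕ}
    (A : Matrix (Fin (n + 1)) (Fin (n + 1)) K) (x y : Fin (n + 1) → K)
    (hA : ∀ f g : Fin n → Fin (n + 1), (A.submatrix f g).det = 0) :
    (A + Matrix.vecMulVec x y).det = 0 := by
  classical
  change (Matrix.detRowAlternating (n := Fin (n + 1)) (R := K)).toMultilinearMap
    (A + Matrix.vecMulVec x y) = 0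
  have hexp := MultilinearMap.map_add_univ
    (Matrix.detRowAlternating (n := Fin (n + 1)) (R := K)).toMultilinearMap
    (Matrix.vecMulVec x y) A
  rw [add_comm A]
  erw [hexp]
  refine Finset.sum_eq_zero fun s _ => ?_
  set M : Matrix (Fin (n + 1)) (Fin (n + 1)) K :=
    Matrix.of fun a b => if a ∈ s then x a * y b else A a b with hM
  have hMs : (s.piecewise (Matrix.vecMulVec x y) A : Fin (n + 1) → Fin (n + 1) → K) = M := by
    funext a b
    by_cases ha : a ∈ s
    · simp only [Finset.piecewise, ha, if_true, hM, Matrix.of_apply]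
      rfl
    · simp [Finset.piecewise, ha, hM]
  erw [hMs]
  change M.det = 0
  by_cases hs : ∃ i ∈ s, ∃ j ∈ s, i ≠ j
  · obtain ⟨i, hi, j, hj, hij⟩ := hs
    have hi' : M = Matrix.updateRow (Matrix.updateRow M i (x i • y)) j (x j • y) := by
      ext a b
      by_cases haj : a = j
      · subst haj
        simp [hj, hM]
      · by_cases hai : a = i
        · subst hai
          simp [haj, hi, hM]
        · simp [haj, hai]
    rw [hi', Matrix.det_updateRow_smul, Matrix.updateRow_comm _ hij, Matrix.det_updateRow_smul,
      Matrix.det_zero_of_row_eq hij]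
    · simp
    · funext b
      simp [Matrix.updateRow_apply]
  · push Not at hs
    have key : ∃ i : Fin (n + 1), ∀ a, a ≠ i → a ∉ s := by
      by_cases hne : s.Nonempty
      · obtain ⟨i, hi⟩ := hne
        exact ⟨i, fun a ha h => ha (hs a h i hi)⟩
      · rw [Finset.not_nonempty_iff_eq_empty] at hne
        exact ⟨0, fun a _ => by simp [hne]⟩
    obtain ⟨i, hi⟩ := key
    rw [Matrix.det_succ_row _ i]
    refine Finset.sum_eq_zero fun j _ => ?_
    have : M.submatrix i.succAbove j.succAbove = A.submatrix i.succAbove j.succAbove := by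
      ext a b
      simp [hM, hi _ (Fin.succAbove_ne i a)]
    rw [this, hA, mul_zero]

theorem OrientedIdem.idemFree_one {B ι : Type*} [CommRing B] [Fintype ι] {E : Matrix ι ι B}
    (h : OrientedIdem 1 E) : IdemFree 1 E := by
  obtain ⟨hE, ⟨v, w, hvw⟩, c, hc⟩ := h
  have hent : ∀ i j, E i j = v (fun _ => i) * w (fun _ => j) := by
    intro i j
    rw [← hvw]
    simp
  have hsum : ∀ i j, E i j * ∑ k, w (fun _ => k) * v (fun _ => k) = E i j := by
    intro i j
    conv_rhs => rw [← hE, Matrix.mul_apply]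
    rw [Finset.mul_sum]
    refine Finset.sum_congr rfl fun k _ => ?_
    simp only [hent]
    ring
  have htr : ∑ k, w (fun _ => k) * v (fun _ => k) = 1 := by
    calc _ = (∑ f, ∑ g, c f g * (E.submatrix f g).det) *
          ∑ k, w (fun _ => k) * v (fun _ => k) := by rw [hc, one_mul]
      _ = ∑ f, ∑ g, c f g * (E.submatrix f g).det := by
        simp only [Finset.sum_mul]
        refine Finset.sum_congr rfl fun f _ => Finset.sum_congr rfl fun g _ => ?_
        rw [mul_assoc]
        congr 1
        rw [Matrix.det_fin_one]
        exact hsum _ _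
      _ = 1 := hc
  refine ⟨Matrix.of fun i _ => v (fun _ => i), Matrix.of fun _ j => w (fun _ => j), ?_, ?_⟩
  · ext i j
    simp [Matrix.mul_apply, hent]
  · ext i j
    rw [Subsingleton.elim i 0, Subsingleton.elim j 0]
    simp [Matrix.mul_apply, htr]

/-- Splitting off a unimodular element from an idempotent matrix. -/
theorem OrientedIdem.sub_vecMulVec {B ι : Type*} [CommRing B] [Fintype ι] {n : ℕ}
    {E : Matrix ι ι B} (h : OrientedIdem (n + 1) E) {p φ : ι → B}
    (hp : Matrix.mulVec E p = p) (hφ : Matrix.vecMul φ E = φ) (hφp : φ ⬝ᵥ p = 1) :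
    OrientedIdem n (E - Matrix.vecMulVec p φ) := by
  classical
  obtain ⟨v, w, hvw⟩ := h.2.1
  refine ⟨?_, ?_, exists_sum_minors_eq_one fun q hq => ?_⟩
  · rw [sub_mul, mul_sub, mul_sub, h.1, Matrix.mul_vecMulVec, hp, Matrix.vecMulVec_mul, hφ,
      Matrix.vecMulVec_mul_vecMulVec, hφp]
    simp
  · let L : (Fin n → ι) → Matrix (Fin (n + 1)) ι B := fun f =>
      Matrix.of (Fin.cons φ fun k => Pi.single (f k) 1)
    let Rt : (Fin n → ι) → Matrix ι (Fin (n + 1)) B := fun g =>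
      (Matrix.of (Fin.cons p fun k => Pi.single (g k) 1) : Matrix (Fin (n + 1)) ι B).transpose
    refine ⟨fun f => ∑ f', (∏ k, L f k (f' k)) * v f',
      fun g => ∑ g', w g' * ∏ k, Rt g (g' k) k, fun f g => ?_⟩
    rw [← OrientedIdem.det_mul_mul hvw (L f) (Rt g)]
    let e : Unit ⊕ Fin n ≃ Fin (n + 1) :=
      (Equiv.sumComm _ _).trans ((Equiv.optionEquivSumPUnit (Fin n)).symm.trans
        (finSuccEquiv n).symm)
    have h0 : ∀ u, e (Sum.inl u) = 0 := fun _ => rfl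
    have hs : ∀ k, e (Sum.inr k) = k.succ := fun _ => rfl
    rw [← Matrix.det_submatrix_equiv_self e]
    have key : (L f * E * Rt g).submatrix e e = Matrix.fromBlocks (1 : Matrix Unit Unit B)
        (Matrix.of fun _ k => φ (g k)) (Matrix.of fun k _ => p (f k)) (E.submatrix f g) := by
      have hL0 : (fun i => L f 0 i) = φ := rfl
      have hLs : ∀ k : Fin n, (fun i => L f k.succ i) = Pi.single (f k) 1 := fun _ => rfl
      have hR0 : (fun i => Rt g i 0) = p := rfl
      have hRs : ∀ k : Fin n, (fun i => Rt g i k.succ) = Pi.single (g k) 1 := fun _ => rfl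
      have hent : ∀ a b, (L f * E * Rt g) a b
          = Matrix.vecMul (fun i => L f a i) E ⬝ᵥ (fun i => Rt g i b) := fun a b => rfl
      ext a b
      rw [Matrix.submatrix_apply, hent]
      rcases a with a | a <;> rcases b with b | b
      · rw [h0, hL0, hR0, hφ, hφp]
        simp
      · rw [h0, hs, hL0, hRs, hφ]
        simp
      · rw [h0, hs, hR0, hLs, ← Matrix.dotProduct_mulVec, hp]
        simp
      · rw [hs, hs, hLs, hRs]
        simp
    rw [key, Matrix.det_fromBlocks_one₁₁]
    congr 1
    ext a b
    simp [Matrix.mul_apply, Matrix.vecMulVec_apply]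
  · by_contra! H
    obtain ⟨f, g, hfg⟩ := h.exists_minor_notMem q hq.ne_top
    apply hfg
    rw [← Ideal.Quotient.eq_zero_iff_mem, RingHom.map_det]
    have h2 : (Ideal.Quotient.mk q).mapMatrix (E.submatrix f g) =
        (Ideal.Quotient.mk q).mapMatrix ((E - Matrix.vecMulVec p φ).submatrix f g) +
        Matrix.vecMulVec (fun k => Ideal.Quotient.mk q (p (f k)))
          (fun k => Ideal.Quotient.mk q (φ (g k))) := by
      ext a b
      simp [Matrix.vecMulVec_apply]
    rw [h2]
    refine Matrix.det_add_vecMulVec_eq_zero _ _ _ fun f' g' => ?_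
    have h3 := H (f ∘ f') (g ∘ g')
    rw [← Ideal.Quotient.eq_zero_iff_mem, RingHom.map_det] at h3
    exact h3

/-- If a free image of rank `n` remains after splitting off a unimodular element, the image of `E`
is free of rank `n + 1`. -/
theorem IdemFree.of_sub_vecMulVec {B ι : Type*} [CommRing B] [Fintype ι] {n : ℕ}
    {E : Matrix ι ι B} {p φ : ι → B}
    (hp : Matrix.mulVec E p = p) (hφ : Matrix.vecMul φ E = φ) (hφp : φ ⬝ᵥ p = 1)
    (h : IdemFree n (E - Matrix.vecMulVec p φ)) : IdemFree (n + 1) E := by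
  obtain ⟨X, Y, hXY, hYX⟩ := h
  have hφ0 : Matrix.vecMul φ (E - Matrix.vecMulVec p φ) = 0 := by
    rw [Matrix.vecMul_sub, hφ, Matrix.vecMul_vecMulVec, hφp, one_smul, sub_self]
  have hp0 : Matrix.mulVec (E - Matrix.vecMulVec p φ) p = 0 := by
    rw [Matrix.sub_mulVec, hp, Matrix.vecMulVec_mulVec, hφp]
    simp
  have hφX : Matrix.vecMul φ X = 0 := by
    have : X = X * Y * X := by rw [Matrix.mul_assoc, hYX, Matrix.mul_one]
    rw [this, hXY, ← Matrix.vecMul_vecMul, hφ0, Matrix.zero_vecMul]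
  have hYp : Matrix.mulVec Y p = 0 := by
    have : Y = Y * (X * Y) := by rw [← Matrix.mul_assoc, hYX, Matrix.one_mul]
    rw [this, hXY, ← Matrix.mulVec_mulVec, hp0, Matrix.mulVec_zero]
  refine ⟨Matrix.of fun i k => (Fin.cons (p i) fun l => X i l : Fin (n + 1) → B) k,
    Matrix.of fun k j => (Fin.cons (φ j) fun l => Y l j : Fin (n + 1) → B) k, ?_, ?_⟩
  · ext i j
    have := congrFun (congrFun hXY i) j
    simp only [Matrix.mul_apply, Matrix.sub_apply, Matrix.vecMulVec_apply] at this
    simp only [Matrix.mul_apply, Matrix.of_apply, Fin.sum_univ_succ, Fin.cons_zero, Fin.cons_succ,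
      this]
    ring
  · ext a b
    rw [Matrix.mul_apply]
    refine Fin.cases ?_ (fun a => ?_) a <;> refine Fin.cases ?_ (fun b => ?_) b
    · simpa [dotProduct] using hφp
    · simpa [Matrix.vecMul, dotProduct, Matrix.one_apply, (Fin.succ_ne_zero b).symm]
        using congrFun hφX b
    · simpa [Matrix.mulVec, dotProduct, Matrix.one_apply] using congrFun hYp a
    · have := congrFun (congrFun hYX a) b
      rw [Matrix.mul_apply] at this
      simp only [Matrix.of_apply, Fin.cons_succ]
      rw [this]
      simp [Matrix.one_apply]

/-- Simultaneous avoidance: given for each prime `q` of a finite set a proper submodule `N q`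
containing `q M` and saturated with respect to the complement of `q`, some element avoids
all of them. -/
theorem exists_forall_notMem_of_saturated {C M : Type*} [CommRing C] [AddCommGroup M] [Module C M]
    (S : Finset (Ideal C)) (hS : ∀ q ∈ S, q.IsPrime) (N : Ideal C → Submodule C M)
    (h1 : ∀ q ∈ S, ∀ c ∈ q, ∀ x, c • x ∈ N q)
    (h2 : ∀ q ∈ S, ∀ c ∉ q, ∀ x, c • x ∈ N q → x ∈ N q)
    (h3 : ∀ q ∈ S, ∃ x, x ∉ N q) : ∃ x, ∀ q ∈ S, x ∉ N q := by
  classical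
  induction hn : S.card generalizing S with
  | zero =>
    rw [Finset.card_eq_zero] at hn
    exact ⟨0, by simp [hn]⟩
  | succ k ih =>
    obtain ⟨q, hq⟩ := S.exists_minimal (Finset.card_pos.1 (by omega))
    have hsub : ∀ a ∈ S.erase q, a ∈ S := fun a ha => Finset.mem_of_mem_erase ha
    obtain ⟨x, hx⟩ := ih (S.erase q) (fun a ha => hS a (hsub a ha)) (fun a ha => h1 a (hsub a ha))
      (fun a ha => h2 a (hsub a ha)) (fun a ha => h3 a (hsub a ha))
      (by rw [Finset.card_erase_of_mem hq.1]; omega)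
    by_cases hxq : x ∈ N q
    · obtain ⟨y, hy⟩ := h3 q hq.1
      have hprod : ¬ (S.erase q).prod id ≤ q := by
        intro hle
        obtain ⟨a, ha, hle⟩ := ((hS q hq.1).prod_le).1 hle
        exact Finset.ne_of_mem_erase ha (le_antisymm hle (hq.2 (hsub a ha) hle))
      obtain ⟨b, hb, hbq⟩ := SetLike.not_le_iff_exists.1 hprod
      refine ⟨x + b • y, fun a ha hmem => ?_⟩
      by_cases haq : a = q
      · subst haq
        exact hy (h2 a ha b hbq y ((Submodule.add_mem_iff_right _ hxq).1 hmem))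
      · have ha' : a ∈ S.erase q := Finset.mem_erase.2 ⟨haq, ha⟩
        have hba : b ∈ a := (Ideal.prod_le_inf.trans (Finset.inf_le ha')) hb
        exact hx a ha' ((Submodule.add_mem_iff_left _ (h1 a ha b hba y)).1 hmem)
    · refine ⟨x, fun a ha => ?_⟩
      by_cases haq : a = q
      · rwa [haq]
      · exact hx a (Finset.mem_erase.2 ⟨haq, ha⟩)

theorem Ideal.isMaximal_of_mem_minimalPrimes_of_krullDimLE_one {C : Type*} [CommRing C]
    [Ring.KrullDimLE 1 C] {I : Ideal C} (hI : ∀ q ∈ minimalPrimes C, ¬ I ≤ q) {q : Ideal C}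
    [hq : q.IsPrime] (h : I ≤ q) : q.IsMaximal :=
  ((Ring.krullDimLE_one_iff.1 ‹_›) q hq).resolve_left fun h' => hI q h' h

theorem Ideal.mem_minimalPrimes_of_krullDimLE_one {C : Type*} [CommRing C]
    [Ring.KrullDimLE 1 C] {I : Ideal C} (hI : ∀ q ∈ minimalPrimes C, ¬ I ≤ q) {q : Ideal C}
    [hq : q.IsPrime] (h : I ≤ q) : q ∈ I.minimalPrimes := by
  obtain ⟨q', hq', hle⟩ := Ideal.exists_minimalPrimes_le h
  have := hq'.1.1
  have := Ideal.isMaximal_of_mem_minimalPrimes_of_krullDimLE_one hI hq'.1.2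
  rwa [← this.eq_of_le hq.ne_top hle]

/-- Over a one-dimensional Noetherian ring the image of an idempotent matrix of rank at least two
contains a unimodular element. -/
theorem OrientedIdem.exists_unimodular {C ι : Type*} [CommRing C] [IsNoetherianRing C]
    [Ring.KrullDimLE 1 C] [Fintype ι] {n : ℕ} {E : Matrix ι ι C} (h : OrientedIdem (n + 2) E) :
    ∃ p φ : ι → C, Matrix.mulVec E p = p ∧ Matrix.vecMul φ E = φ ∧ φ ⬝ᵥ p = 1 := by
  classical
  suffices H : ∃ x : ι → C, ∀ q : Ideal C, q.IsMaximal → ∃ i, Matrix.mulVec E x i ∉ q by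
    obtain ⟨x, hx⟩ := H
    have : Ideal.span (Set.range (Matrix.mulVec E x)) = ⊤ := by
      by_contra H
      obtain ⟨q, hq, hle⟩ := Ideal.exists_le_maximal _ H
      obtain ⟨i, hi⟩ := hx q hq
      exact hi (hle (Ideal.subset_span ⟨i, rfl⟩))
    rw [Ideal.eq_top_iff_one, Ideal.span, Submodule.mem_span_range_iff_exists_fun] at this
    obtain ⟨c, hc⟩ := this
    have hc' : c ⬝ᵥ Matrix.mulVec E x = 1 := hc
    refine ⟨Matrix.mulVec E x, Matrix.vecMul c E, ?_, ?_, ?_⟩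
    · rw [Matrix.mulVec_mulVec, h.1]
    · rw [Matrix.vecMul_vecMul, h.1]
    · rw [← Matrix.dotProduct_mulVec, Matrix.mulVec_mulVec, h.1, hc']
  have hcol : ∀ j, Matrix.mulVec E (Pi.single j 1) = fun i => E i j := fun j => by
    ext i; simp
  have hfinmin : (minimalPrimes C).Finite := minimalPrimes.finite_of_isNoetherianRing C
  let N : Ideal C → Submodule C (ι → C) := fun q =>
    { carrier := {x | ∀ i, Matrix.mulVec E x i ∈ q}
      add_mem' := fun {x y} hx hy i => by
        rw [Matrix.mulVec_add]; exact q.add_mem (hx i) (hy i)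
      zero_mem' := fun i => by rw [Matrix.mulVec_zero]; exact q.zero_mem
      smul_mem' := fun c x hx i => by
        rw [Matrix.mulVec_smul]; exact q.mul_mem_left c (hx i) }
  have hN : ∀ q x, x ∈ N q ↔ ∀ i, Matrix.mulVec E x i ∈ q := fun q x => Iff.rfl
  have hN1 : ∀ q : Ideal C, ∀ c ∈ q, ∀ x, c • x ∈ N q := fun q c hc x => by
    rw [hN]
    intro i
    rw [Matrix.mulVec_smul]
    exact q.mul_mem_right _ hc
  have hN2 : ∀ q : Ideal C, q.IsPrime → ∀ c ∉ q, ∀ x, c • x ∈ N q → x ∈ N q :=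
    fun q hq c hc x hx => by
      rw [hN] at hx ⊢
      intro i
      have := hx i
      rw [Matrix.mulVec_smul] at this
      exact (hq.mem_or_mem this).resolve_left hc
  have hN3 : ∀ q : Ideal C, q.IsPrime → ∃ x, x ∉ N q := fun q hq => by
    by_contra! H
    obtain ⟨f, g, hfg⟩ := h.exists_minor_notMem q hq.ne_top
    apply hfg
    rw [Matrix.det_succ_column_zero]
    refine Ideal.sum_mem _ fun i _ => Ideal.mul_mem_right _ _ (Ideal.mul_mem_left _ _ ?_)
    have := (hN _ _).1 (H (Pi.single (g 0) 1)) (f i)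
    rwa [hcol] at this
  obtain ⟨x, hx⟩ := exists_forall_notMem_of_saturated hfinmin.toFinset
    (fun q hq => (hfinmin.mem_toFinset.1 hq).1.1) N (fun q _ => hN1 q)
    (fun q hq => hN2 q (hfinmin.mem_toFinset.1 hq).1.1)
    (fun q hq => hN3 q (hfinmin.mem_toFinset.1 hq).1.1)
  set p := Matrix.mulVec E x with hp
  let I1 : Ideal C := Ideal.span (Set.range p)
  have hI1le : ∀ q : Ideal C, I1 ≤ q ↔ ∀ i, p i ∈ q := fun q => by
    rw [Ideal.span_le, Set.range_subset_iff]; rfl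
  have hI1 : ∀ q ∈ minimalPrimes C, ¬ I1 ≤ q := fun q hq hle =>
    hx q (hfinmin.mem_toFinset.2 hq) ((hI1le q).1 hle)
  have hF1 : I1.minimalPrimes.Finite := Ideal.finite_minimalPrimes_of_isNoetherianRing C I1
  let N2 : Ideal C → Submodule C (ι → C) := fun q =>
    { carrier := {y | ∀ i j, p i * Matrix.mulVec E y j - p j * Matrix.mulVec E y i ∈ q}
      add_mem' := fun {y z} hy hz i j => by
        rw [Matrix.mulVec_add, Pi.add_apply, Pi.add_apply]
        have := q.add_mem (hy i j) (hz i j)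
        ring_nf at this ⊢
        exact this
      zero_mem' := fun i j => by rw [Matrix.mulVec_zero]; simp
      smul_mem' := fun c y hy i j => by
        rw [Matrix.mulVec_smul, Pi.smul_apply, Pi.smul_apply, smul_eq_mul, smul_eq_mul]
        have := q.mul_mem_left c (hy i j)
        ring_nf at this ⊢
        exact this }
  have hN' : ∀ q x, x ∈ N2 q ↔
    ∀ i j, p i * Matrix.mulVec E x j - p j * Matrix.mulVec E x i ∈ q := fun q x => Iff.rfl
  let N' : Ideal C → Submodule C (ι → C) := fun q => if I1 ≤ q then N q else N2 q
  obtain ⟨y, hy⟩ := exists_forall_notMem_of_saturated (hfinmin.toFinset ∪ hF1.toFinset)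
    (fun q hq => by
      rcases Finset.mem_union.1 hq with hq | hq
      · exact (hfinmin.mem_toFinset.1 hq).1.1
      · exact (hF1.mem_toFinset.1 hq).1.1) N'
    (fun q hq c hc y => by
      by_cases hle : I1 ≤ q
      · simp only [N', if_pos hle]
        exact hN1 q c hc y
      · simp only [N', if_neg hle]
        rw [hN']
        intro i j
        rw [Matrix.mulVec_smul, Pi.smul_apply, Pi.smul_apply, smul_eq_mul, smul_eq_mul]
        exact q.sub_mem (q.mul_mem_left _ (q.mul_mem_right _ hc))
          (q.mul_mem_left _ (q.mul_mem_right _ hc)))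
    (fun q hq c hc y hcy => by
      have hqp : q.IsPrime := by
        rcases Finset.mem_union.1 hq with hq | hq
        · exact (hfinmin.mem_toFinset.1 hq).1.1
        · exact (hF1.mem_toFinset.1 hq).1.1
      by_cases hle : I1 ≤ q
      · simp only [N', if_pos hle] at hcy ⊢
        exact hN2 q hqp c hc y hcy
      · simp only [N', if_neg hle] at hcy ⊢
        rw [hN'] at hcy ⊢
        intro i j
        have := hcy i j
        rw [Matrix.mulVec_smul, Pi.smul_apply, Pi.smul_apply, smul_eq_mul, smul_eq_mul] at this
        refine (hqp.mem_or_mem (?_ : c * _ ∈ q)).resolve_left hc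
        convert this using 1
        ring)
    (fun q hq => by
      have hqp : q.IsPrime := by
        rcases Finset.mem_union.1 hq with hq | hq
        · exact (hfinmin.mem_toFinset.1 hq).1.1
        · exact (hF1.mem_toFinset.1 hq).1.1
      by_cases hle : I1 ≤ q
      · simp only [N', if_pos hle]
        exact hN3 q hqp
      · simp only [N', if_neg hle]
        by_contra! H
        rw [hI1le] at hle
        push Not at hle
        obtain ⟨i, hi⟩ := hle
        obtain ⟨f, g, hfg⟩ := h.exists_minor_notMem q hqp.ne_top
        refine hfg ((hqp.mem_or_mem (?_ : (p i) ^ (n + 2) * _ ∈ q)).resolve_left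
          fun h' => hi (hqp.mem_of_pow_mem _ h'))
        have h1 := Matrix.det_smul (E.submatrix f g) (p i)
        rw [Fintype.card_fin] at h1
        rw [← h1, ← Ideal.Quotient.eq_zero_iff_mem, RingHom.map_det]
        have h2 : (Ideal.Quotient.mk q).mapMatrix (p i • E.submatrix f g) = Matrix.vecMulVec
            (fun k => Ideal.Quotient.mk q (p (f k)))
            (fun k => Ideal.Quotient.mk q (E i (g k))) := by
          ext a b
          have := (hN' _ _).1 (H (Pi.single (g b) 1)) i (f a)
          rw [hcol] at this
          simp only [RingHom.mapMatrix_apply, Matrix.map_apply, Matrix.smul_apply,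
            Matrix.submatrix_apply, smul_eq_mul, Matrix.vecMulVec_apply, ← map_mul]
          exact Ideal.Quotient.eq.2 this
        rw [h2, Matrix.det_vecMulVec])
  set p' := Matrix.mulVec E y with hp'
  have hy1 : ∀ q : Ideal C, q.IsPrime → I1 ≤ q → ∃ i, p' i ∉ q := fun q hq hle => by
    have := hy q (Finset.mem_union_right _ (hF1.mem_toFinset.2
      (Ideal.mem_minimalPrimes_of_krullDimLE_one hI1 hle)))
    simp only [N', if_pos hle] at this
    rw [hN] at this
    push Not at this
    exact this
  let I2 : Ideal C := Ideal.span (Set.range fun ij : ι × ι => p ij.1 * p' ij.2 - p ij.2 * p' ij.1)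
  have hI2le : ∀ q : Ideal C, I2 ≤ q ↔ ∀ i j, p i * p' j - p j * p' i ∈ q := fun q => by
    rw [Ideal.span_le, Set.range_subset_iff, Prod.forall]; rfl
  have hI2 : ∀ q ∈ minimalPrimes C, ¬ I2 ≤ q := fun q hq hle => by
    have := hy q (Finset.mem_union_left _ (hfinmin.mem_toFinset.2 hq))
    simp only [N', if_neg (hI1 q hq)] at this
    exact this ((hI2le q).1 hle)
  have hF2 : I2.minimalPrimes.Finite := Ideal.finite_minimalPrimes_of_isNoetherianRing C I2
  let F := hF2.toFinset.filter fun q => ¬ I1 ≤ q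
  obtain ⟨a, haF, haI⟩ : ∃ a ∈ F.inf id, ∀ q ∈ hF1.toFinset, a ∉ q := by
    by_contra! H
    have hsub : ((F.inf id : Ideal C) : Set C) ⊆ ⋃ q ∈ (hF1.toFinset : Set (Ideal C)), q := by
      intro a ha
      obtain ⟨q, hq, haq⟩ := H a ha
      exact Set.mem_biUnion (Finset.mem_coe.2 hq) haq
    obtain ⟨q, hq, hle⟩ := (Ideal.subset_union_prime (R := C) (s := hF1.toFinset)
      (f := fun q => q) ⊤ ⊤
      (fun q hq _ _ => (hF1.mem_toFinset.1 hq).1.1)).1 hsub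
    have hqp : q.IsPrime := (hF1.mem_toFinset.1 hq).1.1
    obtain ⟨q', hq', hle'⟩ := hqp.inf_le'.1 hle
    rw [Finset.mem_filter, hF2.mem_toFinset] at hq'
    have := hq'.1.1.1
    have hmax := Ideal.isMaximal_of_mem_minimalPrimes_of_krullDimLE_one hI2 hq'.1.1.2
    have heq := hmax.eq_of_le hqp.ne_top hle'
    exact hq'.2 (heq ▸ (hF1.mem_toFinset.1 hq).1.2)
  refine ⟨x + a • y, fun q hq => ?_⟩
  by_contra! H
  have hmem : ∀ i, p i + a * p' i ∈ q := fun i => by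
    have := H i
    rwa [Matrix.mulVec_add, Matrix.mulVec_smul] at this
  have hqp := hq.isPrime
  have hI2q : I2 ≤ q := (hI2le q).2 fun i j => by
    have := q.sub_mem (q.mul_mem_left (p' j) (hmem i)) (q.mul_mem_left (p' i) (hmem j))
    ring_nf at this ⊢
    exact this
  by_cases hle : I1 ≤ q
  · obtain ⟨i, hi⟩ := hy1 q hqp hle
    have haq := haI q (hF1.mem_toFinset.2 (Ideal.mem_minimalPrimes_of_krullDimLE_one hI1 hle))
    exact (hqp.mem_or_mem ((q.add_mem_iff_right ((hI1le q).1 hle i)).1 (hmem i))).elim haq hi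
  · have hqF : q ∈ F := Finset.mem_filter.2
      ⟨hF2.mem_toFinset.2 (Ideal.mem_minimalPrimes_of_krullDimLE_one hI2 hI2q), hle⟩
    have haq : a ∈ q := (Finset.inf_le (f := id) hqF) haF
    exact hle ((hI1le q).2 fun i => (q.add_mem_iff_left (q.mul_mem_right _ haq)).1 (hmem i))

/-- The splitting theorem of Serre in dimension one. -/
theorem OrientedIdem.idemFree_of_krullDimLE_one {C ι : Type*} [CommRing C] [IsNoetherianRing C]
    [Ring.KrullDimLE 1 C] [Fintype ι] {n : ℕ} {E : Matrix ι ι C} (h : OrientedIdem (n + 1) E) :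
    IdemFree (n + 1) E := by
  induction n generalizing E with
  | zero => exact h.idemFree_one
  | succ n ih =>
    obtain ⟨p, φ, hp, hφ, hφp⟩ := h.exists_unimodular
    exact (ih (h.sub_vecMulVec hp hφ hφp)).of_sub_vecMulVec hp hφ hφp

/-- Semilocal rings have stable range one. -/
theorem exists_isUnit_add_mul_of_finite_maximalSpectrum {W : Type*} [CommRing W]
    [Finite (MaximalSpectrum W)] {a b : W} (h : IsCoprime a b) : ∃ t, IsUnit (a + t * b) := by
  classical
  obtain ⟨t, ht⟩ := Ideal.exists_forall_sub_mem_ideal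
    (I := fun q : MaximalSpectrum W => q.asIdeal) (fun i j hij =>
      have := i.isMaximal
      have := j.isMaximal
      Ideal.isCoprime_of_isMaximal fun h => hij (MaximalSpectrum.ext h))
    (fun q => if a ∈ q.asIdeal then 1 else 0)
  refine ⟨t, ?_⟩
  by_contra H
  obtain ⟨q, hq, hmem⟩ := exists_max_ideal_of_mem_nonunits H
  have hqp := hq.isPrime
  have ht' := ht ⟨q, hq⟩
  obtain ⟨x, y, hxy⟩ := h
  by_cases ha : a ∈ q
  · simp only [ha, if_true] at ht'
    have hb : b ∈ q := by
      have h1 := (q.add_mem_iff_right ha).1 hmem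
      have h2 := q.sub_mem h1 (q.mul_mem_right b ht')
      ring_nf at h2
      exact h2
    exact hq.ne_top ((Ideal.eq_top_iff_one _).2
      (hxy ▸ q.add_mem (q.mul_mem_left _ ha) (q.mul_mem_left _ hb)))
  · simp only [ha, if_false, sub_zero] at ht'
    exact ha ((q.add_mem_iff_left (q.mul_mem_right _ ht')).1 hmem)

/-- Matrices of determinant one that lift to matrices of determinant one. -/
def liftableSL {W V : Type*} [CommRing W] [CommRing V] (π : W →+* V) (n : ℕ) :
    Submonoid (Matrix (Fin n) (Fin n) V) where
  carrier := {M | ∃ H : Matrix (Fin n) (Fin n) W, H.det = 1 ∧ H.map π = M}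
  one_mem' := ⟨1, Matrix.det_one, Matrix.map_one _ (map_zero π) (map_one π)⟩
  mul_mem' := by
    rintro _ _ ⟨H, h1, rfl⟩ ⟨H', h2, rfl⟩
    exact ⟨H * H', by rw [Matrix.det_mul, h1, h2, one_mul], Matrix.map_mul⟩

section

variable {W V : Type*} [CommRing W] [CommRing V] {π : W →+* V} {n : ℕ}

theorem one_add_vecMulVec_mem_liftableSL (hπ : Function.Surjective π) {s t : Fin n → V}
    (h : ∀ i, s i = 0 ∨ t i = 0) : 1 + Matrix.vecMulVec s t ∈ liftableSL π n := by
  classical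
  have key : ∀ s : Fin n → V, ∃ s' : Fin n → W, ∀ i, π (s' i) = s i ∧ (s i = 0 → s' i = 0) := by
    intro s
    choose g hg using hπ
    refine ⟨fun i => if s i = 0 then 0 else g (s i), fun i => ?_⟩
    by_cases hi : s i = 0 <;> simp [hi, hg]
  obtain ⟨s', hs'⟩ := key s
  obtain ⟨t', ht'⟩ := key t
  refine ⟨1 + Matrix.vecMulVec s' t', ?_, ?_⟩
  · rw [Matrix.vecMulVec_eq Unit, Matrix.det_one_add_replicateCol_mul_replicateRow]
    have : t' ⬝ᵥ s' = 0 := Finset.sum_eq_zero fun i _ => by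
      rcases h i with h | h
      · rw [(hs' i).2 h, mul_zero]
      · rw [(ht' i).2 h, zero_mul]
    rw [this, add_zero]
  · ext i j
    by_cases hij : i = j <;>
    simp [Matrix.vecMulVec_apply, (hs' _).1, (ht' _).1, hij]

theorem mem_liftableSL_of_mul_left_mem {L M : Matrix (Fin n) (Fin n) V}
    (hL : ∃ L', L' ∈ liftableSL π n ∧ L' * L = 1) (h : L * M ∈ liftableSL π n) :
    M ∈ liftableSL π n := by
  obtain ⟨L', hL', h1⟩ := hL
  have := mul_mem hL' h
  rwa [← Matrix.mul_assoc, h1, Matrix.one_mul] at this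

theorem mem_liftableSL_of_vecMulVec (hπ : Function.Surjective π) {s t : Fin n → V}
    {M : Matrix (Fin n) (Fin n) V}
    (hst : ∀ i, s i = 0 ∨ t i = 0) (h : (1 + Matrix.vecMulVec s t) * M ∈ liftableSL π n) :
    M ∈ liftableSL π n := by
  refine mem_liftableSL_of_mul_left_mem ⟨1 + Matrix.vecMulVec (-s) t,
    one_add_vecMulVec_mem_liftableSL hπ fun i => ?_, ?_⟩ h
  · simpa using hst i
  · have : t ⬝ᵥ s = 0 := Finset.sum_eq_zero fun i _ => by
      rcases hst i with h | h <;> simp [h]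
    rw [mul_add, add_mul, add_mul, Matrix.vecMulVec_mul_vecMulVec, this]
    simp [Matrix.neg_vecMulVec]

theorem mem_liftableSL_of_vecMulVec_right (hπ : Function.Surjective π) {s t : Fin n → V}
    {M : Matrix (Fin n) (Fin n) V}
    (hst : ∀ i, s i = 0 ∨ t i = 0) (h : M * (1 + Matrix.vecMulVec s t) ∈ liftableSL π n) :
    M ∈ liftableSL π n := by
  have h' : (1 + Matrix.vecMulVec (-s) t) ∈ liftableSL π n :=
    one_add_vecMulVec_mem_liftableSL hπ fun i => by simpa using hst i
  have := mul_mem h h'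
  have h0 : t ⬝ᵥ s = 0 := Finset.sum_eq_zero fun i _ => by
    rcases hst i with h | h <;> simp [h]
  rw [Matrix.mul_assoc, mul_add (1 + _), add_mul, add_mul, Matrix.vecMulVec_mul_vecMulVec,
    dotProduct_neg, h0] at this
  simpa [Matrix.neg_vecMulVec] using this

theorem mem_liftableSL_of_det_eq_one [Finite (MaximalSpectrum V)] (hπ : Function.Surjective π)
    (M : Matrix (Fin n) (Fin n) V) (hM : M.det = 1) : M ∈ liftableSL π n := by
  classical
  induction n with
  | zero => rw [Subsingleton.elim M 1]; exact one_mem _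
  | succ n ih =>
  -- the case of a trivial first row and column
  have h3 : ∀ M : Matrix (Fin (n + 1)) (Fin (n + 1)) V, M.det = 1 → M 0 0 = 1 →
      (∀ i : Fin n, M i.succ 0 = 0) → (∀ i : Fin n, M 0 i.succ = 0) → M ∈ liftableSL π (n + 1) := by
    intro M hM h00 hc hr
    have hdet : (M.submatrix Fin.succ Fin.succ).det = 1 := by
      rw [Matrix.det_succ_column_zero, Fin.sum_univ_succ] at hM
      simp only [hc, h00] at hM
      simpa using hM
    obtain ⟨H, hH1, hH2⟩ := ih _ hdet
    let H' : Matrix (Fin (n + 1)) (Fin (n + 1)) W := Matrix.of fun i j =>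
      (Fin.cases (Fin.cases 1 (fun _ => 0) j) (fun i => Fin.cases 0 (fun j => H i j) j) i : W)
    have hs : H'.submatrix Fin.succ Fin.succ = H := rfl
    refine ⟨H', ?_, ?_⟩
    · rw [Matrix.det_succ_column_zero, Fin.sum_univ_succ]
      have : ∀ i : Fin n, H' i.succ 0 = 0 := fun _ => rfl
      have h0 : H' 0 0 = 1 := rfl
      simp only [this, h0, Fin.succAbove_zero, hs, hH1]
      simp
    · ext i j
      refine Fin.cases (Fin.cases ?_ (fun j => ?_) j) (fun i => Fin.cases ?_ (fun j => ?_) j) i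
      · simp [H', h00]
      · simp [H', hr]
      · simp [H', hc]
      · simpa [H'] using congrFun (congrFun hH2 i) j
  have hdet1 : ∀ s t : Fin (n + 1) → V, (∀ i, s i = 0 ∨ t i = 0) →
      (1 + Matrix.vecMulVec s t).det = 1 := fun s t hst => by
    rw [Matrix.vecMulVec_eq Unit, Matrix.det_one_add_replicateCol_mul_replicateRow]
    have : t ⬝ᵥ s = 0 := Finset.sum_eq_zero fun i _ => by
      rcases hst i with h | h <;> simp [h]
    rw [this, add_zero]
  have hmul : ∀ (M : Matrix (Fin (n + 1)) (Fin (n + 1)) V) (s t : Fin (n + 1) → V) i j,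
      ((1 + Matrix.vecMulVec s t) * M) i j = M i j + s i * ∑ k, t k * M k j := by
    intro M s t i j
    rw [add_mul, Matrix.vecMulVec_mul, Matrix.one_mul]
    rfl
  have hmul' : ∀ (M : Matrix (Fin (n + 1)) (Fin (n + 1)) V) (s t : Fin (n + 1) → V) i j,
      (M * (1 + Matrix.vecMulVec s t)) i j = M i j + (∑ k, M i k * s k) * t j := by
    intro M s t i j
    rw [mul_add, Matrix.mul_vecMulVec, Matrix.mul_one]
    rfl
  -- the case of a corner equal to one
  have h2 : ∀ M : Matrix (Fin (n + 1)) (Fin (n + 1)) V, M.det = 1 → M 0 0 = 1 →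
      M ∈ liftableSL π (n + 1) := by
    intro M hM h00
    have hst : ∀ i, (Fin.cons 0 fun i : Fin n => - M i.succ 0 : Fin (n + 1) → V) i = 0 ∨
        (Pi.single 0 1 : Fin (n + 1) → V) i = 0 := Fin.cases (by simp) (by simp)
    have hst' : ∀ i, (Pi.single 0 1 : Fin (n + 1) → V) i = 0 ∨
      (Fin.cons 0 fun i : Fin n => - M 0 i.succ : Fin (n + 1) → V) i = 0 :=
        Fin.cases (by simp) (by simp)
    refine mem_liftableSL_of_vecMulVec hπ hst ?_
    refine mem_liftableSL_of_vecMulVec_right hπ hst' (h3 _ ?_ ?_ ?_ ?_)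
    · rw [Matrix.det_mul, Matrix.det_mul, hdet1 _ _ hst, hdet1 _ _ hst', hM, one_mul, one_mul]
    · simp [hmul, hmul', h00]
    · intro i
      simp [hmul, hmul', h00, Pi.single_apply]
    · intro i
      simp [hmul, hmul', h00, Pi.single_apply]
  -- the case of a unit corner
  have h1 : ∀ M : Matrix (Fin (n + 1)) (Fin (n + 1)) V, M.det = 1 → IsUnit (M 0 0) →
      M ∈ liftableSL π (n + 1) := by
    intro M hM hu
    obtain ⟨u, hu⟩ := hu
    rcases n with _ | n
    · exact h2 M hM (by simpa using hM)
    have hst : ∀ i, (Pi.single 1 1 : Fin (n + 2) → V) i = 0 ∨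
      (Pi.single 0 (↑u⁻¹ * (1 - M 1 0)) : Fin (n + 2) → V) i = 0 := by
      refine Fin.cases (Or.inl (by simp)) fun i => Or.inr (by simp)
    have hst' : ∀ i, (Pi.single 0 1 : Fin (n + 2) → V) i = 0 ∨
      (Pi.single 1 (1 - M 0 0) : Fin (n + 2) → V) i = 0 := by
      refine Fin.cases (Or.inr (by simp)) fun i => Or.inl (by simp)
    refine mem_liftableSL_of_vecMulVec hπ hst (mem_liftableSL_of_vecMulVec hπ hst' (h2 _ ?_ ?_))
    · rw [Matrix.det_mul, Matrix.det_mul, hdet1 _ _ hst, hdet1 _ _ hst', hM, one_mul, one_mul]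
    · simp only [hmul, ← hu, Pi.single_apply, ite_mul, zero_mul, Finset.sum_ite_eq',
        Finset.mem_univ, if_true]
      have : (↑u⁻¹ : V) * ↑u = 1 := u.inv_mul
      simp only [zero_ne_one, if_false]
      linear_combination (1 - (u : V)) * (1 - M 1 0) * this
  have hcop : IsCoprime (M 0 0) (∑ i : Fin n, M.adjugate 0 i.succ * M i.succ 0) := by
    refine ⟨M.adjugate 0 0, 1, ?_⟩
    have := congrFun (congrFun (Matrix.adjugate_mul M) 0) 0
    rw [hM, Matrix.mul_apply, Fin.sum_univ_succ] at this
    simpa using this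
  obtain ⟨t, ht⟩ := exists_isUnit_add_mul_of_finite_maximalSpectrum hcop
  have hst : ∀ i, (Pi.single 0 1 : Fin (n + 1) → V) i = 0 ∨
      (Fin.cons 0 fun i : Fin n => t * M.adjugate 0 i.succ : Fin (n + 1) → V) i = 0 :=
    Fin.cases (by simp) (by simp)
  refine mem_liftableSL_of_vecMulVec hπ hst (h1 _ ?_ ?_)
  · rw [Matrix.det_mul, hdet1 _ _ hst, hM, one_mul]
  · rw [hmul, Fin.sum_univ_succ]
    convert ht using 1
    simp [Finset.mul_sum, mul_assoc]

end

open Polynomial in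
/-- The multiplicative set of values at `z` of monic polynomials over `B₀`. -/
noncomputable def monicValues (B₀ : Type*) {B : Type*} [CommRing B₀] [CommRing B] [Algebra B₀ B]
    (z : B) : Submonoid B where
  carrier := {b | ∃ g : B₀[X], g.Monic ∧ aeval z g = b}
  one_mem' := ⟨1, monic_one, map_one _⟩
  mul_mem' := by
    rintro _ _ ⟨g, hg, rfl⟩ ⟨h, hh, rfl⟩
    exact ⟨g * h, hg.mul hh, map_mul _ _ _⟩

/-- A filtration of a `B₀`-algebra `B` which behaves like the degree filtration of a finite
extension of a polynomial ring `B₀[z]` with `z` of degree `d`. -/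
structure IsHorrocksFiltration {B₀ B : Type*} [CommRing B₀] [CommRing B] [Algebra B₀ B]
    (d : ℕ) (z : B) (F : ℕ → Submodule B₀ B) : Prop where
  d_pos : 0 < d
  mono : Monotone F
  exhaust : ∀ b, ∃ k, b ∈ F k
  one_mem : 1 ∈ F 0
  mul_mem : ∀ {i j a b}, a ∈ F i → b ∈ F j → a * b ∈ F (i + j)
  z_mem : z ∈ F d
  div : ∀ {k b}, b ∈ F (d + (k + 1)) → ∃ q ∈ F (k + 1), b - z * q ∈ F (d + k)
  fg : ∀ k, (F k).FG

namespace IsHorrocksFiltration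

open Polynomial

variable {B₀ B : Type*} [CommRing B₀] [CommRing B] [Algebra B₀ B]
  {d : ℕ} {z : B} {F : ℕ → Submodule B₀ B}

theorem pow_mem (h : IsHorrocksFiltration d z F) (m : ℕ) : z ^ m ∈ F (d * m) := by
  induction m with
  | zero => simpa using h.one_mem
  | succ m ih =>
    rw [pow_succ, Nat.mul_succ]
    exact h.mul_mem ih h.z_mem

theorem aeval_mem (h : IsHorrocksFiltration d z F) {g : B₀[X]} {m : ℕ} (hg : g.natDegree ≤ m) :
    aeval z g ∈ F (d * m) := by
  rw [aeval_eq_sum_range]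
  refine Submodule.sum_mem _ fun i hi => Submodule.smul_mem _ _ ?_
  rw [Finset.mem_range] at hi
  exact h.mono (Nat.mul_le_mul_left d (by omega)) (h.pow_mem i)

theorem div_pow (h : IsHorrocksFiltration d z F) (m : ℕ) {k : ℕ} {b : B}
    (hb : b ∈ F (d * m + (k + 1))) : ∃ q ∈ F (k + 1), b - z ^ m * q ∈ F (d * m + k) := by
  induction m generalizing b with
  | zero => exact ⟨b, by simpa using hb, by simp⟩
  | succ m ih =>
    obtain ⟨q1, hq1, h1⟩ := h.div (k := d * m + k) (b := b) (h.mono (by rw [Nat.mul_succ]; omega) hb)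
    obtain ⟨q, hq, h2⟩ := ih (h.mono (by omega) hq1)
    refine ⟨q, hq, ?_⟩
    have h3 := Submodule.add_mem _ (h.mono (by rw [Nat.mul_succ]; omega) h1)
      (h.mono (show d + (d * m + k) ≤ d * (m + 1) + k by rw [Nat.mul_succ]; omega)
        (h.mul_mem h.z_mem h2))
    convert h3 using 1
    ring

theorem div_monic (h : IsHorrocksFiltration d z F) {g : B₀[X]} (hg : g.Monic) {k : ℕ} {b : B}
    (hb : b ∈ F (d * g.natDegree + (k + 1))) :
    ∃ q ∈ F (k + 1), b - aeval z g * q ∈ F (d * g.natDegree + k) := by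
  obtain ⟨q, hq, h1⟩ := h.div_pow _ hb
  refine ⟨q, hq, ?_⟩
  rcases Nat.eq_zero_or_pos g.natDegree with h0 | hpos
  · rw [hg.natDegree_eq_zero.1 h0] at h1 ⊢
    simpa using h1
  have hmem : aeval z (g - X ^ g.natDegree) ∈ F (d * (g.natDegree - 1)) := by
    refine h.aeval_mem ?_
    have : g - X ^ g.natDegree = g.eraseLead := by
      rw [← g.self_sub_C_mul_X_pow, hg.leadingCoeff, C_1, one_mul]
    rw [this]
    exact eraseLead_natDegree_le g
  have h2 := h.mono (show _ ≤ d * g.natDegree + k by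
    obtain ⟨m, hm⟩ := Nat.exists_eq_succ_of_ne_zero hpos.ne'
    rw [hm, Nat.succ_sub_one, Nat.succ_eq_add_one, Nat.mul_succ]
    have := h.d_pos
    omega) (h.mul_mem hmem hq)
  have h3 := Submodule.sub_mem _ h1 h2
  convert h3 using 1
  simp only [map_sub, map_pow, aeval_X]
  ring

theorem exists_sub_mul_mem (h : IsHorrocksFiltration d z F) {g : B₀[X]} (hg : g.Monic) (b : B) :
    ∃ q, b - aeval z g * q ∈ F (d * g.natDegree) := by
  suffices H : ∀ k, ∀ b ∈ F (d * g.natDegree + k), ∃ q, b - aeval z g * q ∈ F (d * g.natDegree) by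
    obtain ⟨k, hk⟩ := h.exhaust b
    exact H k b (h.mono (by omega) hk)
  intro k
  induction k with
  | zero => exact fun b hb => ⟨0, by simpa using hb⟩
  | succ k ih =>
    intro b hb
    obtain ⟨q, -, h1⟩ := h.div_monic hg hb
    obtain ⟨q', h2⟩ := ih _ h1
    exact ⟨q + q', by convert h2 using 1; ring⟩

theorem finite [Algebra B₀[X] B] [IsScalarTower B₀ B₀[X] B] (hX : algebraMap B₀[X] B X = z)
    (h : IsHorrocksFiltration d z F) : Module.Finite B₀[X] B := by
  obtain ⟨s, hs⟩ := h.fg d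
  refine ⟨⟨s, ?_⟩⟩
  have hF : (F d : Set B) ⊆ Submodule.span B₀[X] (s : Set B) := by
    rw [← hs]
    exact Submodule.span_subset_span B₀ B₀[X] _
  rw [eq_top_iff]
  intro b _
  obtain ⟨k, hk⟩ := h.exhaust b
  have H : ∀ k, ∀ b ∈ F (d + k), b ∈ Submodule.span B₀[X] (s : Set B) := by
    intro k
    induction k using Nat.strong_induction_on with
    | _ k ih =>
    intro b hb
    rcases k with _ | k
    · exact hF hb
    · obtain ⟨q, hq, h1⟩ := h.div hb
      have hq' : q ∈ Submodule.span B₀[X] (s : Set B) := by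
        have := h.d_pos
        exact ih k (by omega) q (h.mono (by omega) hq)
      have := Submodule.add_mem _ (ih k (by omega) _ h1)
        (Submodule.smul_mem _ (X : B₀[X]) hq')
      rw [Algebra.smul_def, hX] at this
      simpa using this
  exact H k b (h.mono (by omega) hk)

/-- A perturbation of a monic value divides a monic value. -/
theorem exists_monic_mem_span [IsLocalRing B₀] (h : IsHorrocksFiltration d z F) {g : B₀[X]}
    (hg : g.Monic) {b : B} (hb : b ∈ IsLocalRing.maximalIdeal B₀ • F (d * g.natDegree)) :
    ∃ p ∈ monicValues B₀ z, p ∈ Ideal.span {aeval z g + b} := by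
  set y := aeval z g + b with hy
  set N : Submodule B₀ B := (Ideal.span {y}).restrictScalars B₀ with hN
  have hyN : ∀ q, y * q ∈ N := fun q => Ideal.mul_mem_right _ _ (Ideal.mem_span_singleton_self y)
  have key : ∀ k, F (d * g.natDegree + k) ≤ N ⊔ F (d * g.natDegree) := by
    intro k
    induction k with
    | zero => exact le_sup_right
    | succ k ih =>
      have : F (d * g.natDegree + (k + 1)) ≤ N ⊔ F (d * g.natDegree + k) := by
        refine Submodule.le_of_le_smul_of_le_jacobson_bot (I := IsLocalRing.maximalIdeal B₀)
          (h.fg _) (IsLocalRing.maximalIdeal_le_jacobson _) ?_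
        intro c hc
        obtain ⟨q, hq, h1⟩ := h.div_monic hg hc
        have h2 : b * q ∈ IsLocalRing.maximalIdeal B₀ • F (d * g.natDegree + (k + 1)) := by
          refine Submodule.smul_induction_on hb (fun r hr n hn => ?_) (fun x y hx hy => ?_)
          · rw [smul_mul_assoc]
            exact Submodule.smul_mem_smul hr (h.mul_mem hn hq)
          · rw [add_mul]
            exact Submodule.add_mem _ hx hy
        have h3 : c = (y * q + (c - aeval z g * q)) - b * q := by rw [hy]; ring
        rw [h3]
        exact Submodule.sub_mem _ (Submodule.mem_sup_left (Submodule.add_mem_sup (hyN q) h1))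
          (Submodule.mem_sup_right h2)
      exact this.trans (sup_le le_sup_left ih)
  have htop : N ⊔ F (d * g.natDegree) = ⊤ := by
    rw [eq_top_iff]
    intro c _
    obtain ⟨k, hk⟩ := h.exhaust c
    exact key k (h.mono (by omega) hk)
  have hfin : Module.Finite B₀ (B ⧸ Ideal.span {y}) := by
    refine ⟨?_⟩
    have hmap : (F (d * g.natDegree)).map (Ideal.Quotient.mkₐ B₀ (Ideal.span {y})).toLinearMap
        = ⊤ := by
      rw [eq_top_iff]
      rintro x -
      obtain ⟨c, rfl⟩ := Ideal.Quotient.mk_surjective x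
      obtain ⟨u, hu, f, hf, huf⟩ := Submodule.mem_sup.1 (htop ▸ Submodule.mem_top : c ∈ _)
      refine ⟨f, hf, ?_⟩
      rw [← huf, map_add, Ideal.Quotient.eq_zero_iff_mem.2 hu, zero_add]
      rfl
    rw [← hmap]
    exact (h.fg _).map _
  obtain ⟨p, hp, hp0⟩ := Algebra.IsIntegral.isIntegral (R := B₀)
    (Ideal.Quotient.mk (Ideal.span {y}) z)
  refine ⟨aeval z p, ⟨p, hp, rfl⟩, ?_⟩
  rw [← Ideal.Quotient.eq_zero_iff_mem]
  have h1 : aeval (Ideal.Quotient.mkₐ B₀ (Ideal.span {y}) z) p = 0 := hp0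
  rw [aeval_algHom_apply] at h1
  exact h1

end IsHorrocksFiltration

namespace IsHorrocksFiltration

open Polynomial

variable {B₀ B : Type*} [CommRing B₀] [CommRing B] [Algebra B₀ B]
  {d : ℕ} {z : B} {F : ℕ → Submodule B₀ B}

theorem smul_mul_mem (h : IsHorrocksFiltration d z F) {I : Ideal B₀} {i j : ℕ} {b c : B}
    (hb : b ∈ I • F i) (hc : c ∈ F j) : b * c ∈ I • F (i + j) := by
  refine Submodule.smul_induction_on hb (fun r hr n hn => ?_) (fun x y hx hy => ?_)
  · rw [smul_mul_assoc]
    exact Submodule.smul_mem_smul hr (h.mul_mem hn hc)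
  · rw [add_mul]
    exact Submodule.add_mem _ hx hy

variable {W : Type*} [CommRing W] [Algebra B W] [Algebra B₀ W] [IsScalarTower B₀ B W]

/-- Fractions `b / g(z)` with `g` monic and `b` in `I` times the filtration step of the degree
of `g(z)`. -/
def boundedFractions (h : IsHorrocksFiltration d z F) (W : Type*) [CommRing W] [Algebra B W]
    [Algebra B₀ W] [IsScalarTower B₀ B W] (I : Ideal B₀) : Submodule B₀ W where
  carrier := {w | ∃ g : B₀[X], g.Monic ∧ ∃ b ∈ I • F (d * g.natDegree),
    w * algebraMap B W (aeval z g) = algebraMap B W b}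
  add_mem' := by
    rintro w w' ⟨g, hg, b, hb, hw⟩ ⟨g', hg', b', hb', hw'⟩
    refine ⟨g * g', hg.mul hg', b * aeval z g' + b' * aeval z g, ?_, ?_⟩
    · rw [hg.natDegree_mul hg', mul_add]
      refine Submodule.add_mem _ (h.smul_mul_mem hb (h.aeval_mem le_rfl)) ?_
      rw [add_comm]
      exact h.smul_mul_mem hb' (h.aeval_mem le_rfl)
    · simp only [map_add, map_mul, ← hw, ← hw']
      ring
  zero_mem' := ⟨1, monic_one, 0, Submodule.zero_mem _, by simp⟩
  smul_mem' := by
    rintro c w ⟨g, hg, b, hb, hw⟩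
    refine ⟨g, hg, c • b, Submodule.smul_mem _ _ hb, ?_⟩
    rw [smul_mul_assoc, hw, algebra_compatible_smul B c b, algebra_compatible_smul W c,
      smul_eq_mul, smul_eq_mul, map_mul, ← IsScalarTower.algebraMap_apply]

theorem boundedFractions_mul_mem (h : IsHorrocksFiltration d z F) {I : Ideal B₀} {w w' : W}
    (hw : w ∈ h.boundedFractions W I) (hw' : w' ∈ h.boundedFractions W ⊤) :
    w * w' ∈ h.boundedFractions W I := by
  obtain ⟨g, hg, b, hb, hw⟩ := hw
  obtain ⟨g', hg', b', hb', hw'⟩ := hw'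
  rw [Submodule.top_smul] at hb'
  refine ⟨g * g', hg.mul hg', b * b', ?_, ?_⟩
  · rw [hg.natDegree_mul hg', mul_add]
    exact h.smul_mul_mem hb hb'
  · rw [map_mul, map_mul, map_mul, ← hw, ← hw']
    ring

theorem smul_boundedFractions_le (h : IsHorrocksFiltration d z F) (I : Ideal B₀) :
    I • h.boundedFractions W ⊤ ≤ h.boundedFractions W I := by
  rw [Submodule.smul_le]
  rintro r hr w ⟨g, hg, b, hb, hw⟩
  rw [Submodule.top_smul] at hb
  refine ⟨g, hg, r • b, Submodule.smul_mem_smul hr hb, ?_⟩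
  rw [smul_mul_assoc, hw, algebra_compatible_smul B r b, algebra_compatible_smul W r,
    smul_eq_mul, smul_eq_mul, map_mul, ← IsScalarTower.algebraMap_apply]

theorem boundedFractions_mono (h : IsHorrocksFiltration d z F) {I J : Ideal B₀} (hIJ : I ≤ J) :
    h.boundedFractions W I ≤ h.boundedFractions W J := by
  rintro w ⟨g, hg, b, hb, hw⟩
  exact ⟨g, hg, b, Submodule.smul_mono_left hIJ hb, hw⟩

theorem one_mem_boundedFractions (h : IsHorrocksFiltration d z F) :
    (1 : W) ∈ h.boundedFractions W ⊤ :=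
  ⟨1, monic_one, 1, by rw [Submodule.top_smul]; simpa using h.one_mem, by simp⟩

variable [IsLocalization (monicValues B₀ z) W]

theorem isUnit_one_sub [IsLocalRing B₀] (h : IsHorrocksFiltration d z F) {w : W}
    (hw : w ∈ h.boundedFractions W (IsLocalRing.maximalIdeal B₀)) : IsUnit (1 - w) := by
  obtain ⟨g, hg, b, hb, hwb⟩ := hw
  have hb' := Submodule.neg_mem _ hb
  obtain ⟨p, hp, hpmem⟩ := h.exists_monic_mem_span hg hb'
  obtain ⟨c, hc⟩ := Ideal.mem_span_singleton'.1 hpmem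
  have hpu : IsUnit (algebraMap B W p) := IsLocalization.map_units W ⟨p, hp⟩
  rw [← hc, map_mul] at hpu
  have h2 := isUnit_of_mul_isUnit_right hpu
  have : algebraMap B W (aeval z g + -b) = (1 - w) * algebraMap B W (aeval z g) := by
    rw [map_add, map_neg, ← hwb]
    ring
  rw [this] at h2
  exact isUnit_of_mul_isUnit_left h2

theorem isUnit_det_one_sub [IsLocalRing B₀] (h : IsHorrocksFiltration d z F) {n : ℕ}
    {l : Matrix (Fin n) (Fin n) W}
    (hl : ∀ i j, l i j ∈ h.boundedFractions W (IsLocalRing.maximalIdeal B₀)) :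
    IsUnit (1 - l).det := by
  let A : Subalgebra B₀ W := (h.boundedFractions W ⊤).toSubalgebra h.one_mem_boundedFractions
    fun _ _ => h.boundedFractions_mul_mem
  let J : Ideal A :=
    { carrier := {x | (x : W) ∈ h.boundedFractions W (IsLocalRing.maximalIdeal B₀)}
      add_mem' := fun hx hy => (h.boundedFractions W (IsLocalRing.maximalIdeal B₀)).add_mem hx hy
      zero_mem' := (h.boundedFractions W (IsLocalRing.maximalIdeal B₀)).zero_mem
      smul_mem' := fun c x hx => by
        change (c : W) * (x : W) ∈ h.boundedFractions W (IsLocalRing.maximalIdeal B₀)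
        rw [mul_comm]
        exact h.boundedFractions_mul_mem hx c.2 }
  let l' : Matrix (Fin n) (Fin n) A :=
    Matrix.of fun i j => ⟨l i j, h.boundedFractions_mono le_top (hl i j)⟩
  have h1 : A.val.toRingHom.mapMatrix (1 - l') = 1 - l := by
    rw [map_sub, map_one]
    rfl
  have h2 : (Ideal.Quotient.mk J).mapMatrix (1 - l') = 1 := by
    rw [map_sub, map_one]
    have : (Ideal.Quotient.mk J).mapMatrix l' = 0 := by
      ext i j
      exact Ideal.Quotient.eq_zero_iff_mem.2 (hl i j)
    rw [this, sub_zero]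
  have h3 : 1 - (1 - l').det ∈ J := by
    rw [← Ideal.Quotient.eq_zero_iff_mem, map_sub, map_one, RingHom.map_det, h2, Matrix.det_one,
      sub_self]
  have h4 := h.isUnit_one_sub (W := W) h3
  rw [← h1, ← RingHom.map_det]
  convert h4 using 1
  simp

theorem exists_add_mem_boundedFractions (h : IsHorrocksFiltration d z F) (w : W) :
    ∃ b : B, w - algebraMap B W b ∈ h.boundedFractions W ⊤ := by
  obtain ⟨⟨b, ⟨_, g, hg, rfl⟩⟩, hw⟩ := IsLocalization.surj (monicValues B₀ z) w
  obtain ⟨q, hq⟩ := h.exists_sub_mul_mem hg b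
  refine ⟨q, g, hg, _, by rwa [Submodule.top_smul], ?_⟩
  rw [sub_mul, hw, map_sub, map_mul]
  ring

end IsHorrocksFiltration

/-- A ring which is integral over a polynomial ring over a field has dimension at most one. -/
theorem krullDimLE_one_of_isIntegral_polynomial {k C : Type*} [Field k] [CommRing C]
    [Algebra (Polynomial k) C] [Algebra.IsIntegral (Polynomial k) C] : Ring.KrullDimLE 1 C := by
  refine Ring.KrullDimLE.mk₁ fun q hq => ?_
  by_cases hmin : q ∈ minimalPrimes C
  · exact Or.inl hmin
  · right
    obtain ⟨p, hp, hle⟩ := Ideal.exists_minimalPrimes_le (I := ⊥) (J := q) bot_le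
    have hpp := hp.1.1
    have hlt : p < q := lt_of_le_of_ne hle fun h => hmin (h ▸ hp)
    obtain ⟨x, hxq, hxp⟩ := SetLike.exists_of_lt hlt
    have hc := Ideal.comap_lt_comap_of_integral_mem_sdiff hle ⟨hxq, hxp⟩
      (Algebra.IsIntegral.isIntegral (R := Polynomial k) x)
    have hmax : (q.comap (algebraMap (Polynomial k) C)).IsMaximal :=
      Ideal.IsPrime.isMaximal inferInstance (bot_lt_of_lt hc).ne'
    exact Ideal.isMaximal_of_isIntegral_of_isMaximal_comap q hmax

/-- A factorization of an idempotent matrix through a free module of the right rank is an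
isomorphism. -/
theorem OrientedIdem.idemFree_of_mul_eq {B ι : Type*} [CommRing B] [Fintype ι] {n : ℕ}
    {E : Matrix ι ι B} (h : OrientedIdem n E) {X : Matrix ι (Fin n) B} {Y : Matrix (Fin n) ι B}
    (hX : E * X = X) (hXY : X * Y = E) : IdemFree n E := by
  refine ⟨X, Y, hXY, ?_⟩
  obtain ⟨-, -, c, hc⟩ := h
  have h0 : X * (Y * X - 1) = 0 := by
    rw [Matrix.mul_sub, ← Matrix.mul_assoc, hXY, hX, Matrix.mul_one, sub_self]
  have h1 : ∀ f : Fin n → ι, (X.submatrix f id).det • (Y * X - 1) = 0 := by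
    intro f
    have h2 : X.submatrix f id * (Y * X - 1) = 0 := by
      ext i j
      exact congrFun (congrFun h0 (f i)) j
    rw [← Matrix.one_mul (Y * X - 1), ← Matrix.smul_mul, ← Matrix.adjugate_mul, Matrix.mul_assoc,
      h2, Matrix.mul_zero]
  have h3 : ∀ f g : Fin n → ι, (E.submatrix f g).det • (Y * X - 1) = 0 := by
    intro f g
    have : E.submatrix f g = X.submatrix f id * Y.submatrix id g := by
      rw [← hXY]
      rfl
    rw [this, Matrix.det_mul, mul_comm, mul_smul, h1, smul_zero]
  rw [← sub_eq_zero, ← one_smul B (Y * X - 1), ← hc, Finset.sum_smul]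
  refine Finset.sum_eq_zero fun f _ => ?_
  rw [Finset.sum_smul]
  refine Finset.sum_eq_zero fun g _ => ?_
  rw [mul_smul, h3, smul_zero]

/-- A trivialization can be chosen to be compatible with a given orientation. -/
theorem IdemFree.exists_det_eq {B ι : Type*} [CommRing B] [Fintype ι] {n : ℕ}
    {E : Matrix ι ι B} (h : IdemFree (n + 1) E) {v w : (Fin (n + 1) → ι) → B}
    (hvw : ∀ f g, (E.submatrix f g).det = v f * w g) :
    ∃ (X : Matrix ι (Fin (n + 1)) B) (Y : Matrix (Fin (n + 1)) ι B), X * Y = E ∧ Y * X = 1 ∧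
      ∀ f, (X.submatrix f id).det = v f := by
  classical
  obtain ⟨X, Y, hXY, hYX⟩ := h
  have h1 : ∀ f g, (X.submatrix f id).det * (Y.submatrix id g).det = v f * w g := by
    intro f g
    rw [← hvw, ← hXY, ← Matrix.det_mul]
    rfl
  set t := ∑ g : Fin (n + 1) → ι, w g * ∏ k, X (g k) k with ht
  have h2 : ∀ f, (X.submatrix f id).det = v f * t := by
    intro f
    have := Matrix.det_mul_eq_sum_submatrix_right Y X
    rw [hYX, Matrix.det_one] at this
    rw [← mul_one (X.submatrix f id).det, this, Finset.mul_sum, ht, Finset.mul_sum]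
    refine Finset.sum_congr rfl fun g _ => ?_
    rw [← mul_assoc (v f), ← h1]
    ring
  have h3 := Matrix.det_mul_eq_sum_submatrix Y X
  rw [hYX, Matrix.det_one] at h3
  set t' := ∑ f : Fin (n + 1) → ι, (∏ k, Y k (f k)) * v f with ht'
  have htt : t' * t = 1 := by
    rw [h3, ht', Finset.sum_mul]
    exact Finset.sum_congr rfl fun f _ => by rw [h2]; ring
  have hdiag : ∀ x y : B, x * y = 1 →
      Matrix.diagonal (Function.update (1 : Fin (n + 1) → B) 0 x) *
        Matrix.diagonal (Function.update (1 : Fin (n + 1) → B) 0 y) = 1 := by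
    intro x y hxy
    rw [Matrix.diagonal_mul_diagonal, ← Matrix.diagonal_one]
    congr 1
    ext i
    rcases eq_or_ne i 0 with rfl | hi
    · simpa using hxy
    · simp [Function.update_of_ne hi]
  refine ⟨X * Matrix.diagonal (Function.update (1 : Fin (n + 1) → B) 0 t'),
    Matrix.diagonal (Function.update (1 : Fin (n + 1) → B) 0 t) * Y, ?_, ?_, fun f => ?_⟩
  · rw [Matrix.mul_assoc, ← Matrix.mul_assoc (Matrix.diagonal _), hdiag _ _ htt, Matrix.one_mul,
      hXY]
  · rw [Matrix.mul_assoc, ← Matrix.mul_assoc Y, hYX, Matrix.one_mul,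
      hdiag _ _ (by rw [mul_comm, htt])]
  · have : (X * Matrix.diagonal (Function.update (1 : Fin (n + 1) → B) 0 t')).submatrix f id =
        X.submatrix f id * Matrix.diagonal (Function.update (1 : Fin (n + 1) → B) 0 t') := rfl
    rw [this, Matrix.det_mul, h2, Matrix.det_diagonal, Fin.prod_univ_succ]
    simp only [Function.update_self, ne_eq, Fin.succ_ne_zero, not_false_eq_true,
      Function.update_of_ne, Pi.one_apply, Finset.prod_const_one, mul_one]
    rw [mul_assoc, mul_comm t, htt, mul_one]

section Localization

variable {B W ι κ : Type*} [CommRing B] [CommRing W] [Algebra B W] [Finite ι] [Finite κ]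
  (S : Submonoid B) [IsLocalization S W]

theorem IsLocalization.exists_smul_matrix_eq_map (M : Matrix ι κ W) :
    ∃ s ∈ S, ∃ N : Matrix ι κ B, N.map (algebraMap B W) = algebraMap B W s • M := by
  obtain ⟨s, hs⟩ := IsLocalization.exist_integer_multiples_of_finite S
    (fun p : ι × κ => M p.1 p.2)
  choose N hN using hs
  refine ⟨s, s.2, Matrix.of fun i j => N (i, j), ?_⟩
  ext i j
  simpa [Algebra.smul_def] using hN (i, j)

theorem IsLocalization.exists_smul_matrix_eq_of_map_eq {M N : Matrix ι κ B}
    (h : M.map (algebraMap B W) = N.map (algebraMap B W)) : ∃ s ∈ S, s • M = s • N := by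
  classical
  cases nonempty_fintype ι
  cases nonempty_fintype κ
  have h1 : ∀ i j, ∃ s : S, (s : B) * M i j = s * N i j := fun i j =>
    (IsLocalization.eq_iff_exists S W).1 (congrFun (congrFun h i) j)
  choose s hs using h1
  refine ⟨∏ i, ∏ j, (s i j : B), Submonoid.prod_mem _ fun i _ =>
    Submonoid.prod_mem _ fun j _ => (s i j).2, ?_⟩
  ext i j
  simp only [Matrix.smul_apply, smul_eq_mul]
  have : (s i j : B) ∣ ∏ i, ∏ j, (s i j : B) :=
    (Finset.dvd_prod_of_mem (fun j => (s i j : B)) (Finset.mem_univ j)).trans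
      (Finset.dvd_prod_of_mem (fun i => ∏ j, (s i j : B)) (Finset.mem_univ i))
  obtain ⟨c, hc⟩ := this
  rw [hc, mul_assoc, mul_left_comm, hs]
  ring

end Localization

theorem Submodule.le_of_le_sup_of_fg {B₀ V : Type*} [CommRing B₀] [IsLocalRing B₀]
    [AddCommGroup V] [Module B₀ V] {R N K : Submodule B₀ V} (hK : K.FG) (h1 : R ≤ N ⊔ K)
    (h2 : K ≤ N ⊔ IsLocalRing.maximalIdeal B₀ • R) : R ≤ N := by
  have h3 : K ≤ N := by
    refine Submodule.le_of_le_smul_of_le_jacobson_bot hK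
      (IsLocalRing.maximalIdeal_le_jacobson _) (h2.trans (sup_le le_sup_left ?_))
    refine (Submodule.smul_mono le_rfl h1).trans ?_
    rw [Submodule.smul_sup]
    exact sup_le_sup Submodule.smul_le_right le_rfl
  exact h1.trans (sup_le le_rfl h3)

theorem Submodule.pi_mem_smul_top {B₀ V κ : Type*} [CommRing B₀] [AddCommGroup V] [Module B₀ V]
    [Finite κ] {I : Ideal B₀} {x : κ → V} (hx : ∀ i, x i ∈ I • (⊤ : Submodule B₀ V)) :
    x ∈ I • (⊤ : Submodule B₀ (κ → V)) := by
  classical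
  cases nonempty_fintype κ
  rw [← Finset.univ_sum_single x]
  refine Submodule.sum_mem _ fun i _ => ?_
  have := Submodule.mem_map_of_mem (f := LinearMap.single B₀ (fun _ : κ => V) i) (hx i)
  rw [Submodule.map_smul''] at this
  exact Submodule.smul_mono le_rfl le_top this

theorem Submodule.mem_smul_top_apply {B₀ V κ : Type*} [CommRing B₀] [AddCommGroup V] [Module B₀ V]
    {I : Ideal B₀} {x : κ → V} (hx : x ∈ I • (⊤ : Submodule B₀ (κ → V))) (i : κ) :
    x i ∈ I • (⊤ : Submodule B₀ V) := by
  have := Submodule.mem_map_of_mem (f := LinearMap.proj (R := B₀) (φ := fun _ : κ => V) i) hx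
  rw [Submodule.map_smul''] at this
  exact Submodule.smul_mono le_rfl le_top this

theorem Ideal.mem_map_iff_mem_smul_top {B₀ V : Type*} [CommRing B₀] [CommRing V] [Algebra B₀ V]
    {I : Ideal B₀} {x : V} : x ∈ I.map (algebraMap B₀ V) ↔ x ∈ I • (⊤ : Submodule B₀ V) := by
  rw [Ideal.smul_top_eq_map]
  rfl

open Polynomial in
/-- A polynomial over a local ring with a unit coefficient is associated to a monic polynomial
modulo the maximal ideal. -/
theorem IsLocalRing.exists_monic_sub_mul_mem {B₀ : Type*} [CommRing B₀] [IsLocalRing B₀]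
    {p : B₀[X]} (hp : p ∉ (IsLocalRing.maximalIdeal B₀).map C) :
    ∃ g : B₀[X], g.Monic ∧ ∃ c : B₀, g - p * C c ∈ (IsLocalRing.maximalIdeal B₀).map C := by
  have hker : RingHom.ker (mapRingHom (IsLocalRing.residue B₀)) =
      (IsLocalRing.maximalIdeal B₀).map C := by
    rw [Polynomial.ker_mapRingHom, IsLocalRing.ker_residue]
  rw [← hker] at hp ⊢
  have hp0 : p.map (IsLocalRing.residue B₀) ≠ 0 := hp
  obtain ⟨c, hc⟩ := IsLocalRing.residue_surjective (p.map (IsLocalRing.residue B₀)).leadingCoeff⁻¹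
  have hmon : ((p * C c).map (IsLocalRing.residue B₀)).Monic := by
    rw [Polynomial.map_mul, map_C, hc]
    exact monic_mul_leadingCoeff_inv hp0
  obtain ⟨g, hg, -, hgm⟩ := lifts_and_degree_eq_and_monic
    (f := IsLocalRing.residue B₀) (p := (p * C c).map (IsLocalRing.residue B₀)) ⟨_, rfl⟩ hmon
  refine ⟨g, hgm, c, ?_⟩
  rw [RingHom.mem_ker, map_sub, sub_eq_zero]
  exact hg

namespace IsHorrocksFiltration

open Polynomial

variable {B₀ B : Type*} [CommRing B₀] [CommRing B] [Algebra B₀ B]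
  {d : ℕ} {z : B} {F : ℕ → Submodule B₀ B}

theorem isIntegral_aeval (h : IsHorrocksFiltration d z F) :
    (aeval (R := B₀) z).toRingHom.IsIntegral := by
  algebraize [(aeval (R := B₀) z).toRingHom]
  have : IsScalarTower B₀ B₀[X] B := IsScalarTower.of_algebraMap_eq fun x => by
    change _ = aeval z (C x)
    simp
  have := h.finite (aeval_X z)
  exact algebraMap_isIntegral_iff.2 inferInstance

variable [IsLocalRing B₀]

theorem mem_minimalPrimes (h : IsHorrocksFiltration d z F) {Q : Ideal B} [Q.IsPrime]
    (hQ : (IsLocalRing.maximalIdeal B₀).map (algebraMap B₀ B) ≤ Q)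
    (hd : Disjoint (monicValues B₀ z : Set B) Q) :
    Q ∈ ((IsLocalRing.maximalIdeal B₀).map (algebraMap B₀ B)).minimalPrimes := by
  obtain ⟨Q', hQ', hle⟩ := Ideal.exists_minimalPrimes_le hQ
  have hQp := hQ'.1.1
  rcases eq_or_ne Q' Q with rfl | hne
  · exact hQ'
  exfalso
  obtain ⟨x, hxQ, hxQ'⟩ := SetLike.exists_of_lt (lt_of_le_of_ne hle hne)
  have hint := h.isIntegral_aeval
  algebraize [(aeval (R := B₀) z).toRingHom]
  have hlt := Ideal.comap_lt_comap_of_integral_mem_sdiff (R := B₀[X]) hle ⟨hxQ, hxQ'⟩ (hint x)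
  obtain ⟨p, hpQ, hpQ'⟩ := SetLike.exists_of_lt hlt
  have hmap : (IsLocalRing.maximalIdeal B₀).map (C : B₀ →+* B₀[X]) ≤
      Q'.comap (algebraMap B₀[X] B) := by
    rw [Ideal.map_le_iff_le_comap]
    intro m hm
    have : algebraMap B₀[X] B (C m) = algebraMap B₀ B m := aeval_C z m
    rw [Ideal.mem_comap, Ideal.mem_comap, this]
    exact hQ'.1.2 (Ideal.mem_map_of_mem _ hm)
  obtain ⟨g, hg, c, hgc⟩ := IsLocalRing.exists_monic_sub_mul_mem fun hp => hpQ' (hmap hp)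
  refine Set.disjoint_left.1 hd ⟨g, hg, rfl⟩ (?_ : aeval z g ∈ Q)
  have h1 := Ideal.add_mem _ (hle (hmap hgc)) (Ideal.mul_mem_right (C c) _ hpQ)
  rw [← map_add, sub_add_cancel] at h1
  exact h1

theorem finite_maximalSpectrum [IsNoetherianRing B] (h : IsHorrocksFiltration d z F)
    (W : Type*) [CommRing W] [Algebra B W] [Algebra B₀ W] [IsScalarTower B₀ B W]
    [IsLocalization (monicValues B₀ z) W] :
    Finite (MaximalSpectrum (W ⧸ (IsLocalRing.maximalIdeal B₀).map (algebraMap B₀ W))) := by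
  set I := (IsLocalRing.maximalIdeal B₀).map (algebraMap B₀ B)
  have hfin : Finite I.minimalPrimes := (Ideal.finite_minimalPrimes_of_isNoetherianRing B I).to_subtype
  refine Finite.of_injective (β := I.minimalPrimes) (fun Q =>
    ⟨(Q.asIdeal.comap (Ideal.Quotient.mk _)).comap (algebraMap B W), ?_⟩) ?_
  · have := Q.isMaximal
    have hpr : (Q.asIdeal.comap (Ideal.Quotient.mk
      ((IsLocalRing.maximalIdeal B₀).map (algebraMap B₀ W)))).IsPrime := inferInstance
    refine h.mem_minimalPrimes ?_ ((IsLocalization.isPrime_iff_isPrime_disjoint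
      (monicValues B₀ z) W _).1 hpr).2
    rw [Ideal.map_le_iff_le_comap]
    intro m hm
    rw [Ideal.mem_comap, Ideal.mem_comap, Ideal.mem_comap, ← IsScalarTower.algebraMap_apply,
      Ideal.Quotient.eq_zero_iff_mem.2 (Ideal.mem_map_of_mem _ hm)]
    exact zero_mem _
  · intro Q Q' hQ
    have h1 := congrArg Subtype.val hQ
    have h2 : Q.asIdeal.comap (Ideal.Quotient.mk
        ((IsLocalRing.maximalIdeal B₀).map (algebraMap B₀ W))) =
        Q'.asIdeal.comap (Ideal.Quotient.mk _) := by
      rw [← IsLocalization.map_under (monicValues B₀ z) W (Q.asIdeal.comap _),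
        ← IsLocalization.map_under (monicValues B₀ z) W (Q'.asIdeal.comap _)]
      exact congrArg (Ideal.map (algebraMap B W)) h1
    exact MaximalSpectrum.ext (Ideal.comap_injective_of_surjective _ Ideal.Quotient.mk_surjective h2)

theorem krullDimLE_one (h : IsHorrocksFiltration d z F) :
    Ring.KrullDimLE 1 (B ⧸ (IsLocalRing.maximalIdeal B₀).map (algebraMap B₀ B)) := by
  set I := (IsLocalRing.maximalIdeal B₀).map (algebraMap B₀ B) with hI
  let φ : IsLocalRing.ResidueField B₀ →+* B ⧸ I :=
    Ideal.Quotient.lift _ ((Ideal.Quotient.mk I).comp (algebraMap B₀ B)) fun m hm =>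
      Ideal.Quotient.eq_zero_iff_mem.2 (Ideal.mem_map_of_mem _ hm)
  let ψ : (IsLocalRing.ResidueField B₀)[X] →+* B ⧸ I := eval₂RingHom φ (Ideal.Quotient.mk I z)
  have hψ : ψ.comp (mapRingHom (IsLocalRing.residue B₀)) =
      (Ideal.Quotient.mk I).comp (aeval (R := B₀) z).toRingHom := by
    ext x
    · simp [ψ]
      rfl
    · simp [ψ]
  have hint : ψ.IsIntegral := by
    refine RingHom.IsIntegral.tower_top (mapRingHom (IsLocalRing.residue B₀)) ψ ?_
    rw [hψ]
    exact h.isIntegral_aeval.trans _ _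
      (RingHom.isIntegral_of_surjective _ Ideal.Quotient.mk_surjective)
  algebraize [ψ]
  exact krullDimLE_one_of_isIntegral_polynomial (k := IsLocalRing.ResidueField B₀)

end IsHorrocksFiltration

theorem Matrix.det_mul_eq_of_det_submatrix_eq {B ι : Type*} [CommRing B] [Fintype ι] {n : ℕ}
    (Y : Matrix (Fin n) ι B) {X X' : Matrix ι (Fin n) B}
    (h : ∀ f : Fin n → ι, (X.submatrix f id).det = (X'.submatrix f id).det) :
    (Y * X).det = (Y * X').det := by
  rw [Matrix.det_mul_eq_sum_submatrix, Matrix.det_mul_eq_sum_submatrix]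
  exact Finset.sum_congr rfl fun f _ => by rw [h]

theorem Matrix.mulVec_mem_of_forall_mem {B ι κ : Type*} [CommRing B] [Fintype κ] {I : Ideal B}
    {M : Matrix ι κ B} {i : ι} (h : ∀ j, M i j ∈ I) (x : κ → B) : Matrix.mulVec M x i ∈ I :=
  Ideal.sum_mem _ fun j _ => Ideal.mul_mem_right _ _ (h j)

theorem Matrix.exists_map_eq_of_surjective {B C ι κ : Type*} {f : B → C}
    (hf : Function.Surjective f) (M : Matrix ι κ C) : ∃ N : Matrix ι κ B, N.map f = M := by
  choose g hg using hf
  exact ⟨M.map g, by ext i j; exact hg _⟩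

theorem Matrix.det_submatrix_map {B C ι : Type*} [CommRing B] [CommRing C] {n : ℕ}
    (φ : B →+* C) (E : Matrix ι ι B) (f g : Fin n → ι) :
    ((E.map φ).submatrix f g).det = φ (E.submatrix f g).det := by
  rw [RingHom.map_det]
  rfl

namespace IsHorrocksFiltration

open Polynomial

variable {B₀ B : Type*} [CommRing B₀] [CommRing B] [Algebra B₀ B]
  {d : ℕ} {z : B} {F : ℕ → Submodule B₀ B}

theorem fg_map_pi (h : IsHorrocksFiltration d z F) (k : ℕ) {κ : Type*} [Finite κ]
    {V : Type*} [AddCommGroup V] [Module B₀ V] (f : (κ → B) →ₗ[B₀] V) :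
    ((Submodule.pi Set.univ fun _ : κ => F k).map f).FG :=
  (Submodule.fg_pi fun _ => h.fg k).map f

theorem exists_sub_smul_mem_pi (h : IsHorrocksFiltration d z F) {g : B₀[X]} (hg : g.Monic)
    {κ : Type*} (x : κ → B) : ∃ q : κ → B, x - aeval z g • q ∈
      Submodule.pi Set.univ fun _ : κ => F (d * g.natDegree) := by
  choose q hq using fun i => h.exists_sub_mul_mem hg (x i)
  exact ⟨q, fun i _ => hq i⟩

variable [IsLocalRing B₀] {W : Type*} [CommRing W] [Algebra B W] [Algebra B₀ W]
  [IsScalarTower B₀ B W] [IsLocalization (monicValues B₀ z) W]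
  {ι : Type*} [Fintype ι] {n : ℕ} {E : Matrix ι ι B}

theorem exists_approximation [IsNoetherianRing B] (h : IsHorrocksFiltration d z F)
    (hE : OrientedIdem (n + 1) E) (hW : IdemFree (n + 1) (E.map (algebraMap B W))) :
    ∃ (X : Matrix ι (Fin (n + 1)) W) (Y : Matrix (Fin (n + 1)) ι W)
      (X₁ : Matrix ι (Fin (n + 1)) B) (Y₁ : Matrix (Fin (n + 1)) ι B),
      X * Y = E.map (algebraMap B W) ∧ Y * X = 1 ∧ E * X₁ = X₁ ∧
      (∀ i j, (E - X₁ * Y₁) i j ∈ (IsLocalRing.maximalIdeal B₀).map (algebraMap B₀ B)) ∧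
      ∀ i j, (1 - Y * X₁.map (algebraMap B W) : Matrix (Fin (n + 1)) (Fin (n + 1)) W) i j ∈
        (IsLocalRing.maximalIdeal B₀).map (algebraMap B₀ W) := by
  obtain ⟨v, w, hvw⟩ := hE.2.1
  set I := (IsLocalRing.maximalIdeal B₀).map (algebraMap B₀ B) with hI
  set J := (IsLocalRing.maximalIdeal B₀).map (algebraMap B₀ W) with hJ
  have := h.krullDimLE_one
  have hfin := h.finite_maximalSpectrum W
  obtain ⟨X, Y, hXY, hYX, hXv⟩ := hW.exists_det_eq (v := fun f => algebraMap B W (v f))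
    (w := fun g => algebraMap B W (w g)) (fun f g => by
      rw [Matrix.det_submatrix_map, hvw, map_mul])
  obtain ⟨Xb, Yb, hXYb, hYXb, hXvb⟩ :=
    (hE.map (Ideal.Quotient.mk I)).idemFree_of_krullDimLE_one.exists_det_eq
    (v := fun f => Ideal.Quotient.mk I (v f))
    (w := fun g => Ideal.Quotient.mk I (w g)) (fun f g => by
      rw [Matrix.det_submatrix_map, hvw, map_mul])
  obtain ⟨Xl, hXl⟩ := Matrix.exists_map_eq_of_surjective
    (Ideal.Quotient.mk_surjective (I := I)) Xb
  obtain ⟨Yl, hYl⟩ := Matrix.exists_map_eq_of_surjective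
    (Ideal.Quotient.mk_surjective (I := I)) Yb
  have hX1 : (E * Xl).map (Ideal.Quotient.mk I) = Xb := by
    rw [Matrix.map_mul, hXl, ← hXYb, Matrix.mul_assoc, hYXb, Matrix.mul_one]
  let σ : B ⧸ I →+* W ⧸ J := Ideal.quotientMap J (algebraMap B W) (by
    rw [hI, hJ, Ideal.map_le_iff_le_comap]
    intro m hm
    rw [Ideal.mem_comap, Ideal.mem_comap, ← IsScalarTower.algebraMap_apply]
    exact Ideal.mem_map_of_mem _ hm)
  have hσ : ∀ b, σ (Ideal.Quotient.mk I b) = Ideal.Quotient.mk J (algebraMap B W b) :=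
    fun b => Ideal.quotientMap_mk
  have hX1W : ((E * Xl).map (algebraMap B W)).map (Ideal.Quotient.mk J) = Xb.map σ := by
    rw [← hX1]
    ext i j
    exact (hσ _).symm
  have hdet : ((Y * (E * Xl).map (algebraMap B W)).map (Ideal.Quotient.mk J)).det = 1 := by
    rw [Matrix.map_mul, hX1W]
    have h1 : (Y.map (Ideal.Quotient.mk J) * X.map (Ideal.Quotient.mk J)).det = 1 := by
      rw [← Matrix.map_mul, hYX, Matrix.map_one _ (map_zero _) (map_one _), Matrix.det_one]
    rw [← h1]
    refine Matrix.det_mul_eq_of_det_submatrix_eq _ fun f => ?_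
    have h2 := RingHom.map_det (Ideal.Quotient.mk J) (X.submatrix f id)
    have h3 := RingHom.map_det σ (Xb.submatrix f id)
    rw [hXv] at h2
    rw [hXvb, hσ] at h3
    exact h3.symm.trans h2
  obtain ⟨H, hH, hHπ⟩ := mem_liftableSL_of_det_eq_one (π := Ideal.Quotient.mk J)
    Ideal.Quotient.mk_surjective _ hdet
  refine ⟨X * H, H.adjugate * Y, E * Xl, Yl, ?_, ?_, ?_, fun i j => ?_, fun i j => ?_⟩
  · rw [Matrix.mul_assoc, ← Matrix.mul_assoc H, Matrix.mul_adjugate, hH, one_smul, Matrix.one_mul,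
      hXY]
  · rw [Matrix.mul_assoc, ← Matrix.mul_assoc Y, hYX, Matrix.one_mul, Matrix.adjugate_mul, hH,
      one_smul]
  · rw [← Matrix.mul_assoc, hE.1]
  · rw [← Ideal.Quotient.eq_zero_iff_mem, Matrix.sub_apply, map_sub, sub_eq_zero]
    change (E.map (Ideal.Quotient.mk I)) i j = ((E * Xl * Yl).map (Ideal.Quotient.mk I)) i j
    rw [Matrix.map_mul, hX1, hYl, hXYb]
  · rw [← Ideal.Quotient.eq_zero_iff_mem, Matrix.sub_apply, map_sub, sub_eq_zero]
    have h1 : ((1 : Matrix (Fin (n + 1)) (Fin (n + 1)) W).map (Ideal.Quotient.mk J)) =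
        (H.adjugate * Y * (E * Xl).map (algebraMap B W)).map (Ideal.Quotient.mk J) := by
      rw [Matrix.mul_assoc, Matrix.map_mul, ← hHπ, ← Matrix.map_mul, Matrix.adjugate_mul, hH,
        one_smul]
    exact congrFun (congrFun h1 i) j

/-- Every vector of fractions is the sum of a vector in the lattice spanned by the columns of `Y`
and a vector of bounded fractions. -/
theorem range_sup_boundedFractions_eq_top (h : IsHorrocksFiltration d z F)
    {X : Matrix ι (Fin n) W} {Y : Matrix (Fin n) ι W} {X₁ : Matrix ι (Fin n) B} (hYX : Y * X = 1)
    (hYX₁ : ∀ i j, (1 - Y * X₁.map (algebraMap B W) : Matrix (Fin n) (Fin n) W) i j ∈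
      (IsLocalRing.maximalIdeal B₀).map (algebraMap B₀ W)) :
    LinearMap.range ((Y.mulVecLin.restrictScalars B₀).comp
      ((IsScalarTower.toAlgHom B₀ B W).toLinearMap.compLeft ι)) ⊔
      (Submodule.pi Set.univ fun _ : Fin n => h.boundedFractions W ⊤) = ⊤ := by
  obtain ⟨_, ⟨g, hg, rfl⟩, N, hN⟩ :=
    IsLocalization.exists_smul_matrix_eq_map (monicValues B₀ z) X
  rw [eq_top_iff]
  refine Submodule.le_of_le_sup_of_fg (h.fg_map_pi (d * g.natDegree)
    ((IsScalarTower.toAlgHom B₀ B W).toLinearMap.compLeft (Fin n))) ?_ ?_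
  · intro w _
    choose b hb using fun i => h.exists_add_mem_boundedFractions (w i)
    obtain ⟨q, hq⟩ := h.exists_sub_smul_mem_pi hg b
    have h1 : w = (Matrix.mulVec Y (fun i => algebraMap B W (Matrix.mulVec N q i)) +
        fun i => w i - algebraMap B W (b i)) +
        fun i => algebraMap B W ((b - aeval z g • q) i) := by
      have h2 : (fun i => algebraMap B W (Matrix.mulVec N q i)) =
          Matrix.mulVec (N.map (algebraMap B W)) (fun i => algebraMap B W (q i)) :=
        funext fun i => RingHom.map_mulVec _ _ _ _
      rw [h2, hN, Matrix.mulVec_mulVec, Matrix.mul_smul, hYX, Matrix.smul_mulVec,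
        Matrix.one_mulVec]
      ext i
      simp only [Pi.add_apply, Pi.smul_apply, Pi.sub_apply, smul_eq_mul, map_sub, map_mul]
      ring
    rw [h1]
    exact Submodule.add_mem_sup (Submodule.add_mem_sup ⟨Matrix.mulVec N q, rfl⟩ fun i _ => hb i)
      ⟨_, hq, rfl⟩
  · rintro _ ⟨x, -, rfl⟩
    have h1 : (IsScalarTower.toAlgHom B₀ B W).toLinearMap.compLeft (Fin n) x =
        Matrix.mulVec Y (fun i => algebraMap B W (Matrix.mulVec X₁ x i)) +
        Matrix.mulVec (1 - Y * X₁.map (algebraMap B W)) (fun i => algebraMap B W (x i)) := by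
      have h2 : (fun i => algebraMap B W (Matrix.mulVec X₁ x i)) =
          Matrix.mulVec (X₁.map (algebraMap B W)) (fun i => algebraMap B W (x i)) :=
        funext fun i => RingHom.map_mulVec _ _ _ _
      rw [h2, Matrix.mulVec_mulVec, ← Matrix.add_mulVec, add_sub_cancel, Matrix.one_mulVec]
      rfl
    rw [h1]
    refine Submodule.add_mem_sup (Submodule.mem_sup_left ⟨Matrix.mulVec X₁ x, rfl⟩)
      (Submodule.pi_mem_smul_top fun i => ?_)
    rw [← Ideal.mem_map_iff_mem_smul_top]
    exact Matrix.mulVec_mem_of_forall_mem (hYX₁ i) _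

/-- The local form of the theorem of Horrocks. -/
theorem idemFree [IsNoetherianRing B] (h : IsHorrocksFiltration d z F)
    (hE : OrientedIdem (n + 1) E) (hW : IdemFree (n + 1) (E.map (algebraMap B W))) :
    IdemFree (n + 1) E := by
  classical
  obtain ⟨X, Y, X₁, Y₁, hXY, hYX, hEX₁, hEX₁Y₁, hYX₁⟩ := h.exists_approximation hE hW
  have hYE : Y * E.map (algebraMap B W) = Y := by
    rw [← hXY, ← Matrix.mul_assoc, hYX, Matrix.one_mul]
  have hEX : E.map (algebraMap B W) * X = X := by
    rw [← hXY, Matrix.mul_assoc, hYX, Matrix.mul_one]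
  have htop := h.range_sup_boundedFractions_eq_top hYX hYX₁
  set D : Matrix (Fin (n + 1)) (Fin (n + 1)) W := 1 - Y * X₁.map (algebraMap B W) with hD
  have hZl : ∀ j, ∃ (Z : ι → B) (l : Fin (n + 1) → W),
      (∀ i, Z i ∈ (IsLocalRing.maximalIdeal B₀).map (algebraMap B₀ B)) ∧
      (∀ i, l i ∈ h.boundedFractions W (IsLocalRing.maximalIdeal B₀)) ∧
      Matrix.mulVec Y (fun i => algebraMap B W (Z i)) + l = fun i => D i j := by
    intro j
    have h1 : (fun i => D i j) ∈
        IsLocalRing.maximalIdeal B₀ • (⊤ : Submodule B₀ (Fin (n + 1) → W)) :=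
      Submodule.pi_mem_smul_top fun i => Ideal.mem_map_iff_mem_smul_top.1 (hYX₁ i j)
    rw [← htop, Submodule.smul_sup, LinearMap.range_eq_map, ← Submodule.map_smul''] at h1
    obtain ⟨_, ⟨Z, hZ, rfl⟩, l, hl, hsum⟩ := Submodule.mem_sup.1 h1
    refine ⟨Z, l, fun i => Ideal.mem_map_iff_mem_smul_top.2 (Submodule.mem_smul_top_apply hZ i),
      fun i => ?_, hsum⟩
    have h2 : IsLocalRing.maximalIdeal B₀ •
        (Submodule.pi Set.univ fun _ : Fin (n + 1) => h.boundedFractions W ⊤) ≤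
        Submodule.pi Set.univ fun _ => h.boundedFractions W (IsLocalRing.maximalIdeal B₀) :=
      Submodule.smul_le.2 fun r hr x hx i hi =>
        h.smul_boundedFractions_le _ (Submodule.smul_mem_smul hr (hx i hi))
    exact h2 hl i trivial
  choose Zc lc hZ hl hDc using hZl
  set Z : Matrix ι (Fin (n + 1)) B := Matrix.of fun i j => Zc j i with hZdef
  set l : Matrix (Fin (n + 1)) (Fin (n + 1)) W := Matrix.of fun i j => lc j i with hldef
  have hDZ : Y * Z.map (algebraMap B W) + l = D := by
    ext i j
    exact congrFun (hDc j) i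
  have hU : IsUnit (1 - l).det := h.isUnit_det_one_sub fun i j => hl j i
  set X' := E * (X₁ + Z) with hX'
  have hEX' : E * X' = X' := by rw [hX', ← Matrix.mul_assoc, hE.1]
  have hYX' : Y * X'.map (algebraMap B W) = 1 - l := by
    rw [hX', Matrix.map_mul, ← Matrix.mul_assoc, hYE, Matrix.map_add _ (map_add _), Matrix.mul_add,
      eq_sub_iff_add_eq, add_assoc, hDZ, hD]
    abel
  have hEW : X'.map (algebraMap B W) * ((1 - l)⁻¹ * Y) = E.map (algebraMap B W) := by
    have h1 : X'.map (algebraMap B W) = X * (1 - l) := by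
      rw [← hYX', ← Matrix.mul_assoc, hXY, ← Matrix.map_mul, hEX']
    rw [h1, Matrix.mul_assoc, ← Matrix.mul_assoc (1 - l), Matrix.mul_nonsing_inv _ hU,
      Matrix.one_mul, hXY]
  obtain ⟨s₁, hs₁, V₁, hV₁⟩ := IsLocalization.exists_smul_matrix_eq_map (monicValues B₀ z)
    ((1 - l)⁻¹ * Y)
  obtain ⟨s₂, hs₂, hV₂⟩ := IsLocalization.exists_smul_matrix_eq_of_map_eq (W := W)
    (monicValues B₀ z) (M := X' * V₁) (N := s₁ • E) (by
      rw [Matrix.map_mul, hV₁, Matrix.mul_smul, hEW]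
      ext i j
      simp)
  obtain ⟨g, hg, hgs⟩ := (monicValues B₀ z).mul_mem hs₂ hs₁
  have hV : X' * (s₂ • V₁) = aeval z g • E := by
    rw [hgs, Matrix.mul_smul, hV₂, smul_smul]
  have key : LinearMap.range (E.mulVecLin.restrictScalars B₀) ≤
      LinearMap.range (X'.mulVecLin.restrictScalars B₀) := by
    refine Submodule.le_of_le_sup_of_fg (h.fg_map_pi (d * g.natDegree)
      (E.mulVecLin.restrictScalars B₀)) ?_ ?_
    · rintro _ ⟨p, rfl⟩
      obtain ⟨q, hq⟩ := h.exists_sub_smul_mem_pi hg p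
      have h1 : (E.mulVecLin.restrictScalars B₀) p =
          Matrix.mulVec X' (Matrix.mulVec (s₂ • V₁) q) + Matrix.mulVec E (p - aeval z g • q) := by
        rw [Matrix.mulVec_mulVec, hV, Matrix.mulVec_sub, Matrix.mulVec_smul, Matrix.smul_mulVec]
        change Matrix.mulVec E p = _
        abel
      rw [h1]
      exact Submodule.add_mem_sup ⟨_, rfl⟩ ⟨_, hq, rfl⟩
    · rintro _ ⟨p, -, rfl⟩
      set G : Matrix ι ι B := E - X₁ * Y₁ - Z * Y₁ with hG
      have h0 : E = X' * Y₁ + E * G := by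
        rw [hG, Matrix.mul_sub, Matrix.mul_sub, hE.1, ← Matrix.mul_assoc, hEX₁,
          ← Matrix.mul_assoc, hX', Matrix.mul_add, hEX₁, Matrix.add_mul]
        abel
      have h1 : (E.mulVecLin.restrictScalars B₀) p =
          Matrix.mulVec X' (Matrix.mulVec Y₁ p) + Matrix.mulVec E (Matrix.mulVec G p) := by
        rw [Matrix.mulVec_mulVec, Matrix.mulVec_mulVec, ← Matrix.add_mulVec, ← h0]
        rfl
      rw [h1]
      refine Submodule.add_mem_sup ⟨_, rfl⟩ ?_
      rw [LinearMap.range_eq_map, ← Submodule.map_smul'']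
      refine ⟨_, Submodule.pi_mem_smul_top fun i => ?_, rfl⟩
      rw [← Ideal.mem_map_iff_mem_smul_top]
      have hGi : ∀ j, G i j ∈ (IsLocalRing.maximalIdeal B₀).map (algebraMap B₀ B) := fun j =>
        Ideal.sub_mem _ (hEX₁Y₁ i j)
          (Matrix.mulVec_mem_of_forall_mem (M := Z) (fun k => hZ k i) fun k => Y₁ k j)
      exact Matrix.mulVec_mem_of_forall_mem hGi _
  have hcol : ∀ j, ∃ y, Matrix.mulVec X' y = Matrix.mulVec E (Pi.single j 1) := fun j =>
    key ⟨Pi.single j 1, rfl⟩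
  choose y hy using hcol
  refine hE.idemFree_of_mul_eq (X := X') (Y := Matrix.of fun i j => y j i) hEX' ?_
  ext i j
  have := congrFun (hy j) i
  rw [Matrix.mulVec_single_one] at this
  exact this

end IsHorrocksFiltration

section QuillenPatching

open Polynomial

theorem IdemIso.refl {B ι : Type*} [CommRing B] [Fintype ι] {E : Matrix ι ι B} (hE : E * E = E) :
    IdemIso E E := ⟨E, E, hE, hE⟩

/-- The specialization at `h` of a homomorphism `φ : B →+* B[X]`. -/
noncomputable def specialize {B A : Type*} [CommRing B] [CommRing A] [Algebra B A]
    (φ : B →+* B[X]) (h : A) : B →+* A :=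
  (aeval h).toRingHom.comp φ

section specialize

variable {B A A' : Type*} [CommRing B] [CommRing A] [Algebra B A] [CommRing A'] [Algebra B A']
  (φ : B →+* B[X])

theorem specialize_apply (h : A) (b : B) : specialize φ h b = aeval h (φ b) := rfl

theorem comp_specialize (θ : A →+* A') (hθ : θ.comp (algebraMap B A) = algebraMap B A') (h : A) :
    θ.comp (specialize φ h) = specialize φ (θ h) := by
  ext b
  simp only [RingHom.comp_apply, specialize_apply, aeval_def, hom_eval₂, hθ]

theorem map_specialize {ι κ : Type*} (M : Matrix ι κ B) (θ : A →+* A')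
    (hθ : θ.comp (algebraMap B A) = algebraMap B A') (h : A) :
    (M.map (specialize φ h)).map θ = M.map (specialize φ (θ h)) := by
  rw [← comp_specialize φ θ hθ]
  rfl

theorem specialize_algebraMap {L : Type*} [CommRing L] [Algebra B L] [Algebra L A]
    [IsScalarTower B L A] (φL : L →+* L[X])
    (hφL : ∀ b, φL (algebraMap B L b) = (φ b).map (algebraMap B L)) (h : A) (b : B) :
    specialize φL h (algebraMap B L b) = specialize φ h b := by
  rw [specialize_apply, hφL, specialize_apply, aeval_map_algebraMap]

end specialize

section Patching

universe u v

variable {B₀ : Type v} {B : Type u} [CommRing B₀] [CommRing B] [Algebra B₀ B]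

/-- The ideal of all `c` such that the specializations of `E` at `x + c y` and `x` are always
isomorphic. -/
def specializeIsoIdeal (φ : B →+* B[X]) {ι : Type*} [Fintype ι]
    {E : Matrix ι ι B} (hE : E * E = E) : Ideal B₀ where
  carrier := {c | ∀ (A : Type u) [CommRing A] [Algebra B A] (x y : A),
    IdemIso (E.map (specialize φ (x + algebraMap B A (algebraMap B₀ B c) * y)))
      (E.map (specialize φ x))}
  add_mem' := by
    intro c c' hc hc' A _ _ x y
    have h := hc A (x + algebraMap B A (algebraMap B₀ B c') * y) y
    rw [add_assoc, ← add_mul, ← map_add, ← map_add, add_comm c'] at h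
    exact h.trans (hc' A x y) (by rw [← Matrix.map_mul, hE]) (by rw [← Matrix.map_mul, hE])
  zero_mem' := by
    intro A _ _ x y
    rw [map_zero, map_zero, zero_mul, add_zero]
    exact IdemIso.refl (by rw [← Matrix.map_mul, hE])
  smul_mem' := by
    intro a c hc A _ _ x y
    have h := hc A x (algebraMap B A (algebraMap B₀ B a) * y)
    rwa [← mul_assoc, ← map_mul, ← map_mul, mul_comm c] at h

/-- The substitution of `c Y` for `Y`. -/
noncomputable def scaleVar {A : Type*} [CommRing A] (c : A) : A[X] →ₐ[A] A[X] :=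
  aeval (C c * X)

theorem scaleVar_eq_zero {A : Type*} [CommRing A] {c : A} {p : A[X]} (h0 : p.eval 0 = 0)
    (hc : C c * p = 0) : scaleVar c p = 0 := by
  have hX : (X : A[X]) ∣ p := X_dvd_iff.2 (by rwa [coeff_zero_eq_eval_zero])
  obtain ⟨q, rfl⟩ := hX
  have hq : C c * q = 0 := by
    rw [mul_left_comm] at hc
    ext i
    have := congrArg (fun p => p.coeff (i + 1)) hc
    simpa only [coeff_X_mul, coeff_zero] using this
  rw [map_mul]
  have h1 : scaleVar c (X : A[X]) = C c * X := aeval_X _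
  have h2 : scaleVar c (C c * q) = C c * scaleVar c q := by
    rw [map_mul]
    congr 1
    exact aeval_C _ _
  rw [h1, mul_right_comm, ← h2, hq, map_zero, zero_mul]

theorem map_scaleVar {A A' : Type*} [CommRing A] [CommRing A'] (f : A →+* A') (c : A) (p : A[X]) :
    (scaleVar c p).map f = scaleVar (f c) (p.map f) := by
  have : (mapRingHom f).comp (scaleVar c).toRingHom
      = (scaleVar (f c)).toRingHom.comp (mapRingHom f) := by
    ext
    · simp [scaleVar]
    · simp [scaleVar]
  exact congrArg (fun g => g p) this

theorem exists_eq_X_smul_of_map_eval_eq {A ι κ : Type*} [CommRing A] {M N : Matrix ι κ A[X]}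
    (h : M.map (evalRingHom 0) = N.map (evalRingHom 0)) :
    ∃ Z : Matrix ι κ A[X], M = N + (X : A[X]) • Z := by
  have hX : ∀ i j, (X : A[X]) ∣ M i j - N i j := by
    intro i j
    rw [X_dvd_iff, coeff_zero_eq_eval_zero, eval_sub, sub_eq_zero]
    exact congrFun (congrFun h i) j
  choose Z hZ using hX
  refine ⟨Matrix.of Z, ?_⟩
  ext1 i j
  simp [← hZ]

section Bivariate

variable {L : Type u} [CommRing L] [Algebra B L] (S : Submonoid B) [IsLocalization S L]
  {ι κ : Type*} [Finite ι] [Finite κ]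

attribute [local instance] Polynomial.algebra in
theorem isLocalization_bivariate :
    IsLocalization ((S.map C).map C : Submonoid B[X][X]) L[X][X] :=
  have := Polynomial.isLocalization S L
  Polynomial.isLocalization (S.map C) L[X]

attribute [local instance] Polynomial.algebra in
theorem exists_smul_matrix_eq_map_bivariate (Z : Matrix ι κ L[X][X]) :
    ∃ s ∈ S, ∃ N : Matrix ι κ B[X][X],
      N.map (mapRingHom (mapRingHom (algebraMap B L))) = C (C (algebraMap B L s)) • Z := by
  have := isLocalization_bivariate (L := L) S
  obtain ⟨_, ⟨_, ⟨s, hs, rfl⟩, rfl⟩, N, hN⟩ :=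
    IsLocalization.exists_smul_matrix_eq_map ((S.map C).map C : Submonoid B[X][X]) Z
  refine ⟨s, hs, N, hN.trans ?_⟩
  congr 1
  change mapRingHom (mapRingHom (algebraMap B L)) (C (C s)) = _
  simp

attribute [local instance] Polynomial.algebra in
theorem exists_smul_matrix_eq_of_map_eq_bivariate {M N : Matrix ι κ B[X][X]}
    (h : M.map (mapRingHom (mapRingHom (algebraMap B L)))
      = N.map (mapRingHom (mapRingHom (algebraMap B L)))) :
    ∃ s ∈ S, (C (C s) : B[X][X]) • M = (C (C s) : B[X][X]) • N := by
  have := isLocalization_bivariate (L := L) S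
  obtain ⟨_, ⟨_, ⟨s, hs, rfl⟩, rfl⟩, hN⟩ :=
    IsLocalization.exists_smul_matrix_eq_of_map_eq (W := L[X][X])
      ((S.map C).map C : Submonoid B[X][X]) h
  exact ⟨s, hs, hN⟩

end Bivariate

theorem map_scaleVar_smul {A ι κ : Type*} [CommRing A] (c : A) (M : Matrix ι κ A[X]) :
    ((X : A[X]) • M).map (scaleVar c) = (C c * X : A[X]) • M.map (scaleVar c) := by
  ext1 i j
  simp [scaleVar]

theorem scaleVar_C {A : Type*} [CommRing A] (c a : A) : scaleVar c (C a) = C a :=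
  aeval_C _ _

theorem scaleVar_X {A : Type*} [CommRing A] (c : A) : scaleVar c (X : A[X]) = C c * X :=
  aeval_X _

section Local

variable {ι : Type*} [Fintype ι] {L : Type u} [CommRing L] [Algebra B L]

/-- Two bivariate matrices connecting the specializations at `x + y` and `x`. -/
theorem exists_bivariate_of_specialize_eq (φ : L →+* L[X]) {e e₀ : Matrix ι ι L}
    (he : e * e = e) (hiso : IdemIso e e₀)
    (h₀ : ∀ h : L[X][X], e₀.map (specialize φ h) = e₀.map (algebraMap L L[X][X])) :
    ∃ Z Z' : Matrix ι ι L[X][X],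
      (e.map (specialize φ (C X : L[X][X])) + (X : L[X][X]) • Z) *
        (e.map (specialize φ (C X : L[X][X])) + (X : L[X][X]) • Z') = e.map (specialize φ (C X + X : L[X][X])) ∧
      (e.map (specialize φ (C X : L[X][X])) + (X : L[X][X]) • Z') *
        (e.map (specialize φ (C X : L[X][X])) + (X : L[X][X]) • Z) = e.map (specialize φ (C X : L[X][X])) := by
  obtain ⟨U, V, hUV, hVU⟩ := hiso
  have h1 : ∀ h : L[X][X], U.map (specialize φ h) * V.map (specialize φ h)
      = e.map (specialize φ h) := fun h => by rw [← Matrix.map_mul, hUV]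
  have h2 : ∀ h : L[X][X], V.map (specialize φ h) * U.map (specialize φ h)
      = e₀.map (algebraMap L L[X][X]) := fun h => by rw [← Matrix.map_mul, hVU, h₀]
  have h3 : ∀ h h' : L[X][X], (U.map (specialize φ h) * V.map (specialize φ h')) *
      (U.map (specialize φ h') * V.map (specialize φ h)) = e.map (specialize φ h) := by
    intro h h'
    calc _ = U.map (specialize φ h) * (V.map (specialize φ h') *
          U.map (specialize φ h')) * V.map (specialize φ h) := by simp only [Matrix.mul_assoc]
      _ = (U.map (specialize φ h) * V.map (specialize φ h)) *
          (U.map (specialize φ h) * V.map (specialize φ h)) := by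
        rw [h2 h', ← h2 h]; simp only [Matrix.mul_assoc]
      _ = _ := by rw [h1, ← Matrix.map_mul, he]
  have h4 : ∀ h : L[X][X], (evalRingHom (0 : L[X])).comp (specialize φ h)
      = specialize φ (h.eval 0) := fun h =>
    comp_specialize φ _ (by ext; simp [algebraMap_eq]) h
  have h5 : ∀ (M : Matrix ι ι L) (h : L[X][X]), (M.map (specialize φ h)).map
      (evalRingHom (0 : L[X])) = M.map (specialize φ (h.eval 0)) := fun M h => by
    rw [← h4]; rfl
  have h6 : eval (0 : L[X]) (C X + X : L[X][X]) = X := by simp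
  have h7 : eval (0 : L[X]) (C X : L[X][X]) = X := by simp
  obtain ⟨Z, hZ⟩ := exists_eq_X_smul_of_map_eval_eq
    (M := U.map (specialize φ (C X + X : L[X][X])) * V.map (specialize φ (C X : L[X][X])))
    (N := e.map (specialize φ (C X : L[X][X])))
    (by rw [Matrix.map_mul, h5, h5, h5, h6, h7, ← Matrix.map_mul, hUV])
  obtain ⟨Z', hZ'⟩ := exists_eq_X_smul_of_map_eval_eq
    (M := U.map (specialize φ (C X : L[X][X])) * V.map (specialize φ (C X + X : L[X][X])))
    (N := e.map (specialize φ (C X : L[X][X])))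
    (by rw [Matrix.map_mul, h5, h5, h5, h6, h7, ← Matrix.map_mul, hUV])
  refine ⟨Z, Z', ?_, ?_⟩
  · rw [← hZ, ← hZ', h3]
  · rw [← hZ, ← hZ', h3]

theorem exists_idemIso_specialize (S : Submonoid B) [IsLocalization S L]
    (φ : B →+* B[X]) (φL : L →+* L[X])
    (hφL : ∀ b, φL (algebraMap B L b) = (φ b).map (algebraMap B L))
    {E : Matrix ι ι B} (hE : E * E = E) {e₀ : Matrix ι ι L}
    (hiso : IdemIso (E.map (algebraMap B L)) e₀)
    (h₀ : ∀ h : L[X][X], e₀.map (specialize φL h) = e₀.map (algebraMap L L[X][X])) :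
    ∃ s ∈ S, IdemIso (E.map (specialize φ (C X + C (C s) * X : B[X][X])))
      (E.map (specialize φ (C X : B[X][X]))) := by
  obtain ⟨Z, Z', hZ1, hZ2⟩ := exists_bivariate_of_specialize_eq φL
    (by rw [← Matrix.map_mul, hE]) hiso h₀
  obtain ⟨c, hc, N, hN⟩ := exists_smul_matrix_eq_map_bivariate S (Matrix.fromCols Z Z')
  obtain ⟨Y, Y', rfl⟩ : ∃ Y Y', N = Matrix.fromCols Y Y' :=
    ⟨N.toCols₁, N.toCols₂, (Matrix.fromCols_toCols N).symm⟩
  set θ := mapRingHom (mapRingHom (algebraMap B L)) with hθ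
  have hY : Y.map θ = (C (C (algebraMap B L c)) : L[X][X]) • Z := by
    ext1 i j
    exact congrFun (congrFun hN i) (Sum.inl j)
  have hY' : Y'.map θ = (C (C (algebraMap B L c)) : L[X][X]) • Z' := by
    ext1 i j
    exact congrFun (congrFun hN i) (Sum.inr j)
  have hθs : ∀ h : B[X][X], (E.map (specialize φ h)).map θ
      = (E.map (algebraMap B L)).map (specialize φL (θ h)) := by
    intro h
    ext1 i j
    rw [Matrix.map_apply, Matrix.map_apply, Matrix.map_apply, Matrix.map_apply,
      specialize_algebraMap φ φL hφL, ← comp_specialize φ θ (by ext; simp [hθ, algebraMap_eq])]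
    rfl
  have hsB : ∀ (a : B[X]) (h : B[X][X]), (E.map (specialize φ h)).map (scaleVar a)
      = E.map (specialize φ (scaleVar a h)) := fun a h =>
    map_specialize φ E (scaleVar a).toRingHom (by ext; simp [algebraMap_eq]) h
  have hsL : ∀ (a : L[X]) (h : L[X][X]),
      ((E.map (algebraMap B L)).map (specialize φL h)).map (scaleVar a)
      = (E.map (algebraMap B L)).map (specialize φL (scaleVar a h)) := fun a h =>
    map_specialize φL _ (scaleVar a).toRingHom (by ext; simp [algebraMap_eq]) h
  have hZc : ∀ (Y : Matrix ι ι B[X][X]) (Z : Matrix ι ι L[X][X]),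
      Y.map θ = (C (C (algebraMap B L c)) : L[X][X]) • Z →
      (E.map (specialize φ (C X : B[X][X])) + (X : B[X][X]) • Y.map (scaleVar (C c))).map θ
      = ((E.map (algebraMap B L)).map (specialize φL (C X : L[X][X])) + (X : L[X][X]) • Z).map
          (scaleVar (C (algebraMap B L c))) := by
    intro Y Z h
    rw [Matrix.map_add _ (map_add _), Matrix.map_add _ (map_add _), hθs, hsL, scaleVar_C,
      map_scaleVar_smul]
    congr 1
    · simp [hθ]
    · ext1 i j
      have h1 := congrFun (congrFun h i) j
      have h2 : θ (scaleVar (C c) (Y i j)) = scaleVar (C (algebraMap B L c)) (θ (Y i j)) := by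
        have := map_scaleVar (mapRingHom (algebraMap B L)) (C c) (Y i j)
        rwa [coe_mapRingHom, map_C] at this
      rw [Matrix.map_apply] at h1
      simp only [Matrix.map_apply, Matrix.smul_apply, smul_eq_mul, map_mul, h2, h1, scaleVar_C]
      simp only [hθ, coe_mapRingHom, map_X]
      ring
  set T := E.map (specialize φ (C X : B[X][X])) + (X : B[X][X]) • Y.map (scaleVar (C c)) with hT
  set T' := E.map (specialize φ (C X : B[X][X])) + (X : B[X][X]) • Y'.map (scaleVar (C c)) with hT'
  have hev : ∀ Y : Matrix ι ι B[X][X],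
      (E.map (specialize φ (C X : B[X][X])) + (X : B[X][X]) • Y).map (evalRingHom 0)
      = E.map (specialize φ (X : B[X])) := by
    intro Y
    rw [Matrix.map_add _ (map_add _),
      map_specialize φ E (evalRingHom (0 : B[X])) (by ext; simp [algebraMap_eq])]
    ext1 i j
    simp
  have key : ∀ (M M' : Matrix ι ι B[X][X]), M.map (evalRingHom 0) = M'.map (evalRingHom 0) →
      M.map θ = M'.map θ → ∃ s ∈ S, ∀ a, M.map (scaleVar (C (s * a)) : B[X][X] → B[X][X])
        = M'.map (scaleVar (C (s * a))) := by
    intro M M' h0 h1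
    obtain ⟨s, hs, h2⟩ := exists_smul_matrix_eq_of_map_eq_bivariate S h1
    refine ⟨s, hs, fun a => ?_⟩
    ext1 i j
    rw [Matrix.map_apply, Matrix.map_apply, ← sub_eq_zero, ← map_sub]
    refine scaleVar_eq_zero ?_ ?_
    · rw [eval_sub, sub_eq_zero]
      exact congrFun (congrFun h0 i) j
    · have := congrFun (congrFun h2 i) j
      rw [Matrix.smul_apply, Matrix.smul_apply, smul_eq_mul, smul_eq_mul, ← sub_eq_zero,
        ← mul_sub] at this
      rw [C_mul, C_mul, mul_comm (C (C s)), mul_assoc, this, mul_zero]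
  have hθc : θ (C X + C (C c) * X) = C X + C (C (algebraMap B L c)) * X := by simp [hθ]
  obtain ⟨s, hs, hs'⟩ := key (T * T') (E.map (specialize φ (C X + C (C c) * X : B[X][X])))
    (by
      rw [Matrix.map_mul, hev, hev, ← Matrix.map_mul, hE,
        map_specialize φ E (evalRingHom (0 : B[X])) (by ext; simp [algebraMap_eq])]
      simp)
    (by
      rw [Matrix.map_mul, hZc Y Z hY, hZc Y' Z' hY', hθs, ← Matrix.map_mul, hZ1, hsL, hθc,
        map_add, scaleVar_C, scaleVar_X])
  obtain ⟨t, ht, ht'⟩ := key (T' * T) (E.map (specialize φ (C X : B[X][X])))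
    (by
      rw [Matrix.map_mul, hev, hev, ← Matrix.map_mul, hE,
        map_specialize φ E (evalRingHom (0 : B[X])) (by ext; simp [algebraMap_eq])]
      simp)
    (by
      rw [Matrix.map_mul, hZc Y Z hY, hZc Y' Z' hY', hθs, ← Matrix.map_mul, hZ2, hsL,
        scaleVar_C]
      simp [hθ])
  refine ⟨c * (s * t), S.mul_mem hc (S.mul_mem hs ht), T.map (scaleVar (C (s * t))),
    T'.map (scaleVar (C (s * t))), ?_, ?_⟩
  · rw [← Matrix.map_mul, hs', hsB, map_add, scaleVar_C, map_mul, scaleVar_C, scaleVar_X]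
    simp only [map_mul, mul_assoc]
  · rw [← Matrix.map_mul, mul_comm s, ht', hsB, scaleVar_C]

end Local

/-- Quillen patching for an idempotent matrix over a `B₀`-algebra `B` with a contraction `φ`
of `B` onto `B₀`. -/
theorem idemIso_of_localization_maximal {ι : Type*} [Fintype ι] (φ : B →ₐ[B₀] B[X]) (ε : B →+* B₀)
    (hφ1 : ∀ b, (φ b).eval 1 = b) (hφ0 : ∀ b, (φ b).eval 0 = algebraMap B₀ B (ε b))
    {E : Matrix ι ι B} (hE : E * E = E)
    (hloc : ∀ (𝔪 : Ideal B₀) [𝔪.IsMaximal],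
      IdemIso (E.map (algebraMap B (Localization (Algebra.algebraMapSubmonoid B 𝔪.primeCompl))))
        ((E.map ((algebraMap B₀ B).comp ε)).map
          (algebraMap B (Localization (Algebra.algebraMapSubmonoid B 𝔪.primeCompl))))) :
    IdemIso E (E.map ((algebraMap B₀ B).comp ε)) := by
  have htop : (specializeIsoIdeal φ.toRingHom hE : Ideal B₀) = ⊤ := by
    by_contra hne
    obtain ⟨𝔪, h𝔪, hle⟩ := Ideal.exists_le_maximal _ hne
    set S := Algebra.algebraMapSubmonoid B 𝔪.primeCompl
    set L := Localization S
    set g : B →+* L[X] := (mapRingHom (algebraMap B L)).comp φ.toRingHom with hg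
    have hgB₀ : ∀ b : B₀, g (algebraMap B₀ B b) = C (algebraMap B L (algebraMap B₀ B b)) := by
      intro b
      simp [hg, Polynomial.algebraMap_apply]
    have hunit : ∀ s : S, IsUnit (g s) := by
      rintro ⟨_, s, hs, rfl⟩
      rw [hgB₀]
      exact (IsLocalization.map_units L (⟨_, s, hs, rfl⟩ : S)).map C
    obtain ⟨_, ⟨s, hs, rfl⟩, h⟩ := exists_idemIso_specialize S φ.toRingHom
      (IsLocalization.lift hunit) (fun b => IsLocalization.lift_eq hunit b) hE (hloc 𝔪) (by
        intro h
        ext1 i j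
        simp only [Matrix.map_apply, RingHom.comp_apply]
        rw [specialize_apply, IsLocalization.lift_eq, hgB₀, aeval_C])
    refine hs (hle fun A _ _ x y => ?_)
    have h' := h.map (eval₂RingHom (eval₂RingHom (algebraMap B A) x) y)
    rw [map_specialize _ _ _ (by ext; simp [algebraMap_eq, Polynomial.algebraMap_apply]),
      map_specialize _ _ _ (by ext; simp [algebraMap_eq, Polynomial.algebraMap_apply])] at h'
    simpa using h'
  have h1 : (1 : B₀) ∈ (specializeIsoIdeal φ.toRingHom hE : Ideal B₀) := by rw [htop]; trivial
  have h2 := h1 B 0 1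
  rw [map_one, map_one, mul_one, zero_add] at h2
  have h3 : E.map (specialize φ.toRingHom (1 : B)) = E := by
    ext1 i j
    rw [Matrix.map_apply, specialize_apply, coe_aeval_eq_eval]
    exact hφ1 _
  have h4 : E.map (specialize φ.toRingHom (0 : B)) = E.map ((algebraMap B₀ B).comp ε) := by
    ext1 i j
    rw [Matrix.map_apply, specialize_apply, coe_aeval_eq_eval]
    exact hφ0 _
  rwa [h3, h4] at h2

end Patching

end QuillenPatching

namespace IsHorrocksFiltration

variable {B₀ B A₀ A : Type*} [CommRing B₀] [CommRing B] [Algebra B₀ B] [CommRing A₀] [CommRing A]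
  [Algebra B₀ A₀] [Algebra B A] [Algebra A₀ A] [Algebra B₀ A] [IsScalarTower B₀ B A]
  [IsScalarTower B₀ A₀ A] {d : ℕ} {z : B} {F : ℕ → Submodule B₀ B}

theorem mem_span_image_iff (S : Submonoid B₀) [IsLocalization S A₀]
    [IsLocalization (Algebra.algebraMapSubmonoid B S) A] (N : Submodule B₀ B) {a : A} :
    a ∈ Submodule.span A₀ (algebraMap B A '' N) ↔ ∃ s ∈ S, ∃ b ∈ N, s • a = algebraMap B A b := by
  have := isLocalizedModule_iff_isLocalization.2
    (inferInstance : IsLocalization (Algebra.algebraMapSubmonoid B S) A)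
  have h : N.localized' A₀ S (IsScalarTower.toAlgHom B₀ B A).toLinearMap
    = Submodule.span A₀ (algebraMap B A '' N) := Submodule.localized'_eq_span ..
  rw [← h, Submodule.mem_localized']
  constructor
  · rintro ⟨m, hm, s, rfl⟩
    exact ⟨s, s.2, m, hm, IsLocalizedModule.mk'_cancel' _ m s⟩
  · rintro ⟨s, hs, b, hb, h⟩
    exact ⟨b, hb, ⟨s, hs⟩, IsLocalizedModule.mk'_eq_iff.2 h.symm⟩

theorem localization (h : IsHorrocksFiltration d z F) (S : Submonoid B₀) [IsLocalization S A₀]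
    [IsLocalization (Algebra.algebraMapSubmonoid B S) A] :
    IsHorrocksFiltration d (algebraMap B A z)
      (fun k => Submodule.span A₀ (algebraMap B A '' (F k : Set B))) where
  d_pos := h.d_pos
  mono i j hij := Submodule.span_mono (Set.image_mono (h.mono hij))
  exhaust a := by
    have := isLocalizedModule_iff_isLocalization.2
      (inferInstance : IsLocalization (Algebra.algebraMapSubmonoid B S) A)
    obtain ⟨⟨b, s⟩, hb⟩ := IsLocalizedModule.surj S (IsScalarTower.toAlgHom B₀ B A).toLinearMap a
    obtain ⟨k, hk⟩ := h.exhaust b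
    exact ⟨k, (mem_span_image_iff S (F k)).2 ⟨s, s.2, b, hk, hb⟩⟩
  one_mem := Submodule.subset_span ⟨1, h.one_mem, map_one _⟩
  mul_mem := by
    intro i j a b ha hb
    obtain ⟨s, hs, x, hx, hsx⟩ := (mem_span_image_iff S (F i)).1 ha
    obtain ⟨t, ht, y, hy, hty⟩ := (mem_span_image_iff S (F j)).1 hb
    exact (mem_span_image_iff S (F (i + j))).2 ⟨s * t, S.mul_mem hs ht, x * y, h.mul_mem hx hy, by
      rw [map_mul, ← hsx, ← hty, smul_mul_smul_comm]⟩
  z_mem := Submodule.subset_span ⟨z, h.z_mem, rfl⟩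
  div := by
    intro k b hb
    obtain ⟨s, hs, x, hx, hsx⟩ := (mem_span_image_iff S (F _)).1 hb
    obtain ⟨q, hq, hxq⟩ := h.div hx
    obtain ⟨u, hu⟩ := (IsLocalization.map_units A₀ (⟨s, hs⟩ : S))
    have hsm : ∀ a : A, s • a = (u : A₀) • a := fun a => by
      rw [hu, algebraMap_smul]
    refine ⟨(↑u⁻¹ : A₀) • algebraMap B A q, Submodule.smul_mem _ _
      (Submodule.subset_span ⟨q, hq, rfl⟩), ?_⟩
    have : b - algebraMap B A z * (↑u⁻¹ : A₀) • algebraMap B A q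
        = (↑u⁻¹ : A₀) • algebraMap B A (x - z * q) := by
      rw [map_sub, ← hsx, hsm, smul_sub, smul_smul, Units.inv_mul, one_smul, map_mul,
        mul_smul_comm]
    rw [this]
    exact Submodule.smul_mem _ _ (Submodule.subset_span ⟨_, hxq, rfl⟩)
  fg k := by
    obtain ⟨T, hT⟩ := h.fg k
    have := isLocalizedModule_iff_isLocalization.2
      (inferInstance : IsLocalization (Algebra.algebraMapSubmonoid B S) A)
    have h1 : (F k).localized' A₀ S (IsScalarTower.toAlgHom B₀ B A).toLinearMap
      = Submodule.span A₀ (algebraMap B A '' F k) := Submodule.localized'_eq_span ..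
    rw [← h1, ← hT, Submodule.localized'_span]
    exact Submodule.fg_span (T.finite_toSet.image _)

end IsHorrocksFiltration

/-- The theorem of Horrocks together with Quillen patching: an oriented idempotent matrix over `B` which
becomes free after inverting the monic polynomials in `z` is extended from `B₀`. -/
theorem IsHorrocksFiltration.idemIso_contraction {B₀ B : Type*} [CommRing B₀] [CommRing B]
    [Algebra B₀ B] [IsNoetherianRing B] {d : ℕ} {z : B} {F : ℕ → Submodule B₀ B}
    (h : IsHorrocksFiltration d z F) (φ : B →ₐ[B₀] Polynomial B) (ε : B →+* B₀)
    (hφ1 : ∀ b, (φ b).eval 1 = b) (hφ0 : ∀ b, (φ b).eval 0 = algebraMap B₀ B (ε b))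
    {ι : Type*} [Fintype ι] {n : ℕ} {E : Matrix ι ι B} (hE : OrientedIdem (n + 1) E)
    (hW : IdemFree (n + 1) (E.map (algebraMap B (Localization (monicValues B₀ z)))))
    (hε : IdemFree (n + 1) (E.map ε)) :
    IdemFree (n + 1) E := by
  have key : IdemIso E (E.map ((algebraMap B₀ B).comp ε)) := by
    refine idemIso_of_localization_maximal φ ε hφ1 hφ0 hE.1 fun 𝔪 _ => ?_
    set S := Algebra.algebraMapSubmonoid B 𝔪.primeCompl
    set L := Localization S
    set A₀ := Localization 𝔪.primeCompl
    have hEL := hE.map (algebraMap B L)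
    have hL : IdemFree (n + 1) (E.map (algebraMap B L)) := by
      have hloc : IsLocalRing A₀ := IsLocalization.AtPrime.isLocalRing A₀ 𝔪
      have hnoeth : IsNoetherianRing L := IsLocalization.isNoetherianRing S L inferInstance
      set W := Localization (monicValues A₀ (algebraMap B L z))
      have hunit : ∀ y : monicValues B₀ z, IsUnit (((algebraMap L W).comp (algebraMap B L)) y) := by
        rintro ⟨_, g, hg, rfl⟩
        refine IsLocalization.map_units W (⟨_, g.map (algebraMap B₀ A₀), hg.map _, ?_⟩ :
          monicValues A₀ (algebraMap B L z))
        rw [Polynomial.aeval_map_algebraMap]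
        exact Polynomial.aeval_algebraMap_apply L z g
      refine (h.localization (A₀ := A₀) (A := L) 𝔪.primeCompl).idemFree (W := W) hEL ?_
      convert hW.map (IsLocalization.lift hunit) using 1
      ext1 i j
      simp only [Matrix.map_apply, IsLocalization.lift_eq, RingHom.comp_apply]
    have hL' : IdemFree (n + 1) ((E.map ((algebraMap B₀ B).comp ε)).map (algebraMap B L)) := by
      have := hε.map ((algebraMap B L).comp (algebraMap B₀ B))
      exact this
    exact hL.trans hL'.symm hEL.1 ((hE.map ((algebraMap B₀ B).comp ε)).map (algebraMap B L)).1
  exact key.trans (hε.map (algebraMap B₀ B)) hE.1 (by simp)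

namespace AddMonoidAlgebra

section DegreeContraction

variable {R M M₀ : Type*} [CommRing R] [AddCommMonoid M] [AddCommMonoid M₀]
  (δ : M →+ ℕ) (j : M₀ →+ M)

open scoped Classical in
/-- The retraction of `R[M]` onto `R[M₀]` killing the monomials of positive degree. -/
noncomputable def degreeZeroPart (hj : Function.Injective j) (hδ : ∀ x, δ x = 0 ↔ ∃ y, j y = x) :
    AddMonoidAlgebra R M →ₐ[R] AddMonoidAlgebra R M₀ :=
  AddMonoidAlgebra.lift R (AddMonoidAlgebra R M₀) M
    { toFun x := if h : ∃ y, j y = x.toAdd then single h.choose 1 else 0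
      map_one' := by
        have h : ∃ y, j y = (1 : Multiplicative M).toAdd := ⟨0, map_zero j⟩
        rw [dif_pos h, hj (h.choose_spec.trans (map_zero j).symm), one_def]
      map_mul' x y := by
        by_cases hx : ∃ a, j a = x.toAdd
        · by_cases hy : ∃ b, j b = y.toAdd
          · have h : ∃ c, j c = (x * y).toAdd :=
              ⟨hx.choose + hy.choose, by rw [map_add, hx.choose_spec, hy.choose_spec]; rfl⟩
            have h' : h.choose = hx.choose + hy.choose := hj (by
              rw [h.choose_spec, map_add, hx.choose_spec, hy.choose_spec]; rfl)
            rw [dif_pos hx, dif_pos hy, dif_pos h, single_mul_single, h', one_mul]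
          · rw [dif_neg hy, mul_zero, dif_neg]
            rw [← hδ, toAdd_mul, map_add]
            rw [← hδ] at hy
            omega
        · rw [dif_neg hx, zero_mul, dif_neg]
          rw [← hδ, toAdd_mul, map_add]
          rw [← hδ] at hx
          omega }

variable {δ j} in
theorem degreeZeroPart_single (hj : Function.Injective j) (hδ : ∀ x, δ x = 0 ↔ ∃ y, j y = x)
    (y : M₀) (a : R) : degreeZeroPart δ j hj hδ (single (j y) a) = single y a := by
  have h : ∃ b, j b = (Multiplicative.ofAdd (j y)).toAdd := ⟨y, rfl⟩
  rw [degreeZeroPart, lift_single]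
  simp only [MonoidHom.coe_mk, OneHom.coe_mk]
  rw [dif_pos h, hj h.choose_spec]
  simp

variable {δ j} in
theorem degreeZeroPart_single_of_ne (hj : Function.Injective j)
    (hδ : ∀ x, δ x = 0 ↔ ∃ y, j y = x) {x : M} (hx : δ x ≠ 0) (a : R) :
    degreeZeroPart δ j hj hδ (single x a) = 0 := by
  rw [degreeZeroPart, lift_single]
  simp only [MonoidHom.coe_mk, OneHom.coe_mk]
  rw [dif_neg (by rwa [← hδ]), smul_zero]

/-- The coaction of `R[X]` on `R[M]` given by the degree `δ`. -/
noncomputable def degreeCoaction : AddMonoidAlgebra R M →ₐ[R] Polynomial (AddMonoidAlgebra R M) :=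
  AddMonoidAlgebra.lift R _ M
    { toFun x := Polynomial.monomial (δ x.toAdd) (single x.toAdd 1)
      map_one' := by simp [← one_def]
      map_mul' x y := by
        rw [Polynomial.monomial_mul_monomial, single_mul_single, toAdd_mul, map_add, one_mul] }

theorem degreeCoaction_single (x : M) (a : R) :
    degreeCoaction δ (single x a) = Polynomial.monomial (δ x) (single x a) := by
  rw [degreeCoaction, lift_single]
  simp [Polynomial.smul_monomial]

variable [Algebra (AddMonoidAlgebra R M₀) (AddMonoidAlgebra R M)]

theorem isHorrocksFiltration
    (halg : ∀ b, algebraMap (AddMonoidAlgebra R M₀) (AddMonoidAlgebra R M) b = mapDomain j b)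
    (hδ : ∀ x, δ x = 0 ↔ ∃ y, j y = x) {z : M} (hz : 0 < δ z)
    (hdiv : ∀ x, δ z < δ x → ∃ y, x = z + y)
    (hfin : ∀ k, ∃ G : Set M, G.Finite ∧ ∀ x, δ x ≤ k → ∃ g ∈ G, ∃ y, x = g + j y) :
    IsHorrocksFiltration (δ z) (single z 1 : AddMonoidAlgebra R M)
      (fun k => Submodule.span (AddMonoidAlgebra R M₀)
        ((fun x => (single x 1 : AddMonoidAlgebra R M)) '' {x | δ x ≤ k})) := by
  have hsm : ∀ (y : M₀) (a : R) (x : M), (single y a : AddMonoidAlgebra R M₀) •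
      (single x 1 : AddMonoidAlgebra R M) = single (x + j y) a := by
    intro y a x
    rw [Algebra.smul_def, halg, mapDomain_single, single_mul_single, mul_one, add_comm]
  refine ⟨hz, ?_, ?_, ?_, ?_, ?_, ?_, ?_⟩
  · intro i k hik
    exact Submodule.span_mono (Set.image_mono fun x hx => le_trans hx hik)
  · intro b
    induction b using AddMonoidAlgebra.induction_linear with
    | zero => exact ⟨0, Submodule.zero_mem _⟩
    | add f g hf hg =>
      obtain ⟨k, hk⟩ := hf
      obtain ⟨l, hl⟩ := hg
      exact ⟨max k l, Submodule.add_mem _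
        (Submodule.span_mono (Set.image_mono fun x hx => le_trans hx (le_max_left k l)) hk)
        (Submodule.span_mono (Set.image_mono fun x hx => le_trans hx (le_max_right k l)) hl)⟩
    | single x a =>
      refine ⟨δ x, ?_⟩
      have := hsm 0 a x
      rw [map_zero, add_zero] at this
      rw [← this]
      exact Submodule.smul_mem _ _ (Submodule.subset_span ⟨x, le_refl (δ x), rfl⟩)
  · exact Submodule.subset_span ⟨0, by simp, rfl⟩
  · intro i k a b ha hb
    have := Submodule.mul_mem_mul ha hb
    rw [Submodule.span_mul_span] at this
    refine Submodule.span_mono ?_ this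
    rintro _ ⟨_, ⟨x, hx, rfl⟩, _, ⟨y, hy, rfl⟩, rfl⟩
    refine ⟨x + y, ?_, ?_⟩
    · rw [Set.mem_ofPred_eq, map_add]
      exact add_le_add hx hy
    · simp only [single_mul_single, mul_one]
  · exact Submodule.subset_span ⟨z, le_refl (δ z), rfl⟩
  · intro k b hb
    induction hb using Submodule.span_induction with
    | zero => exact ⟨0, Submodule.zero_mem _, by simp⟩
    | add f g _ _ hf hg =>
      obtain ⟨p, hp, hp'⟩ := hf
      obtain ⟨q, hq, hq'⟩ := hg
      refine ⟨p + q, Submodule.add_mem _ hp hq, ?_⟩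
      convert Submodule.add_mem _ hp' hq' using 1
      ring
    | smul a f _ hf =>
      obtain ⟨p, hp, hp'⟩ := hf
      refine ⟨a • p, Submodule.smul_mem _ _ hp, ?_⟩
      convert Submodule.smul_mem _ a hp' using 1
      rw [smul_sub, mul_smul_comm]
    | mem b hb =>
      obtain ⟨x, hx, rfl⟩ := hb
      rw [Set.mem_ofPred_eq] at hx
      by_cases h : δ z < δ x
      · obtain ⟨y, rfl⟩ := hdiv x h
        rw [map_add] at hx
        refine ⟨single y 1, Submodule.subset_span ⟨y, by rw [Set.mem_ofPred_eq]; omega, rfl⟩, ?_⟩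
        simp only [single_mul_single, mul_one, sub_self]
        exact Submodule.zero_mem _
      · refine ⟨0, Submodule.zero_mem _, ?_⟩
        rw [mul_zero, sub_zero]
        exact Submodule.subset_span ⟨x, by rw [Set.mem_ofPred_eq]; omega, rfl⟩
  · intro k
    obtain ⟨G, hG, hG'⟩ := hfin k
    have : Submodule.span (AddMonoidAlgebra R M₀)
        ((fun x => (single x 1 : AddMonoidAlgebra R M)) '' {x | δ x ≤ k})
        = Submodule.span (AddMonoidAlgebra R M₀)
        ((fun x => (single x 1 : AddMonoidAlgebra R M)) '' (G ∩ {x | δ x ≤ k})) := by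
      apply le_antisymm
      · rw [Submodule.span_le]
        rintro _ ⟨x, hx, rfl⟩
        obtain ⟨g, hg, y, rfl⟩ := hG' x hx
        have h0 : δ (j y) = 0 := (hδ _).2 ⟨y, rfl⟩
        rw [Set.mem_ofPred_eq, map_add, h0, add_zero] at hx
        have h1 := hsm y 1 g
        simp only [← h1]
        exact Submodule.smul_mem _ _ (Submodule.subset_span ⟨g, ⟨hg, hx⟩, rfl⟩)
      · exact Submodule.span_mono (Set.image_mono Set.inter_subset_right)
    rw [this]
    exact Submodule.fg_span ((hG.subset Set.inter_subset_left).image _)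

end DegreeContraction

theorem idemFree_of_degree {R M M₀ : Type*} [CommRing R] [AddCommMonoid M] [AddCommMonoid M₀]
    [IsNoetherianRing (AddMonoidAlgebra R M)] (δ : M →+ ℕ) (j : M₀ →+ M)
    (hj : Function.Injective j) (hδ : ∀ x, δ x = 0 ↔ ∃ y, j y = x) {z : M} (hz : 0 < δ z)
    (hdiv : ∀ x, δ z < δ x → ∃ y, x = z + y)
    (hfin : ∀ k, ∃ G : Set M, G.Finite ∧ ∀ x, δ x ≤ k → ∃ g ∈ G, ∃ y, x = g + j y)
    {ι : Type*} [Fintype ι] {n : ℕ} {E : Matrix ι ι (AddMonoidAlgebra R M)}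
    (hE : OrientedIdem (n + 1) E)
    (hW : IdemFree (n + 1) (E.map (algebraMap _
      (Localization (monicValues R (single z 1 : AddMonoidAlgebra R M))))))
    (h₀ : IdemFree (n + 1) (E.map (degreeZeroPart δ j hj hδ))) :
    IdemFree (n + 1) E := by
  let _ : Algebra (AddMonoidAlgebra R M₀) (AddMonoidAlgebra R M) := (mapDomainRingHom R j).toAlgebra
  have halg : ∀ b, algebraMap (AddMonoidAlgebra R M₀) (AddMonoidAlgebra R M) b = mapDomain j b :=
    fun b => rfl
  have hlin : ∀ f g : AddMonoidAlgebra R M →+ AddMonoidAlgebra R M,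
      (∀ x a, f (single x a) = g (single x a)) → ∀ b, f b = g b := by
    intro f g hfg b
    induction b using AddMonoidAlgebra.induction_linear with
    | zero => simp
    | add p q hp hq => rw [map_add, map_add, hp, hq]
    | single x a => exact hfg x a
  let φ : AddMonoidAlgebra R M →ₐ[AddMonoidAlgebra R M₀] Polynomial (AddMonoidAlgebra R M) :=
    { (degreeCoaction δ).toRingHom with
      commutes' := by
        intro b
        change degreeCoaction δ (algebraMap _ _ b) = Polynomial.C (algebraMap _ _ b)
        rw [halg]
        induction b using AddMonoidAlgebra.induction_linear with
        | zero => simp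
        | add p q hp hq => rw [mapDomain_add, map_add, hp, hq, map_add]
        | single y a =>
          rw [mapDomain_single, degreeCoaction_single, (hδ (j y)).2 ⟨y, rfl⟩]
          rfl }
  refine (isHorrocksFiltration (R := R) δ j halg hδ hz hdiv hfin).idemIso_contraction φ
    (degreeZeroPart δ j hj hδ).toRingHom ?_ ?_ hE ?_ h₀
  · refine hlin ((Polynomial.evalRingHom 1).comp φ.toRingHom).toAddMonoidHom (AddMonoidHom.id _) ?_
    intro x a
    change Polynomial.eval 1 (degreeCoaction δ (single x a)) = single x a
    rw [degreeCoaction_single]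
    simp
  · refine hlin ((Polynomial.evalRingHom 0).comp φ.toRingHom).toAddMonoidHom
      ((mapDomainRingHom R j).comp (degreeZeroPart δ j hj hδ).toRingHom).toAddMonoidHom ?_
    intro x a
    change Polynomial.eval 0 (degreeCoaction δ (single x a))
      = mapDomain j (degreeZeroPart δ j hj hδ (single x a))
    rw [degreeCoaction_single, Polynomial.eval_monomial]
    by_cases hx : δ x = 0
    · obtain ⟨y, rfl⟩ := (hδ x).1 hx
      rw [degreeZeroPart_single, mapDomain_single, hx, pow_zero, mul_one]
    · rw [degreeZeroPart_single_of_ne hj hδ hx, mapDomain_zero, zero_pow hx, mul_zero]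
  · set W := Localization (monicValues (AddMonoidAlgebra R M₀) (single z 1 : AddMonoidAlgebra R M))
    have hunit : ∀ y : monicValues R (single z 1 : AddMonoidAlgebra R M),
        IsUnit (algebraMap (AddMonoidAlgebra R M) W y) := by
      rintro ⟨_, g, hg, rfl⟩
      refine IsLocalization.map_units W (⟨_, g.map (algebraMap R (AddMonoidAlgebra R M₀)),
        hg.map _, ?_⟩ : monicValues (AddMonoidAlgebra R M₀) (single z 1 : AddMonoidAlgebra R M))
      have : (algebraMap (AddMonoidAlgebra R M₀) (AddMonoidAlgebra R M)).comp
          (algebraMap R (AddMonoidAlgebra R M₀)) = algebraMap R (AddMonoidAlgebra R M) := by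
        ext a
        rw [RingHom.comp_apply, halg]
        simp
      rw [Polynomial.aeval_def, Polynomial.eval₂_map, this, Polynomial.aeval_def]
    convert hW.map (IsLocalization.lift hunit) using 1
    ext1 i k
    simp only [Matrix.map_apply, IsLocalization.lift_eq]
    rfl

end AddMonoidAlgebra

section DegreeFG

variable {M M₀ : Type*} [AddCommMonoid M] [AddCommMonoid M₀] (δ : M →+ ℕ) (j : M₀ →+ M)

theorem AddMonoid.FG.exists_finite_of_degree_le [AddMonoid.FG M]
    (hδ : ∀ x, δ x = 0 ↔ ∃ y, j y = x) (k : ℕ) :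
    ∃ G : Set M, G.Finite ∧ ∀ x, δ x ≤ k → ∃ g ∈ G, ∃ y, x = g + j y := by
  obtain ⟨T, hT⟩ := AddMonoid.FG.fg_top (M := M)
  have key : ∀ x : M, x ∈ AddSubmonoid.closure (T : Set M) → ∀ k, δ x ≤ k →
      ∃ g ∈ (fun G => G ∪ (Set.image2 (· + ·) (T : Set M) G))^[k] {0}, ∃ y, x = g + j y := by
    intro x hx
    induction hx using AddSubmonoid.closure_induction_left with
    | zero =>
      intro k _
      refine ⟨0, ?_, 0, by simp⟩
      clear * -
      induction k with
      | zero => simp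
      | succ k ih =>
        rw [Function.iterate_succ_apply']
        exact Or.inl ih
    | add_left t ht x _ ih =>
      intro k hk
      rw [map_add] at hk
      by_cases h : δ t = 0
      · obtain ⟨y, rfl⟩ := (hδ t).1 h
        obtain ⟨g, hg, y', rfl⟩ := ih k (by omega)
        exact ⟨g, hg, y + y', by rw [map_add]; abel⟩
      · obtain ⟨k, rfl⟩ : ∃ l, k = l + 1 := ⟨k - 1, by omega⟩
        obtain ⟨g, hg, y, rfl⟩ := ih k (by omega)
        refine ⟨t + g, ?_, y, by rw [add_assoc]⟩
        rw [Function.iterate_succ_apply']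
        exact Or.inr ⟨t, ht, g, hg, rfl⟩
  refine ⟨_, ?_, fun x hx => key x (hT ▸ AddSubmonoid.mem_top x) k hx⟩
  induction k with
  | zero => simp
  | succ k ih =>
    rw [Function.iterate_succ_apply']
    exact ih.union (T.finite_toSet.image2 _ ih)

theorem AddMonoid.FG.of_degree_eq_zero [AddMonoid.FG M] (hj : Function.Injective j)
    (hδ : ∀ x, δ x = 0 ↔ ∃ y, j y = x) : AddMonoid.FG M₀ := by
  obtain ⟨T, hT⟩ := AddMonoid.FG.fg_top (M := M)
  have key : ∀ x : M, x ∈ AddSubmonoid.closure (T : Set M) → ∀ y, j y = x →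
      y ∈ AddSubmonoid.closure (j ⁻¹' (T : Set M)) := by
    intro x hx
    induction hx using AddSubmonoid.closure_induction_left with
    | zero =>
      intro y hy
      rw [hj (hy.trans (map_zero j).symm)]
      exact AddSubmonoid.zero_mem _
    | add_left t ht x _ ih =>
      intro y hy
      have h0 : δ t + δ x = 0 := by
        rw [← map_add, ← hy]
        exact (hδ _).2 ⟨y, rfl⟩
      obtain ⟨y1, rfl⟩ := (hδ t).1 (by omega)
      obtain ⟨y2, rfl⟩ := (hδ x).1 (by omega)
      rw [← map_add] at hy
      rw [hj hy]
      exact AddSubmonoid.add_mem _ (AddSubmonoid.subset_closure ht) (ih y2 rfl)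
  have hfin : (j ⁻¹' (T : Set M)).Finite := T.finite_toSet.preimage hj.injOn
  exact ⟨⟨hfin.toFinset, by
    rw [hfin.coe_toFinset, eq_top_iff]
    exact fun y _ => key (j y) (hT ▸ AddSubmonoid.mem_top _) y rfl⟩⟩

end DegreeFG

/-- The combinatorial properties of the monoids in the class `C(Φ)` used in the proof: every
truncation projects onto its last coordinate axis after a shear, and contains elements of slope one
in every other coordinate. -/
structure IsShearable {r : ℕ} (M : AddSubmonoid (Fin r → ℕ)) : Prop where
  fg : M.FG
  integral : ∃ N : ℕ, 0 < N ∧ ∀ x, N • x ∈ M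
  seminormal : ∀ {b x : Fin r → ℕ}, b ∈ M → b + x ∈ M → 2 • x ∈ M → 3 • x ∈ M → x ∈ M
  shear : ∀ m : Fin r, ∃ c : Fin r → ℕ, ∀ x ∈ M, (∀ i, m < i → x i = 0) →
    Pi.single m (x m + ∑ i with i < m, c i * x i) ∈ M
  slope : ∀ m i : Fin r, i < m → ∃ k : ℕ, Pi.single i 1 + Pi.single m k ∈ M

namespace IsShearable

variable {r : ℕ}

theorem top : IsShearable (⊤ : AddSubmonoid (Fin r → ℕ)) where
  fg := by
    have := AddSubmonoid.FG.pi (M := fun _ : Fin r => ℕ) (P := fun _ => ⊤)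
      fun _ => ⟨{1}, by simp⟩
    rwa [AddSubmonoid.pi_top] at this
  integral := ⟨1, one_pos, fun _ => trivial⟩
  seminormal _ _ _ _ := trivial
  shear _ := ⟨0, fun _ _ _ => trivial⟩
  slope _ _ _ := ⟨0, trivial⟩

theorem mem_of_forall_ge {M : AddSubmonoid (Fin r → ℕ)} (hM : IsShearable M) {x : Fin r → ℕ}
    {k₀ : ℕ} (h : ∀ k, k₀ ≤ k → k • x ∈ M) : x ∈ M := by
  induction k₀ with
  | zero => simpa using h 1 (Nat.zero_le _)
  | succ k₀ ih =>
    by_cases h0 : k₀ = 0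
    · subst h0
      simpa using h 1 le_rfl
    · refine ih fun k hk => ?_
      rcases hk.eq_or_lt with rfl | hk
      · refine hM.seminormal (b := (k₀ + 1) • x) (h _ le_rfl) ?_ ?_ ?_
        · rw [← add_smul]
          exact h _ (by omega)
        · rw [smul_smul]
          exact h _ (by omega)
        · rw [smul_smul]
          exact h _ (by omega)
      · exact h k hk

theorem mem_of_add_eq_smul {M : AddSubmonoid (Fin r → ℕ)} (hM : IsShearable M)
    {b b' x : Fin r → ℕ} (hb : b ∈ M) (hbx : b + x ∈ M) (hb' : b' ∈ M) {K : ℕ}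
    (hK : b + b' = K • x) : x ∈ M := by
  obtain ⟨N, hN, hNM⟩ := hM.integral
  have hs : ∀ s : ℕ, (s * (K * N) + s) • x ∈ M := by
    intro s
    have h1 := M.add_mem (M.nsmul_mem hbx s) (M.add_mem (M.nsmul_mem hb' s)
      (M.nsmul_mem (M.add_mem hb hb') (s * (N - 1))))
    convert h1 using 1
    obtain ⟨N, rfl⟩ : ∃ l, N = l + 1 := ⟨N - 1, by omega⟩
    funext i
    have := congrFun hK i
    simp only [Pi.add_apply, Pi.smul_apply, smul_eq_mul, Nat.add_sub_cancel] at this ⊢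
    have h2 : b i = K * x i - b' i := by omega
    zify at this ⊢
    linear_combination (-s - s * (N : ℤ)) * this
  refine hM.mem_of_forall_ge (k₀ := N * (K * N) + N) fun k hk => ?_
  have hlt := Nat.mod_lt k hN
  have h1 : (k % N) * (K * N) ≤ N * (K * N) := Nat.mul_le_mul_right _ hlt.le
  have h2 := Nat.div_add_mod k N
  obtain ⟨t, ht⟩ : N ∣ k - ((k % N) * (K * N) + k % N) := by
    have : k - ((k % N) * (K * N) + k % N) = N * (k / N) - N * ((k % N) * K) := by
      have : (k % N) * (K * N) = N * ((k % N) * K) := by ring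
      omega
    rw [this]
    exact Nat.dvd_sub (dvd_mul_right _ _) (dvd_mul_right _ _)
  have h3 : k = ((k % N) * (K * N) + k % N) + t * N := by
    rw [mul_comm t, ← ht]
    omega
  rw [h3, add_smul, mul_smul]
  exact M.add_mem (hs _) (M.nsmul_mem (hNM x) t)

theorem exists_dvd {M : AddSubmonoid (Fin r → ℕ)} (hM : IsShearable M) (m : Fin r) :
    ∃ d : ℕ, 0 < d ∧ Pi.single m d ∈ M ∧ (∀ k, Pi.single m k ∈ M → d ∣ k) ∧
      ∀ x ∈ M, d < x m → ∃ y ∈ M, x = Pi.single m d + y := by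
  classical
  obtain ⟨N, hN, hNM⟩ := hM.integral
  have hex : ∃ d : ℕ, 0 < d ∧ Pi.single m d ∈ M :=
    ⟨N, hN, by simpa [← Pi.single_smul] using hNM (Pi.single m 1)⟩
  obtain ⟨hd, hdM⟩ := Nat.find_spec hex
  set d := Nat.find hex
  have hmul : ∀ k : ℕ, Pi.single m (k * d) ∈ M := fun k => by
    simpa [← Pi.single_smul] using M.nsmul_mem hdM k
  refine ⟨d, hd, hdM, ?_, ?_⟩
  · intro k hk
    by_contra hdk
    have hpos : 0 < k % d := Nat.pos_of_ne_zero fun h => hdk (Nat.dvd_of_mod_eq_zero h)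
    refine Nat.find_min hex (Nat.mod_lt k hd) ⟨hpos, ?_⟩
    obtain ⟨g, hg⟩ : ∃ g, k % d = g + 1 := ⟨k % d - 1, by omega⟩
    refine hM.mem_of_add_eq_smul (hmul (k / d)) ?_ (hmul (k / d * g)) (K := k / d * d) ?_
    · rw [← Pi.single_add, Nat.div_add_mod']
      exact hk
    · rw [← Pi.single_add, ← Pi.single_smul, smul_eq_mul, hg]
      congr 1
      ring
  · intro x hx hlt
    have hle : Pi.single m d ≤ x := by
      intro i
      by_cases h : i = m
      · subst h
        simpa using hlt.le
      · simp [Pi.single_eq_of_ne h]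
    obtain ⟨y, rfl⟩ := exists_add_of_le hle
    refine ⟨y, ?_, rfl⟩
    have hy : Pi.single m 1 ≤ y := by
      intro i
      by_cases h : i = m
      · subst h
        have : d < d + y i := by simpa using hlt
        simp only [Pi.single_eq_same]
        omega
      · simp [Pi.single_eq_of_ne h]
    obtain ⟨y', rfl⟩ := exists_add_of_le hy
    refine hM.mem_of_add_eq_smul hdM hx (M.add_mem (M.nsmul_mem (hNM y') d) (hmul (N - 1)))
      (K := d * N) ?_
    obtain ⟨N, rfl⟩ : ∃ l, N = l + 1 := ⟨N - 1, by omega⟩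
    funext i
    by_cases h : i = m
    · subst h
      simp
      ring
    · simp [Pi.single_eq_of_ne h]
      ring

end IsShearable

/-- Appending a zero coordinate. -/
def snocZero (r : ℕ) : (Fin r → ℕ) →+ (Fin (r + 1) → ℕ) where
  toFun x := Fin.snoc (α := fun _ => ℕ) x 0
  map_zero' := by
    funext i
    induction i using Fin.lastCases <;> simp
  map_add' x y := by
    funext i
    induction i using Fin.lastCases <;> simp

section

variable {r : ℕ}

@[simp]
theorem snocZero_last (x : Fin r → ℕ) : snocZero r x (Fin.last r) = 0 := by
  simp [snocZero]

@[simp]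
theorem snocZero_castSucc (x : Fin r → ℕ) (i : Fin r) : snocZero r x i.castSucc = x i := by
  simp [snocZero]

theorem snocZero_injective : Function.Injective (snocZero r) := fun x y h => by
  funext i
  simpa using congrFun h i.castSucc

theorem snocZero_single (m : Fin r) (k : ℕ) :
    snocZero r (Pi.single m k) = Pi.single m.castSucc k := by
  funext i
  induction i using Fin.lastCases with
  | last => simp
  | cast i => by_cases h : i = m <;> simp [h]

theorem eq_snocZero_of_last_eq_zero {x : Fin (r + 1) → ℕ} (hx : x (Fin.last r) = 0) :
    snocZero r (Fin.init x) = x := by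
  funext i
  induction i using Fin.lastCases with
  | last => simp [hx]
  | cast i => simp [Fin.init]

/-- The last coordinate, as a degree on a submonoid of `ℕ^{r+1}`. -/
def lastCoord (M : AddSubmonoid (Fin (r + 1) → ℕ)) : M →+ ℕ :=
  (Pi.evalAddMonoidHom (fun _ => ℕ) (Fin.last r)).comp M.subtype

/-- The face of a submonoid of `ℕ^{r+1}` on which the last coordinate vanishes. -/
def lastFace (M : AddSubmonoid (Fin (r + 1) → ℕ)) : AddSubmonoid (Fin r → ℕ) :=
  M.comap (snocZero r)

/-- The inclusion of the last face. -/
def lastFaceIncl (M : AddSubmonoid (Fin (r + 1) → ℕ)) : lastFace M →+ M :=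
  ((snocZero r).comp (lastFace M).subtype).codRestrict M fun x => x.2

theorem lastFaceIncl_injective (M : AddSubmonoid (Fin (r + 1) → ℕ)) :
    Function.Injective (lastFaceIncl M) := fun _ _ h =>
  Subtype.ext (snocZero_injective (congrArg Subtype.val h))

theorem lastCoord_eq_zero_iff (M : AddSubmonoid (Fin (r + 1) → ℕ)) (x : M) :
    lastCoord M x = 0 ↔ ∃ y, lastFaceIncl M y = x := by
  constructor
  · intro h
    have hx : snocZero r (Fin.init x.1) = x.1 := eq_snocZero_of_last_eq_zero h
    refine ⟨⟨Fin.init x.1, ?_⟩, Subtype.ext hx⟩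
    rw [lastFace, AddSubmonoid.mem_comap, hx]
    exact x.2
  · rintro ⟨y, rfl⟩
    exact snocZero_last _

theorem IsShearable.lastFace {M : AddSubmonoid (Fin (r + 1) → ℕ)} (hM : IsShearable M) :
    IsShearable (lastFace M) where
  fg := by
    have : AddMonoid.FG M := (AddMonoid.fg_iff_addSubmonoid_fg M).2 hM.fg
    exact (AddMonoid.fg_iff_addSubmonoid_fg _).1 (AddMonoid.FG.of_degree_eq_zero (lastCoord M)
      (lastFaceIncl M) (lastFaceIncl_injective M) (lastCoord_eq_zero_iff M))
  integral := by
    obtain ⟨N, hN, h⟩ := hM.integral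
    exact ⟨N, hN, fun x => by
      rw [_root_.lastFace, AddSubmonoid.mem_comap, map_nsmul]
      exact h _⟩
  seminormal {b x} hb hbx h2 h3 := by
    rw [_root_.lastFace, AddSubmonoid.mem_comap] at *
    rw [map_add] at hbx
    rw [map_nsmul] at h2 h3
    exact hM.seminormal hb hbx h2 h3
  shear m := by
    obtain ⟨c, hc⟩ := hM.shear m.castSucc
    refine ⟨fun i => c i.castSucc, fun x hx h0 => ?_⟩
    have h := hc (snocZero r x) hx fun i hi => by
      induction i using Fin.lastCases with
      | last => simp
      | cast i =>
        rw [snocZero_castSucc]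
        exact h0 i (by simpa using hi)
    rw [_root_.lastFace, AddSubmonoid.mem_comap, snocZero_single]
    convert h using 2
    rw [snocZero_castSucc, Finset.sum_filter, Finset.sum_filter, Fin.sum_univ_castSucc]
    simp
  slope m i h := by
    obtain ⟨k, hk⟩ := hM.slope m.castSucc i.castSucc (by simpa using h)
    refine ⟨k, ?_⟩
    rw [_root_.lastFace, AddSubmonoid.mem_comap, map_add, snocZero_single, snocZero_single]
    exact hk

/-- The submonoid `ℕ × M` of `ℕ^{r+1}`. -/
def consMonoid (M : AddSubmonoid (Fin r → ℕ)) : AddSubmonoid (Fin (r + 1) → ℕ) where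
  carrier := {x | Fin.tail x ∈ M}
  zero_mem' := M.zero_mem
  add_mem' ha hb := M.add_mem ha hb

theorem mem_consMonoid {M : AddSubmonoid (Fin r → ℕ)} {x : Fin (r + 1) → ℕ} :
    x ∈ consMonoid M ↔ Fin.tail x ∈ M := Iff.rfl

/-- The isomorphism between `ℕ × M` and its realization in `ℕ^{r+1}`. -/
def consMonoidEquiv (M : AddSubmonoid (Fin r → ℕ)) : ℕ × M ≃+ consMonoid M where
  toFun x := ⟨Fin.cons x.1 x.2.1, by rw [mem_consMonoid, Fin.tail_cons]; exact x.2.2⟩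
  invFun x := (x.1 0, ⟨Fin.tail x.1, x.2⟩)
  left_inv x := by simp
  right_inv x := by simp
  map_add' x y := by
    ext i
    induction i using Fin.cases <;> simp

theorem tail_single_succ (m : Fin r) (k : ℕ) :
    Fin.tail (α := fun _ => ℕ) (Pi.single m.succ k) = Pi.single m k := by
  funext i
  by_cases h : i = m <;> simp [Fin.tail, h]

theorem tail_single_zero (k : ℕ) :
    Fin.tail (n := r) (α := fun _ => ℕ) (Pi.single 0 k) = 0 := by
  funext i
  simp [Fin.tail]

theorem IsShearable.consMonoid {M : AddSubmonoid (Fin r → ℕ)} (hM : IsShearable M) :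
    IsShearable (consMonoid M) where
  fg := by
    have : AddMonoid.FG M := (AddMonoid.fg_iff_addSubmonoid_fg M).2 hM.fg
    have : AddMonoid.FG ℕ := ⟨⟨{1}, by simp⟩⟩
    exact (AddMonoid.fg_iff_addSubmonoid_fg _).1
      (AddMonoid.fg_of_surjective (consMonoidEquiv M).toAddMonoidHom (consMonoidEquiv M).surjective)
  integral := by
    obtain ⟨N, hN, h⟩ := hM.integral
    exact ⟨N, hN, fun x => h (Fin.tail x)⟩
  seminormal {b x} hb hbx h2 h3 := hM.seminormal hb hbx h2 h3
  shear m := by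
    induction m using Fin.cases with
    | zero =>
      refine ⟨0, fun x hx h0 => ?_⟩
      rw [mem_consMonoid, tail_single_zero]
      exact M.zero_mem
    | succ m =>
      obtain ⟨N, hN, hNM⟩ := hM.integral
      obtain ⟨c, hc⟩ := hM.shear m
      refine ⟨Fin.cons N c, fun x hx h0 => ?_⟩
      have h := hc (Fin.tail x) hx fun i hi => h0 i.succ (by simpa using hi)
      have h1 := M.add_mem (hNM (Pi.single m (x 0))) h
      rw [mem_consMonoid, tail_single_succ]
      rw [← Pi.single_smul, ← Pi.single_add] at h1
      have h2 : x m.succ + ∑ i with i < m.succ, (Fin.cons N c : Fin (r + 1) → ℕ) i * x i =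
          N • x 0 + (Fin.tail x m + ∑ i with i < m, c i * Fin.tail x i) := by
        rw [Finset.sum_filter, Finset.sum_filter, Fin.sum_univ_succ]
        simp [Fin.tail]
        ring
      rw [h2]
      exact h1
  slope m i h := by
    induction m using Fin.cases with
    | zero => exact absurd h (Fin.not_lt_zero _)
    | succ m =>
      induction i using Fin.cases with
      | zero =>
        refine ⟨0, ?_⟩
        rw [Pi.single_zero, add_zero, mem_consMonoid, tail_single_zero]
        exact M.zero_mem
      | succ i =>
        obtain ⟨k, hk⟩ := hM.slope m i (by simpa using h)
        refine ⟨k, ?_⟩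
        have : Fin.tail (α := fun _ => ℕ) (Pi.single i.succ 1 + Pi.single m.succ k) =
            Pi.single i 1 + Pi.single m k :=
          congrArg₂ (· + ·) (tail_single_succ i 1) (tail_single_succ m k)
        rw [mem_consMonoid, this]
        exact hk

end

section OfInClassCPhi

variable {r : ℕ}

theorem natCast_injective : Function.Injective (natCast r) := fun x y h => by
  funext i
  have : (x i : ℤ) = y i := congrFun h i
  exact_mod_cast this

open Polynomial in
/-- The bivariate polynomials whose monomials have exponents on a coordinate plane in `M`. -/
def planeSubalgebra (M : AddSubmonoid (Fin r → ℕ)) (i m : Fin r) : Subalgebra ℤ ℤ[X][X] where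
  carrier := {p | ∀ a b, (p.coeff a).coeff b ≠ 0 → Pi.single i a + Pi.single m b ∈ M}
  mul_mem' {p q} hp hq a b h := by
    rw [Polynomial.coeff_mul, Polynomial.finsetSum_coeff] at h
    obtain ⟨⟨a₁, a₂⟩, ha, h⟩ := Finset.exists_ne_zero_of_sum_ne_zero h
    rw [Polynomial.coeff_mul] at h
    obtain ⟨⟨b₁, b₂⟩, hb, h⟩ := Finset.exists_ne_zero_of_sum_ne_zero h
    rw [Finset.HasAntidiagonal.mem_antidiagonal] at ha hb
    have := M.add_mem (hp a₁ b₁ (left_ne_zero_of_mul h)) (hq a₂ b₂ (right_ne_zero_of_mul h))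
    rw [← ha, ← hb, Pi.single_add, Pi.single_add]
    convert this using 1
    simp only
    abel
  add_mem' {p q} hp hq a b h := by
    rw [Polynomial.coeff_add, Polynomial.coeff_add] at h
    by_cases h1 : (p.coeff a).coeff b = 0
    · exact hq a b fun h2 => h (by rw [h1, h2, add_zero])
    · exact hp a b h1
  algebraMap_mem' n a b h := by
    have : (algebraMap ℤ ℤ[X][X]) n = C (C n) := rfl
    rw [this, Polynomial.coeff_C] at h
    split_ifs at h with ha
    · rw [Polynomial.coeff_C] at h
      split_ifs at h with hb
      · simp [ha, hb]
      · simp at h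
    · simp at h

open Polynomial in
/-- Restriction of polynomials to a coordinate plane. -/
noncomputable def planeRestrict (i m : Fin r) : MvPolynomial (Fin r) ℤ →ₐ[ℤ] ℤ[X][X] :=
  MvPolynomial.aeval fun j => if j = m then (C X : ℤ[X][X]) else if j = i then X else 0

open Polynomial in
theorem planeRestrict_X (i m j : Fin r) : planeRestrict i m (MvPolynomial.X j) =
    if j = m then (C X : ℤ[X][X]) else if j = i then X else 0 :=
  MvPolynomial.aeval_X _ _

theorem map_monomialOf {A B : Type*} [CommRing A] [CommRing B] [Algebra A B]
    (φ : MvPolynomial (Fin r) A →ₐ[A] B) (x : Fin r → ℕ) :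
    φ (monomialOf A x) = ∏ j, φ (MvPolynomial.X j) ^ x j := by
  rw [monomialOf, MvPolynomial.monomial_eq, MvPolynomial.C_1, one_mul,
    Finsupp.prod_fintype _ _ fun _ => pow_zero _, map_prod]
  simp

open Polynomial in
theorem planeRestrict_mem {M : AddSubmonoid (Fin r → ℕ)} {i m : Fin r}
    {p : MvPolynomial (Fin r) ℤ} (hp : p ∈ truncAlgebra M m ℤ) :
    planeRestrict i m p ∈ planeSubalgebra M i m := by
  suffices truncAlgebra M m ℤ ≤ (planeSubalgebra M i m).comap (planeRestrict i m) from this hp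
  refine Algebra.adjoin_le ?_
  rintro _ ⟨x, ⟨hx, -⟩, rfl⟩ a b hab
  rw [RingHom.coe_coe, map_monomialOf] at hab
  simp only [planeRestrict_X] at hab
  have h0 : ∀ j, j ≠ m → j ≠ i → x j = 0 := by
    intro j hjm hji
    by_contra hj
    refine hab ?_
    rw [Finset.prod_eq_zero (Finset.mem_univ j), coeff_zero, coeff_zero]
    rw [if_neg hjm, if_neg hji, zero_pow hj]
  by_cases him : i = m
  · subst him
    rw [Finset.prod_eq_single i (fun j _ hj => by rw [h0 j hj hj, pow_zero]) (by simp), if_pos rfl,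
      ← C_pow, coeff_C] at hab
    split_ifs at hab with ha
    · rw [coeff_X_pow] at hab
      split_ifs at hab with hb
      · have : x = Pi.single i a + Pi.single i b := by
          funext j
          by_cases hj : j = i
          · subst hj
            simp [ha, hb]
          · simp [hj, h0 j hj hj]
        rwa [← this]
      · exact absurd rfl hab
    · simp at hab
  · rw [Fintype.prod_eq_mul i m him (fun j hj => by rw [h0 j hj.2 hj.1, pow_zero]), if_neg him,
      if_pos rfl, if_pos rfl, ← C_pow, coeff_mul_C, coeff_X_pow] at hab
    split_ifs at hab with ha
    · rw [one_mul, coeff_X_pow] at hab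
      split_ifs at hab with hb
      · have : x = Pi.single i a + Pi.single m b := by
          funext j
          by_cases hj : j = i
          · subst hj
            simp [ha, him]
          · by_cases hjm : j = m
            · subst hjm
              simp [hb, hj]
            · simp [hj, hjm, h0 j hjm hj]
        rwa [← this]
      · exact absurd rfl hab
    · simp at hab

open Polynomial in
theorem mem_of_planeRestrict_subst {M : AddSubmonoid (Fin r → ℕ)} {i m : Fin r}
    {c : Fin r → ℕ}
    (hc : Subalgebra.map (subst m c ℤ) (truncAlgebra M m ℤ) = truncAlgebra M m ℤ)
    {x : Fin r → ℕ} (hx : x ∈ truncMonoid M m) {a b : ℕ}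
    (h : ((planeRestrict i m (subst m c ℤ (monomialOf ℤ x))).coeff a).coeff b ≠ 0) :
    Pi.single i a + Pi.single m b ∈ M := by
  refine planeRestrict_mem ?_ a b h
  rw [← hc]
  exact ⟨_, Algebra.subset_adjoin ⟨x, hx, rfl⟩, rfl⟩

theorem InClassCPhi.isShearable {M : AddSubmonoid (Fin r → ℕ)} (hM : PhiSimplicial M)
    (hMC : InClassCPhi M) : IsShearable M where
  fg := hM.1
  integral := by
    choose N hN h using fun i : Fin r => hM.2 (Pi.single i 1)
    refine ⟨∏ i, N i, Finset.prod_pos fun i _ => hN i, fun x => ?_⟩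
    have : (∏ i, N i) • x = ∑ i, ((∏ j ∈ Finset.univ.erase i, N j) * x i) • (N i • Pi.single i 1) := by
      funext k
      rw [Finset.sum_apply, Finset.sum_eq_single k]
      · simp only [Pi.smul_apply, Pi.single_eq_same, smul_eq_mul, mul_one]
        rw [← Finset.prod_erase_mul _ _ (Finset.mem_univ k)]
        ring
      · intro b _ hb
        simp [Pi.single_eq_of_ne hb.symm]
      · simp
    rw [this]
    exact M.sum_mem fun i _ => M.nsmul_mem (h i) _
  seminormal {b x} hb hbx h2 h3 := by
    have h := hMC.1 (natCast r x) ?_ ⟨_, h2, map_nsmul _ _ _⟩ ⟨_, h3, map_nsmul _ _ _⟩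
    · obtain ⟨y, hy, hyx⟩ := h
      rwa [← natCast_injective hyx]
    · have : natCast r x = natCast r (b + x) - natCast r b := by
        rw [map_add]
        abel
      rw [this]
      exact AddSubgroup.sub_mem _ (AddSubgroup.subset_closure ⟨_, hbx, rfl⟩)
        (AddSubgroup.subset_closure ⟨_, hb, rfl⟩)
  shear m := by
    obtain ⟨c, -, hc⟩ := hMC.2 m 0
    refine ⟨c, fun x hx hx0 => ?_⟩
    have := mem_of_planeRestrict_subst (hc ℤ _) ⟨hx, hx0⟩ (i := m) (a := 0)
      (b := x m + ∑ i with i < m, c i * x i) ?_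
    · simpa using this
    · have h1 : ∀ j, planeRestrict m m (subst m c ℤ (MvPolynomial.X j)) ^ x j =
          (Polynomial.C Polynomial.X) ^
            ((if j = m then x m else 0) + if j < m then c j * x j else 0) := by
        intro j
        rw [subst, MvPolynomial.aeval_X]
        rcases lt_trichotomy j m with hj | hj | hj
        · rw [if_pos hj, map_add, map_pow, planeRestrict_X, planeRestrict_X, if_neg hj.ne,
            if_neg hj.ne, if_pos rfl, zero_add, if_neg hj.ne, if_pos hj, zero_add, pow_mul]
        · subst hj
          rw [if_neg (lt_irrefl _), planeRestrict_X, if_pos rfl, if_pos rfl,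
            if_neg (lt_irrefl _), add_zero]
        · rw [hx0 j hj, pow_zero, if_neg hj.ne', if_neg hj.not_gt, add_zero, pow_zero]
      rw [← AlgHom.comp_apply, map_monomialOf]
      simp only [AlgHom.comp_apply, h1]
      rw [Finset.prod_pow_eq_pow_sum, Finset.sum_add_distrib, Finset.sum_ite_eq' Finset.univ m,
        if_pos (Finset.mem_univ m), ← Finset.sum_filter, ← Polynomial.C_pow,
        Polynomial.coeff_C_zero, Polynomial.coeff_X_pow_self]
      exact one_ne_zero
  slope m i h := by
    obtain ⟨c, -, hc⟩ := hMC.2 m 0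
    obtain ⟨N, hN, hNM⟩ := hM.2 (Pi.single i 1)
    refine ⟨c i * (N - 1), ?_⟩
    refine mem_of_planeRestrict_subst (hc ℤ _) (x := N • Pi.single i 1)
      ⟨hNM, fun j hj => ?_⟩ ?_
    · simp [Pi.single_eq_of_ne (h.trans hj).ne']
    · rw [← AlgHom.comp_apply, map_monomialOf,
        Finset.prod_eq_single i (fun j _ hj => by simp [hj]) (by simp), AlgHom.comp_apply,
        subst, MvPolynomial.aeval_X, if_pos h, map_add, map_pow, planeRestrict_X, planeRestrict_X,
        if_neg h.ne, if_pos rfl, if_pos rfl, ← Polynomial.C_pow, Polynomial.coeff_X_add_C_pow]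
      simp only [Pi.smul_apply, Pi.single_eq_same, smul_eq_mul, mul_one, Nat.choose_one_right]
      rw [← pow_mul, ← Polynomial.C_eq_natCast, Polynomial.coeff_mul_C, Polynomial.coeff_X_pow_self,
        one_mul]
      exact_mod_cast hN.ne'

end OfInClassCPhi

section MonicLocalization

open Polynomial

theorem eq_map_C_of_forall_monic_notMem {R : Type*} [CommRing R] {q : Ideal R[X]}
    [(q.comap C).IsMaximal] (hq : ∀ g ∈ q, ¬ g.Monic) : q = (q.comap C).map C := by
  refine le_antisymm (fun f hf => ?_) Ideal.map_comap_le
  set p := q.comap C with hp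
  let _ : Field (R ⧸ p) := Ideal.Quotient.field p
  have hker : ∀ g : R[X], g.map (Ideal.Quotient.mk p) = 0 ↔ g ∈ p.map C := by
    intro g
    rw [← Polynomial.coe_mapRingHom, ← RingHom.mem_ker, Polynomial.ker_mapRingHom,
      Ideal.mk_ker]
  by_contra hfp
  have hf0 : f.map (Ideal.Quotient.mk p) ≠ 0 := fun h => hfp ((hker f).1 h)
  obtain ⟨a, ha⟩ := Ideal.Quotient.mk_surjective (f.map (Ideal.Quotient.mk p)).leadingCoeff⁻¹
  have hmon := Polynomial.monic_mul_leadingCoeff_inv hf0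
  obtain ⟨g, hg, -, hgm⟩ := Polynomial.lifts_and_natDegree_eq_and_monic
    (Polynomial.map_surjective (Ideal.Quotient.mk p) Ideal.Quotient.mk_surjective _) hmon
  refine hq g ?_ hgm
  have h1 : g - f * C a ∈ p.map C := by
    rw [← hker, Polynomial.map_sub, hg, Polynomial.map_mul, Polynomial.map_C, ha, sub_self]
  have h2 := q.add_mem (Ideal.map_comap_le h1) (q.mul_mem_right (C a) hf)
  rwa [sub_add_cancel] at h2

/-- The primes of `R[X]` over a minimal prime have height at most one. -/
theorem height_le_one_of_height_comap_C {R : Type*} [CommRing R] [IsNoetherianRing R]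
    (q : Ideal R[X]) [q.IsPrime] (h : (q.comap C).height = 0) : q.height ≤ 1 := by
  set p := q.comap C with hp
  have : p.IsPrime := inferInstance
  let Rp := Localization.AtPrime p
  let _ : Algebra R[X] Rp[X] := Polynomial.algebra R Rp
  have hloc : IsLocalization (p.primeCompl.map C) Rp[X] := Polynomial.isLocalization p.primeCompl Rp
  have disj : Disjoint (p.primeCompl.map C : Set R[X]) q := by
    refine Set.disjoint_left.mpr ?_
    rintro _ ⟨b, hb, rfl⟩ ha
    exact hb ha
  have hprime := IsLocalization.isPrime_of_isPrime_disjoint (p.primeCompl.map C) Rp[X] q ‹_› disj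
  have h1 : q.height = (q.map (algebraMap R[X] Rp[X])).height :=
    (IsLocalization.height_map_of_disjoint (p.primeCompl.map C) q disj).symm
  rw [h1, ← WithBot.coe_le_coe]
  refine (Ideal.height_le_ringKrullDim_of_ne_top hprime.ne_top).trans ?_
  rw [Polynomial.ringKrullDim_of_isNoetherianRing,
    IsLocalization.AtPrime.ringKrullDim_eq_height p Rp, h]
  rfl

/-- Inverting the monic polynomials of `R[X]` does not increase the dimension one. -/
theorem krullDimLE_one_localization_monic {R : Type*} [CommRing R] [IsNoetherianRing R]
    [Ring.KrullDimLE 1 R] (S : Submonoid R[X]) (hS : ∀ g : R[X], g.Monic → g ∈ S) :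
    Ring.KrullDimLE 1 (Localization S) := by
  rw [Ring.krullDimLE_iff]
  refine (ringKrullDim_le_iff_isMaximal_height_le _).2 fun Q hQ => ?_
  set q := Q.comap (algebraMap R[X] (Localization S)) with hq
  have hqp : q.IsPrime := inferInstance
  have hdisj := ((IsLocalization.isPrime_iff_isPrime_disjoint S _ Q).1 hQ.isPrime).2
  have hQq : Q.height = q.height := (IsLocalization.height_under S Q).symm
  rw [hQq]
  set p := q.comap C with hp
  have hp1 : (p.height : WithBot ℕ∞) ≤ 1 := by
    refine (Ideal.height_le_ringKrullDim_of_ne_top Ideal.IsPrime.ne_top').trans ?_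
    exact_mod_cast (Ring.krullDimLE_iff (n := 1) (R := R)).1 inferInstance
  rcases Ring.krullDimLE_one_iff.1 ‹_› p inferInstance with hmin | hmax
  · have : p.height = 0 := Ideal.height_eq_zero_iff.2 hmin
    exact_mod_cast height_le_one_of_height_comap_C q this
  · rw [eq_map_C_of_forall_monic_notMem (q := q) fun g hg hgm =>
      Set.disjoint_left.1 hdisj (hS g hgm) hg, height_map_C]
    exact_mod_cast hp1

end MonicLocalization

section Induction

variable {r : ℕ}

theorem IsShearable.exists_shear {M : AddSubmonoid (Fin (r + 1) → ℕ)} (hM : IsShearable M) :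
    ∃ (z : M) (e : M →+ ℕ) (u : Fin r → M) (q : Fin r → ℕ),
      0 < lastCoord M z ∧ (∀ x, lastCoord M z < lastCoord M x → ∃ y, x = z + y) ∧
      ∀ x : M, x + (∑ i, x.1 i.castSucc * q i) • z =
        (∑ i, x.1 i.castSucc • u i) + e x • z := by
  obtain ⟨d, hd, hdM, hdvd, hdiv⟩ := hM.exists_dvd (Fin.last r)
  obtain ⟨c, hc⟩ := hM.shear (Fin.last r)
  have hlt : ∀ i : Fin r, i.castSucc < Fin.last r := fun i => i.castSucc_lt_last
  choose k hk using fun i : Fin r => hM.slope (Fin.last r) i.castSucc (hlt i)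
  have hsum : ∀ x : Fin (r + 1) → ℕ, ∑ i with i < Fin.last r, c i * x i =
      ∑ i : Fin r, c i.castSucc * x i.castSucc := by
    intro x
    rw [Finset.sum_filter, Fin.sum_univ_castSucc]
    simp
  have hx : ∀ x : M, d ∣ x.1 (Fin.last r) + ∑ i : Fin r, c i.castSucc * x.1 i.castSucc := by
    intro x
    rw [← hsum]
    exact hdvd _ (hc x.1 x.2 fun i hi => absurd hi (Fin.le_last i).not_gt)
  choose q hq using fun i : Fin r => hx ⟨_, hk i⟩
  choose e he using hx
  have hq' : ∀ i, k i + c i.castSucc = d * q i := by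
    intro i
    rw [← hq i, Finset.sum_eq_single i]
    · simp
    · intro b _ hb
      simp [hb]
    · simp
  refine ⟨⟨_, hdM⟩, ⟨⟨e, ?_⟩, ?_⟩, fun i => ⟨_, hk i⟩, q, ?_, ?_, ?_⟩
  · refine (Nat.eq_of_mul_eq_mul_left hd ?_)
    rw [← he]
    simp
  · intro x y
    refine (Nat.eq_of_mul_eq_mul_left hd ?_)
    change d * e (x + y) = d * (e x + e y)
    rw [← he, mul_add, ← he, ← he]
    simp only [AddSubmonoid.coe_add, Pi.add_apply, mul_add, Finset.sum_add_distrib]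
    ring
  · simpa [lastCoord] using hd
  · intro x hx
    obtain ⟨y, hy, hxy⟩ := hdiv x.1 x.2 (by simpa [lastCoord] using hx)
    exact ⟨⟨y, hy⟩, Subtype.ext hxy⟩
  · intro x
    have h1 := he x
    ext i
    simp only [AddMonoidHom.coe_mk, ZeroHom.coe_mk, AddSubmonoid.coe_add, AddSubmonoidClass.coe_nsmul,
      AddSubmonoid.coe_finsetSum, Pi.add_apply, Pi.smul_apply, Finset.sum_apply, smul_eq_mul]
    induction i using Fin.lastCases with
    | last =>
      have h2 : (∑ i : Fin r, x.1 i.castSucc * q i) * d =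
          (∑ i : Fin r, x.1 i.castSucc * k i) + ∑ i : Fin r, c i.castSucc * x.1 i.castSucc := by
        rw [Finset.sum_mul, ← Finset.sum_add_distrib]
        refine Finset.sum_congr rfl fun i _ => ?_
        rw [mul_assoc, mul_comm (q i), ← hq']
        ring
      have h3 : ∀ i : Fin r, x.1 i.castSucc * ((Pi.single i.castSucc 1 : Fin (r + 1) → ℕ)
          (Fin.last r) + (Pi.single (Fin.last r) (k i) : Fin (r + 1) → ℕ) (Fin.last r)) =
          x.1 i.castSucc * k i := by
        intro i
        simp
      rw [Pi.single_eq_same, h2, Finset.sum_congr rfl fun i _ => h3 i, mul_comm (e x), ← h1]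
      ring
    | cast j =>
      have h2 : ∑ b : Fin r, x.1 b.castSucc *
          ((Pi.single b.castSucc 1 : Fin (r + 1) → ℕ) j.castSucc +
            (Pi.single (Fin.last r) (k b) : Fin (r + 1) → ℕ) j.castSucc) = x.1 j.castSucc := by
        rw [Finset.sum_eq_single j]
        · simp
        · intro b _ hb
          simp [Pi.single_eq_of_ne fun h => hb (Fin.castSucc_injective r h).symm]
        · simp
      rw [h2]
      simp

open AddMonoidAlgebra in
theorem OrientedIdem.idemFree_localization_of_shear {R : Type*} [CommRing R]
    {M : AddSubmonoid (Fin (r + 1) → ℕ)} (z : M) (e : M →+ ℕ) (u : Fin r → M) (q : Fin r → ℕ)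
    (hrel : ∀ x : M, x + (∑ i, x.1 i.castSucc * q i) • z =
      (∑ i, x.1 i.castSucc • u i) + e x • z)
    {ι : Type*} [Fintype ι] {n : ℕ} {E : Matrix ι ι (AddMonoidAlgebra R M)}
    (hE : OrientedIdem n E)
    (hfree : ∀ E : Matrix ι ι (AddMonoidAlgebra
      (Localization (monicValues R (Polynomial.X : Polynomial R)))
      (⊤ : AddSubmonoid (Fin r → ℕ))), OrientedIdem n E → IdemFree n E) :
    IdemFree n (E.map (algebraMap _
      (Localization (monicValues R (single z 1 : AddMonoidAlgebra R M))))) := by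
  set S := monicValues R (Polynomial.X : Polynomial R)
  set W := Localization (monicValues R (single z 1 : AddMonoidAlgebra R M))
  let init : M →+ (⊤ : AddSubmonoid (Fin r → ℕ)) :=
    { toFun := fun x => ⟨Fin.init x.1, trivial⟩
      map_zero' := rfl
      map_add' := fun _ _ => rfl }
  set x' : Localization S := algebraMap _ _ (Polynomial.X : Polynomial R) with hx'
  let ψ : AddMonoidAlgebra R M →ₐ[R] AddMonoidAlgebra (Localization S)
      (⊤ : AddSubmonoid (Fin r → ℕ)) :=
    AddMonoidAlgebra.lift R _ M
      { toFun := fun x => single (init x.toAdd) (x' ^ e x.toAdd)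
        map_one' := by simp [one_def]
        map_mul' := fun x y => by simp [single_mul_single, pow_add] }
  have hψ : ∀ x, ψ (single x 1) = single (init x) (x' ^ e x) := fun x => by
    simp [ψ]
  set Z : W := algebraMap _ W (single z (1 : R))
  have hZ : IsUnit Z := IsLocalization.map_units W
    (⟨_, Polynomial.X, Polynomial.monic_X, Polynomial.aeval_X _⟩ :
      monicValues R (single z 1 : AddMonoidAlgebra R M))
  obtain ⟨Y, hY⟩ := hZ.exists_right_inv
  have hθ : ∀ s : S, IsUnit (Polynomial.aeval (R := R) Z (s : Polynomial R)) := by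
    rintro ⟨s, g, hg, hs⟩
    rw [Polynomial.aeval_X_left_apply] at hs
    subst hs
    rw [Polynomial.aeval_algebraMap_apply]
    exact IsLocalization.map_units W
      (⟨_, g, hg, rfl⟩ : monicValues R (single z 1 : AddMonoidAlgebra R M))
  let θ : Localization S →ₐ[R] W := IsLocalization.liftAlgHom (M := S)
    (f := Polynomial.aeval (R := R) Z) hθ
  have hθx : θ x' = Z := by
    simp [θ, hx']
  let g : Multiplicative (⊤ : AddSubmonoid (Fin r → ℕ)) →* W :=
    { toFun := fun x => ∏ i, (algebraMap _ W (single (u i) (1 : R)) * Y ^ q i) ^ x.toAdd.1 i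
      map_one' := by simp
      map_mul' := fun x y => by simp [pow_add, Finset.prod_mul_distrib] }
  let χ : AddMonoidAlgebra (Localization S) (⊤ : AddSubmonoid (Fin r → ℕ)) →+* W :=
    liftNCRingHom θ.toRingHom g fun _ _ => Commute.all _ _
  have hχ : ∀ x a, χ (single x a) = θ a * g (Multiplicative.ofAdd x) := fun x a =>
    liftNC_single _ _ _ _
  have hcomp : ∀ b, χ (ψ b) = algebraMap _ W b := by
    intro b
    induction b using AddMonoidAlgebra.induction_linear with
    | zero => simp
    | add p q hp hq => rw [map_add, map_add, map_add, hp, hq]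
    | single x a =>
      have hxa : single x a = algebraMap R (AddMonoidAlgebra R M) a * single x 1 := by
        rw [AddMonoidAlgebra.coe_algebraMap, Function.comp_apply, single_mul_single]
        simp
      let ρ : Multiplicative M →* W :=
        (algebraMap (AddMonoidAlgebra R M) W : AddMonoidAlgebra R M →* W).comp (of R M)
      have h1 := congrArg (fun y : M => ρ (Multiplicative.ofAdd y)) (hrel x)
      simp only [ofAdd_add, ofAdd_sum, ofAdd_nsmul, map_mul, map_pow, map_prod] at h1
      change algebraMap _ W (single x (1 : R)) * Z ^ (∑ i, x.1 i.castSucc * q i) =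
        (∏ i, algebraMap _ W (single (u i) (1 : R)) ^ x.1 i.castSucc) * Z ^ e x at h1
      have h2 : χ (ψ (single x 1)) = algebraMap _ W (single x (1 : R)) := by
        have h3 : (Z * Y) ^ (∑ i, x.1 i.castSucc * q i) = 1 := by
          rw [hY, one_pow]
        rw [hψ, hχ, map_pow, hθx]
        have h4 : g (Multiplicative.ofAdd (init x)) =
            (∏ i, algebraMap _ W (single (u i) (1 : R)) ^ x.1 i.castSucc) *
              Y ^ (∑ i, x.1 i.castSucc * q i) := by
          change ∏ i, (algebraMap _ W (single (u i) (1 : R)) * Y ^ q i) ^ x.1 i.castSucc = _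
          rw [← Finset.prod_pow_eq_pow_sum Finset.univ _ Y, ← Finset.prod_mul_distrib]
          refine Finset.prod_congr rfl fun i _ => ?_
          rw [mul_comm (x.1 i.castSucc), pow_mul, ← mul_pow]
        rw [h4]
        rw [mul_pow] at h3
        linear_combination (-Y ^ (∑ i, x.1 i.castSucc * q i)) * h1 +
          algebraMap _ W (single x (1 : R)) * h3
      rw [hxa, map_mul, map_mul, map_mul, h2, AlgHom.commutes,
        AddMonoidAlgebra.coe_algebraMap, Function.comp_apply, hχ, AlgHom.commutes, ofAdd_zero,
        map_one, mul_one, ← IsScalarTower.algebraMap_apply R (AddMonoidAlgebra R M) W]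
  convert (hfree _ (hE.map ψ.toRingHom)).map χ using 1
  ext1 i k
  exact (hcomp _).symm

universe v

theorem IsShearable.idemFree {r : ℕ} : ∀ {R : Type v} [CommRing R] [IsNoetherianRing R]
    [Ring.KrullDimLE 1 R] {M : AddSubmonoid (Fin r → ℕ)}, IsShearable M →
    ∀ {ι : Type*} [Fintype ι] {n : ℕ} {E : Matrix ι ι (AddMonoidAlgebra R M)},
    OrientedIdem (n + 1) E → IdemFree (n + 1) E := by
  induction r with
  | zero =>
    intro R _ _ _ M _ ι _ n E hE
    let f : AddMonoidAlgebra R M →ₐ[R] R := AddMonoidAlgebra.lift R R M 1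
    have hf : ∀ b, algebraMap R (AddMonoidAlgebra R M) (f b) = b := by
      intro b
      induction b using AddMonoidAlgebra.induction_linear with
      | zero => simp
      | add p q hp hq => rw [map_add, map_add, hp, hq]
      | single x a =>
        have hx : x = 0 := Subtype.ext (Subsingleton.elim _ _)
        subst hx
        simp [f]
    have h := (hE.map f.toRingHom).idemFree_of_krullDimLE_one.map
      (algebraMap R (AddMonoidAlgebra R M))
    convert h using 1
    ext1 i k
    exact (hf _).symm
  | succ r ih =>
    intro R _ _ _ M hM ι _ n E hE
    have hfg : AddMonoid.FG M := (AddMonoid.fg_iff_addSubmonoid_fg M).2 hM.fg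
    have hnoeth : IsNoetherianRing (AddMonoidAlgebra R M) :=
      Algebra.FiniteType.isNoetherianRing R _
    obtain ⟨z, e, u, q, hz, hdiv, hrel⟩ := hM.exists_shear
    have hdim : Ring.KrullDimLE 1
        (Localization (monicValues R (Polynomial.X : Polynomial R))) :=
      krullDimLE_one_localization_monic _ fun g hg => ⟨g, hg, Polynomial.aeval_X_left_apply g⟩
    have h₀ := ih hM.lastFace (hE.map (AddMonoidAlgebra.degreeZeroPart (lastCoord M)
      (lastFaceIncl M) (lastFaceIncl_injective M) (lastCoord_eq_zero_iff M)).toRingHom)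
    have hW := hE.idemFree_localization_of_shear z e u q hrel fun _ hE' => ih IsShearable.top hE'
    have hfin := AddMonoid.FG.exists_finite_of_degree_le (lastCoord M) (lastFaceIncl M)
      (lastCoord_eq_zero_iff M)
    exact AddMonoidAlgebra.idemFree_of_degree (lastCoord M) (lastFaceIncl M)
      (lastFaceIncl_injective M) (lastCoord_eq_zero_iff M) hz hdiv hfin hE hW h₀

end Induction

section DualBasis

variable {B P ι : Type*} [CommRing B] [AddCommGroup P] [Module B P] [Fintype ι]
  {p : ι → P} {φ : ι → P →ₗ[B] B}

theorem exists_dualBasis (B P : Type*) [CommRing B] [AddCommGroup P] [Module B P]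
    [Module.Finite B P] [Module.Projective B P] :
    ∃ (m : ℕ) (p : Fin m → P) (φ : Fin m → P →ₗ[B] B), ∀ x, ∑ i, φ i x • p i = x := by
  obtain ⟨m, f, g, -, -, hfg⟩ := Module.Finite.exists_comp_eq_id_of_projective B P
  refine ⟨m, fun i => f (Pi.single i 1), fun i => LinearMap.proj i ∘ₗ g, fun x => ?_⟩
  have h : ∀ v : Fin m → B, ∑ i, v i • f (Pi.single i 1) = f v := by
    intro v
    conv_rhs => rw [pi_eq_sum_univ' v]
    simp [map_sum]
  exact (h _).trans (LinearMap.congr_fun hfg x)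

/-- The idempotent matrix attached to a dual basis of a projective module. -/
def dualBasisMatrix (p : ι → P) (φ : ι → P →ₗ[B] B) : Matrix ι ι B :=
  Matrix.of fun i j => φ i (p j)

theorem dualBasisMatrix_mul_self (h : ∀ x, ∑ i, φ i x • p i = x) :
    dualBasisMatrix p φ * dualBasisMatrix p φ = dualBasisMatrix p φ := by
  ext1 i j
  rw [Matrix.mul_apply]
  conv_rhs => rw [dualBasisMatrix, Matrix.of_apply, ← h (p j), map_sum]
  exact Finset.sum_congr rfl fun k _ => by
    rw [map_smul, smul_eq_mul, mul_comm]
    rfl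

theorem idemFree_of_localizedModule_equiv (h : ∀ x, ∑ i, φ i x • p i = x) (S : Submonoid B)
    {n : ℕ} (e : LocalizedModule S P ≃ₗ[Localization S] (Fin n → Localization S)) :
    IdemFree n ((dualBasisMatrix p φ).map (algebraMap B (Localization S))) := by
  classical
  let φ' : ι → LocalizedModule S P →ₗ[Localization S] Localization S := fun i =>
    IsLocalizedModule.mapExtendScalars S (LocalizedModule.mkLinearMap S P)
      (Algebra.linearMap B (Localization S)) (Localization S) (φ i)
  let p' : ι → LocalizedModule S P := fun i => LocalizedModule.mkLinearMap S P (p i)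
  have hφ : ∀ i x, φ' i (LocalizedModule.mkLinearMap S P x) = algebraMap B _ (φ i x) := by
    intro i x
    simp only [φ', IsLocalizedModule.mapExtendScalars_apply_apply]
    exact IsLocalizedModule.map_apply S _ (Algebra.linearMap B (Localization S)) (φ i) x
  have h' : ∀ y, ∑ i, φ' i y • p' i = y := by
    have : (∑ i, (φ' i).smulRight (p' i)) = LinearMap.id := by
      refine LinearMap.restrictScalars_injective B ?_
      refine IsLocalizedModule.linearMap_ext S (LocalizedModule.mkLinearMap S P)
        (LocalizedModule.mkLinearMap S P) ?_
      ext x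
      simp only [LinearMap.comp_apply, LinearMap.restrictScalars_apply, LinearMap.sum_apply,
        LinearMap.smulRight_apply, hφ, LinearMap.id_apply, algebraMap_smul]
      conv_rhs => rw [← h x, map_sum]
      simp only [map_smul, p']
    intro y
    simpa using LinearMap.congr_fun this y
  refine ⟨Matrix.of fun i k => φ' i (e.symm (Pi.single k 1)), Matrix.of fun k i => e (p' i) k,
    ?_, ?_⟩
  · ext1 i j
    rw [Matrix.mul_apply, Matrix.map_apply]
    simp only [Matrix.of_apply, dualBasisMatrix, ← hφ]
    conv_rhs => rw [← e.symm_apply_apply (LocalizedModule.mkLinearMap S P (p j)),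
      pi_eq_sum_univ' (e _)]
    simp only [map_sum]
    refine Finset.sum_congr rfl fun k _ => ?_
    simp only [map_smul, smul_eq_mul]
    exact mul_comm _ _
  · ext1 k l
    rw [Matrix.mul_apply]
    simp only [Matrix.of_apply]
    have := congrArg (fun y => e y k) (h' (e.symm (Pi.single l 1)))
    simp only [map_sum, map_smul, Finset.sum_apply, Pi.smul_apply, smul_eq_mul,
      LinearEquiv.apply_symm_apply] at this
    rw [Matrix.one_apply]
    simp only [Pi.single_apply] at this
    rw [← this]
    exact Finset.sum_congr rfl fun i _ => mul_comm _ _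

theorem IsLocalization.exists_mul_eq_smul_of_idemFree {W : Type*} [CommRing W] [Algebra B W]
    (S : Submonoid B) [IsLocalization S W] {E : Matrix ι ι B} {n : ℕ}
    (h : IdemFree n (E.map (algebraMap B W))) :
    ∃ s ∈ S, ∃ (X : Matrix ι (Fin n) B) (Y : Matrix (Fin n) ι B), X * Y = s • E ∧
      Y * X = s • 1 := by
  obtain ⟨U, V, hUV, hVU⟩ := h
  obtain ⟨s₁, hs₁, X, hX⟩ := exists_smul_matrix_eq_map S U
  obtain ⟨s₂, hs₂, Y, hY⟩ := exists_smul_matrix_eq_map S V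
  have h1 : (X * Y).map (algebraMap B W) = ((s₁ * s₂) • E).map (algebraMap B W) := by
    rw [Matrix.map_mul, hX, hY, Matrix.smul_mul, Matrix.mul_smul, hUV, smul_smul, ← map_mul]
    ext1 i j
    simp
  have h2 : (Y * X).map (algebraMap B W) =
      ((s₁ * s₂) • (1 : Matrix (Fin n) (Fin n) B)).map (algebraMap B W) := by
    rw [Matrix.map_mul, hX, hY, Matrix.smul_mul, Matrix.mul_smul, hVU, smul_smul, ← map_mul]
    ext1 i j
    simp [Matrix.one_apply, mul_comm, apply_ite (algebraMap B W)]
  obtain ⟨t₁, ht₁, h1⟩ := exists_smul_matrix_eq_of_map_eq (W := W) S h1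
  obtain ⟨t₂, ht₂, h2⟩ := exists_smul_matrix_eq_of_map_eq (W := W) S h2
  refine ⟨t₁ * t₂ * (s₁ * s₂), S.mul_mem (S.mul_mem ht₁ ht₂) (S.mul_mem hs₁ hs₂),
    (t₁ * t₂) • X, Y, ?_, ?_⟩
  · rw [Matrix.smul_mul, mul_comm t₁, mul_smul, h1, smul_smul, smul_smul]
  · rw [Matrix.mul_smul, mul_smul, h2, smul_smul, smul_smul]

/-- If the idempotent matrix of a projective module is free up to inverting `s`, so is the
module. -/
theorem exists_comp_eq_smul_of_mul_eq_smul (h : ∀ x, ∑ i, φ i x • p i = x) {n : ℕ} {s : B}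
    {X : Matrix ι (Fin n) B} {Y : Matrix (Fin n) ι B} (hXY : X * Y = s • dualBasisMatrix p φ)
    (hYX : Y * X = s • 1) :
    ∃ (a : P →ₗ[B] (Fin n → B)) (b : (Fin n → B) →ₗ[B] P),
      (∀ v, a (b v) = s • s • v) ∧ ∀ x, b (a x) = s • s • x := by
  have hφp : ∀ v : ι → B, (fun i => φ i (∑ j, v j • p j)) = (dualBasisMatrix p φ).mulVec v := by
    intro v
    funext i
    simp only [map_sum, map_smul, Matrix.mulVec, dotProduct, dualBasisMatrix, Matrix.of_apply,
      smul_eq_mul, mul_comm]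
  refine ⟨s • Y.mulVecLin ∘ₗ LinearMap.pi φ, (Fintype.linearCombination B p) ∘ₗ X.mulVecLin,
    ?_, ?_⟩
  · intro v
    change s • Y.mulVec (fun i => φ i (∑ j, X.mulVec v j • p j)) = _
    rw [hφp, ← Matrix.mulVec_smul, ← Matrix.smul_mulVec, ← hXY, Matrix.mulVec_mulVec,
      Matrix.mulVec_mulVec, ← Matrix.mul_assoc Y, hYX, Matrix.smul_mul, Matrix.one_mul,
      Matrix.smul_mul, hYX, Matrix.smul_mulVec, Matrix.smul_mulVec, Matrix.one_mulVec]
  · intro x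
    change ∑ i, X.mulVec (s • Y.mulVec fun i => φ i x) i • p i = _
    have h1 := hφp fun i => φ i x
    rw [h] at h1
    rw [Matrix.mulVec_smul, Matrix.mulVec_mulVec, hXY, Matrix.smul_mulVec, ← h1]
    conv_rhs => rw [← h x, Finset.smul_sum, Finset.smul_sum]
    simp only [Pi.smul_apply, smul_smul, smul_eq_mul]

theorem localizedModule_map_map_apply {N : Type*} [AddCommGroup N] [Module B N] {S : Submonoid B}
    {t : B} (a : P →ₗ[B] N) (b : N →ₗ[B] P) (hba : ∀ x, b (a x) = t • x)
    (x : LocalizedModule S P) :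
    LocalizedModule.map S b (LocalizedModule.map S a x) =
      algebraMap B (Localization S) t • x := by
  induction x with
  | _ x c =>
    rw [LocalizedModule.map_mk, LocalizedModule.map_mk, hba, algebraMap_smul,
      LocalizedModule.smul'_mk]

/-- Maps which are mutually inverse up to `t ∈ S` become isomorphisms after inverting `S`. -/
theorem nonempty_localizedModule_equiv {N : Type*} [AddCommGroup N] [Module B N]
    {S : Submonoid B} {t : B} (ht : t ∈ S) (a : P →ₗ[B] N) (b : N →ₗ[B] P)
    (hab : ∀ y, a (b y) = t • y) (hba : ∀ x, b (a x) = t • x) :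
    Nonempty (LocalizedModule S P ≃ₗ[Localization S] LocalizedModule S N) := by
  obtain ⟨u, hu⟩ := IsLocalization.map_units (Localization S) (⟨t, ht⟩ : S)
  refine ⟨LinearEquiv.ofLinearMap (LocalizedModule.map S a)
    ((↑u⁻¹ : Localization S) • LocalizedModule.map S b) ?_ ?_⟩
  · ext1 y
    rw [LinearMap.comp_apply, LinearMap.smul_apply, map_smul, localizedModule_map_map_apply b a hab,
      ← hu, smul_smul, Units.inv_mul, one_smul, LinearMap.id_apply]
  · ext1 x
    rw [LinearMap.comp_apply, LinearMap.smul_apply, localizedModule_map_map_apply a b hba,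
      ← hu, smul_smul, Units.inv_mul, one_smul, LinearMap.id_apply]

end DualBasis

section Rank

variable {B P ι : Type*} [CommRing B] [AddCommGroup P] [Module B P] [Fintype ι]
  {p : ι → P} {φ : ι → P →ₗ[B] B}

theorem idemFree_localization_atPrime [Module.Finite B P] [Module.Projective B P]
    (h : ∀ x, ∑ i, φ i x • p i = x) {n : ℕ} (q : Ideal B) [q.IsPrime]
    (hrank : Module.finrank (Localization.AtPrime q) (LocalizedModule q.primeCompl P) = n) :
    IdemFree n ((dualBasisMatrix p φ).map (algebraMap B (Localization.AtPrime q))) := by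
  have : Module.Finite (Localization.AtPrime q) (LocalizedModule q.primeCompl P) :=
    Module.Finite.of_isLocalizedModule q.primeCompl (LocalizedModule.mkLinearMap q.primeCompl P)
  have : Module.Projective (Localization.AtPrime q) (LocalizedModule q.primeCompl P) :=
    Module.projective_of_isLocalizedModule q.primeCompl
      (LocalizedModule.mkLinearMap q.primeCompl P)
  have : Module.Free (Localization.AtPrime q) (LocalizedModule q.primeCompl P) :=
    Module.free_of_flat_of_isLocalRing
  exact idemFree_of_localizedModule_equiv h q.primeCompl
    (Module.finBasisOfFinrankEq _ _ hrank).equivFun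

theorem IdemFree.exists_minor_notMem {E : Matrix ι ι B} {n : ℕ} {q : Ideal B} [q.IsPrime]
    (h : IdemFree n (E.map (algebraMap B (Localization.AtPrime q)))) :
    ∃ f g : Fin n → ι, (E.submatrix f g).det ∉ q := by
  obtain ⟨s, hs, X, Y, hXY, hYX⟩ :=
    IsLocalization.exists_mul_eq_smul_of_idemFree q.primeCompl h
  by_contra! H
  have h1 : (Y * (X * Y) * X).det ∈ q := by
    rw [hXY, Matrix.mul_smul, Matrix.smul_mul, Matrix.det_smul, Matrix.mul_assoc,
      Matrix.det_mul_eq_sum_submatrix]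
    refine Ideal.mul_mem_left _ _ (Ideal.sum_mem _ fun f _ => Ideal.mul_mem_left _ _ ?_)
    have : (E * X).submatrix f id = E.submatrix f id * X := by
      ext; simp [Matrix.mul_apply]
    rw [this, Matrix.det_mul_eq_sum_submatrix_right]
    exact Ideal.sum_mem _ fun g _ => Ideal.mul_mem_right _ _ (H f g)
  rw [← Matrix.mul_assoc Y, hYX, Matrix.smul_mul, Matrix.one_mul, Matrix.smul_mul, hYX,
    Matrix.det_smul, Matrix.det_smul, Matrix.det_one, mul_one, ← mul_pow] at h1
  have h2 := Ideal.IsPrime.mem_of_pow_mem ‹_› _ h1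
  exact hs ((or_self_iff).1 (Ideal.IsPrime.mem_or_mem ‹_› h2))

theorem dualBasisMatrix_eq_zero [Module.Finite B P] [Module.Projective B P]
    (h : ∀ x, ∑ i, φ i x • p i = x)
    (hrank : ∀ (q : Ideal B) [q.IsPrime],
      Module.finrank (Localization.AtPrime q) (LocalizedModule q.primeCompl P) = 0) :
    dualBasisMatrix p φ = 0 := by
  ext1 i j
  refine eq_zero_of_localization _ fun q hq => ?_
  obtain ⟨U, V, hUV, -⟩ := idemFree_localization_atPrime h q (hrank q)
  have := congrFun (congrFun hUV i) j
  rw [Matrix.mul_apply, Finset.univ_eq_empty, Finset.sum_empty] at this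
  exact this.symm

theorem exists_smul_eq_smul_of_finrank_eq_one [Module.Finite B P] [Module.Projective B P]
    (q : Ideal B) [q.IsPrime]
    (hrank : Module.finrank (Localization.AtPrime q) (LocalizedModule q.primeCompl P) = 1) :
    ∃ s ∉ q, ∃ (a : P →ₗ[B] B) (x₀ : P), ∀ x, a x • x₀ = s • x := by
  obtain ⟨m, p, φ, h⟩ := exists_dualBasis B P
  obtain ⟨s, hs, X, Y, hXY, hYX⟩ := IsLocalization.exists_mul_eq_smul_of_idemFree q.primeCompl
    (idemFree_localization_atPrime h q hrank)
  obtain ⟨a, b, -, hba⟩ := exists_comp_eq_smul_of_mul_eq_smul h hXY hYX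
  refine ⟨s * s, q.primeCompl.mul_mem hs hs, LinearMap.proj 0 ∘ₗ a, b fun _ => 1, fun x => ?_⟩
  rw [mul_smul, ← hba, ← map_smul]
  congr 1
  funext k
  fin_cases k
  simp

open TensorProduct in
theorem exists_smul_eq_smul_of_baseChange {C D : Type*} [CommRing C] [Algebra B C]
    [AddCommGroup D] [Module C D] (ε : C ⊗[B] P ≃ₗ[C] D) {s : B} {a : P →ₗ[B] B} {x₀ : P}
    (h : ∀ x, a x • x₀ = s • x) :
    ∃ (a' : D →ₗ[C] C) (y₀ : D), ∀ y, a' y • y₀ = algebraMap B C s • y := by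
  refine ⟨(AlgebraTensorModule.rid B C C).toLinearMap ∘ₗ a.baseChange C ∘ₗ ε.symm.toLinearMap,
    ε (1 ⊗ₜ x₀), fun y => ?_⟩
  obtain ⟨z, rfl⟩ := ε.surjective y
  rw [← map_smul, ← map_smul]
  congr 1
  simp only [LinearMap.comp_apply, LinearEquiv.coe_coe, LinearEquiv.symm_apply_apply]
  induction z with
  | zero => simp
  | add z w hz hw => rw [map_add, map_add, add_smul, hz, hw, smul_add]
  | tmul c x =>
    rw [LinearMap.baseChange_tmul, AlgebraTensorModule.rid_tmul, algebraMap_smul, smul_tmul',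
      ← tmul_smul, ← h, tmul_smul, smul_tmul', smul_eq_mul, mul_one]

end Rank

open ExteriorAlgebra in
theorem exists_mul_det_eq_mul {B P ι : Type*} [CommRing B] [AddCommGroup P]
    [Module B P] {n : ℕ} {s : B} {a : exteriorPower B n P →ₗ[B] B}
    {y₀ : exteriorPower B n P} (h : ∀ y, a y • y₀ = s • y) (p : ι → P) (φ : ι → P →ₗ[B] B) :
    ∃ v w : (Fin n → ι) → B, ∀ f g,
      s * ((dualBasisMatrix p φ).submatrix f g).det = v f * w g := by
  let δ : (Fin n → ι) → exteriorPower B n P →ₗ[B] B := fun f =>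
    exteriorPower.alternatingMapLinearEquiv
      ((Matrix.detRowAlternating (n := Fin n) (R := B)).compLinearMap
        (LinearMap.pi fun k => φ (f k)))
  have hδ : ∀ f g : Fin n → ι, δ f (exteriorPower.ιMulti B n (p ∘ g)) =
      ((dualBasisMatrix p φ).submatrix f g).det := by
    intro f g
    rw [exteriorPower.alternatingMapLinearEquiv_apply_ιMulti, ← Matrix.det_transpose]
    rfl
  refine ⟨fun f => δ f y₀, fun g => a (exteriorPower.ιMulti B n (p ∘ g)), fun f g => ?_⟩
  rw [← hδ, ← smul_eq_mul, ← map_smul, ← h, map_smul, smul_eq_mul, mul_comm]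

theorem OrientedIdem.map_of_mul_det_eq {B W ι : Type*} [CommRing B] [CommRing W] [Fintype ι]
    {n : ℕ} {E : Matrix ι ι B} (hE : E * E = E) {c : (Fin n → ι) → (Fin n → ι) → B}
    (hc : ∑ f, ∑ g, c f g * (E.submatrix f g).det = 1) {s : B} {v w : (Fin n → ι) → B}
    (hvw : ∀ f g, s * (E.submatrix f g).det = v f * w g) (π : B →+* W) (hs : IsUnit (π s)) :
    OrientedIdem n (E.map π) := by
  obtain ⟨u, hu⟩ := hs.exists_left_inv
  refine ⟨by rw [← Matrix.map_mul, hE], ⟨fun f => u * π (v f), π ∘ w, fun f g => ?_⟩,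
    fun f g => π (c f g), ?_⟩
  · rw [Matrix.det_submatrix_map, Function.comp_apply, mul_assoc, ← map_mul, ← hvw, map_mul,
      ← mul_assoc, hu, one_mul]
  · simp only [Matrix.det_submatrix_map, ← map_mul, ← map_sum, hc, map_one]

section PolynomialExtension

open Polynomial

variable {r : ℕ}

open AddMonoidAlgebra in
/-- Localizing `R[M][T]` at elements of `R` gives a retract of a monoid algebra over a localization
of `R`. -/
theorem exists_localization_polynomial_retract {R R' W : Type*} [CommRing R] [CommRing R']
    [Algebra R R'] [CommRing W] (M : AddSubmonoid (Fin r → ℕ)) (S : Submonoid R)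
    [IsLocalization S R'] [Algebra (AddMonoidAlgebra R M)[X] W]
    [IsLocalization (S.map (algebraMap R (AddMonoidAlgebra R M)[X])) W] :
    ∃ (φ : W →+* AddMonoidAlgebra R' (consMonoid M))
      (ψ : AddMonoidAlgebra R' (consMonoid M) →+* W), ∀ x, ψ (φ x) = x := by
  let T := S.map (algebraMap R (AddMonoidAlgebra R M)[X])
  let α : AddMonoidAlgebra R M →ₐ[R] AddMonoidAlgebra R' (consMonoid M) :=
    AddMonoidAlgebra.lift R _ M
      { toFun := fun x => single (consMonoidEquiv M (0, x.toAdd)) 1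
        map_one' := by
          rw [toAdd_one, Prod.mk_zero_zero, map_zero, one_def]
        map_mul' := fun x y => by
          rw [single_mul_single, ← map_add, Prod.mk_add_mk, add_zero, one_mul, toAdd_mul] }
  have hα : ∀ x, α (single x 1) = single (consMonoidEquiv M (0, x)) 1 := fun x => by
    simp [α]
  have hαR : ∀ a, α (single 0 a) = single 0 (algebraMap R R' a) := fun a => by
    have h := α.commutes a
    rwa [AddMonoidAlgebra.coe_algebraMap, AddMonoidAlgebra.coe_algebraMap] at h
  let φ₀ : (AddMonoidAlgebra R M)[X] →+* AddMonoidAlgebra R' (consMonoid M) :=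
    Polynomial.eval₂RingHom α.toRingHom (single (consMonoidEquiv M (1, 0)) 1)
  have hφC : ∀ b, φ₀ (Polynomial.C b) = α b := fun b => Polynomial.eval₂_C _ _
  have hφX : φ₀ Polynomial.X = single (consMonoidEquiv M (1, 0)) 1 := Polynomial.eval₂_X _ _
  have hφ₀ : ∀ t : T, IsUnit (φ₀ t) := by
    rintro ⟨-, s, hs, rfl⟩
    have h1 : φ₀ (algebraMap R (AddMonoidAlgebra R M)[X] s) =
        singleZeroRingHom (algebraMap R R' s) := by
      rw [Polynomial.algebraMap_apply, hφC, AddMonoidAlgebra.coe_algebraMap]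
      exact hαR s
    exact h1 ▸ (IsLocalization.map_units R' (⟨s, hs⟩ : S)).map
      (singleZeroRingHom (R := R') (M := consMonoid M))
  let φ : W →+* AddMonoidAlgebra R' (consMonoid M) := IsLocalization.lift (M := T) hφ₀
  have hφ : ∀ b, φ (algebraMap (AddMonoidAlgebra R M)[X] _ b) = φ₀ b :=
    IsLocalization.lift_eq hφ₀
  let j : R →+* W := (algebraMap (AddMonoidAlgebra R M)[X] W).comp
    (algebraMap R (AddMonoidAlgebra R M)[X])
  have hθ₀ : ∀ s : S, IsUnit (j s) :=
    fun s => IsLocalization.map_units W (⟨_, s, s.2, rfl⟩ : T)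
  let θ : R' →+* W := IsLocalization.lift (M := S) (P := W) (g := j) hθ₀
  have hθ : ∀ a, θ (algebraMap R _ a) =
      algebraMap (AddMonoidAlgebra R M)[X] _ (algebraMap R (AddMonoidAlgebra R M)[X] a) :=
    IsLocalization.lift_eq hθ₀
  let g₀ : Multiplicative (consMonoid M) →* (AddMonoidAlgebra R M)[X] :=
    { toFun := fun x => Polynomial.X ^ ((consMonoidEquiv M).symm x.toAdd).1 *
        Polynomial.C (single ((consMonoidEquiv M).symm x.toAdd).2 1)
      map_one' := by
        rw [toAdd_one, map_zero, Prod.fst_zero, Prod.snd_zero, pow_zero, ← one_def, map_one,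
          one_mul]
      map_mul' := fun x y => by
        rw [toAdd_mul, map_add, Prod.fst_add, Prod.snd_add, pow_add, ← one_mul (1 : R),
          ← single_mul_single, map_mul, one_mul]
        ring }
  let ψ : AddMonoidAlgebra R' (consMonoid M) →+* W :=
    liftNCRingHom θ (((algebraMap (AddMonoidAlgebra R M)[X] W) :
      (AddMonoidAlgebra R M)[X] →* W).comp g₀)
      fun _ _ => Commute.all _ _
  have hψ : ∀ x a, ψ (single x a) = θ a *
      algebraMap (AddMonoidAlgebra R M)[X] _ (g₀ (Multiplicative.ofAdd x)) :=
    fun x a => liftNC_single _ _ _ _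
  have hg : ∀ x, g₀ (Multiplicative.ofAdd (consMonoidEquiv M x)) =
      Polynomial.X ^ x.1 * Polynomial.C (single x.2 1) := by
    intro x
    change Polynomial.X ^ ((consMonoidEquiv M).symm (consMonoidEquiv M x)).1 *
        Polynomial.C (single ((consMonoidEquiv M).symm (consMonoidEquiv M x)).2 (1 : R)) = _
    rw [AddEquiv.symm_apply_apply]
  have hcomp : (ψ.comp φ) = RingHom.id _ := by
    refine IsLocalization.ringHom_ext T (Polynomial.ringHom_ext' (AddMonoidAlgebra.ringHom_ext
      (fun a => ?_) fun x => ?_) ?_)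
    · simp only [RingHom.comp_apply, RingHom.id_apply]
      rw [hφ, hφC, hαR, hψ, ofAdd_zero, map_one, map_one, mul_one, hθ]
      rfl
    · simp only [RingHom.comp_apply, RingHom.id_apply]
      rw [hφ, hφC, hα, hψ, hg, map_one, one_mul, pow_zero, one_mul]
    · simp only [RingHom.comp_apply, RingHom.id_apply]
      rw [hφ, hφX, hψ, hg, map_one, one_mul, pow_one, ← one_def, map_one, mul_one]
  exact ⟨φ, ψ, RingHom.congr_fun hcomp⟩

theorem krullDimLE_one_localization_atPrime {R : Type*} [CommRing R] (p : Ideal R) [p.IsPrime]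
    (hp : p.height ≤ 1) : Ring.KrullDimLE 1 (Localization.AtPrime p) := by
  rw [Ring.krullDimLE_iff, IsLocalization.AtPrime.ringKrullDim_eq_height p]
  exact_mod_cast hp

theorem IsShearable.idemFree_localization_polynomial {R : Type*} [CommRing R] [IsNoetherianRing R]
    {M : AddSubmonoid (Fin r → ℕ)} (hM : IsShearable M) (p : Ideal R) [p.IsPrime]
    (hp : p.height ≤ 1) {ι : Type*} [Fintype ι] {n : ℕ}
    {E : Matrix ι ι (Localization (p.primeCompl.map
      (algebraMap R (AddMonoidAlgebra R M)[X])))}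
    (hE : OrientedIdem (n + 1) E) : IdemFree (n + 1) E := by
  have := krullDimLE_one_localization_atPrime p hp
  have : IsNoetherianRing (Localization.AtPrime p) :=
    IsLocalization.isNoetherianRing p.primeCompl _ ‹_›
  obtain ⟨φ, ψ, h⟩ := exists_localization_polynomial_retract (R' := Localization.AtPrime p)
    (W := Localization (p.primeCompl.map
      (algebraMap R (AddMonoidAlgebra R M)[X]))) M p.primeCompl
  convert (hM.consMonoid.idemFree (R := Localization.AtPrime p) (hE.map φ)).map ψ using 1
  ext1 i k
  exact (h _).symm

/-- A projective `R[M][T]`-module of positive rank whose determinant is trivial after inverting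
`s ∉ p` becomes free after inverting an element outside of the prime `p` of height at most one. -/
theorem IsShearable.exists_mul_eq_smul {R : Type*} [CommRing R] [IsNoetherianRing R]
    {M : AddSubmonoid (Fin r → ℕ)} (hM : IsShearable M) (p : Ideal R) [p.IsPrime]
    (hp : p.height ≤ 1) {ι : Type*} [Fintype ι] {n : ℕ}
    {E : Matrix ι ι (AddMonoidAlgebra R M)[X]} (hE : E * E = E)
    {c : (Fin (n + 1) → ι) → (Fin (n + 1) → ι) → (AddMonoidAlgebra R M)[X]}
    (hc : ∑ f, ∑ g, c f g * (E.submatrix f g).det = 1) {s : R} (hs : s ∉ p)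
    {v w : (Fin (n + 1) → ι) → (AddMonoidAlgebra R M)[X]}
    (hvw : ∀ f g, algebraMap R _ s * (E.submatrix f g).det = v f * w g) :
    ∃ t ∉ p, ∃ (X : Matrix ι (Fin (n + 1)) (AddMonoidAlgebra R M)[X])
      (Y : Matrix (Fin (n + 1)) ι (AddMonoidAlgebra R M)[X]),
      X * Y = algebraMap R (AddMonoidAlgebra R M)[X] t • E ∧
        Y * X = algebraMap R (AddMonoidAlgebra R M)[X] t • 1 := by
  have hu : IsUnit (algebraMap _ (Localization (p.primeCompl.map
      (algebraMap R (AddMonoidAlgebra R M)[X]))) (algebraMap R _ s)) :=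
    IsLocalization.map_units (Localization (p.primeCompl.map
      (algebraMap R (AddMonoidAlgebra R M)[X]))) (⟨_, s, hs, rfl⟩ : p.primeCompl.map
      (algebraMap R (AddMonoidAlgebra R M)[X]))
  have hfree := hM.idemFree_localization_polynomial p hp
    (OrientedIdem.map_of_mul_det_eq hE hc hvw _ hu)
  obtain ⟨-, ⟨t, ht, rfl⟩, h⟩ := IsLocalization.exists_mul_eq_smul_of_idemFree (p.primeCompl.map
    (algebraMap R (AddMonoidAlgebra R M)[X])) hfree
  exact ⟨t, ht, h⟩

end PolynomialExtension

section Extended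

open TensorProduct in
/-- A projective module over `B` whose idempotent matrix is free up to inverting `s` is extended
from `A` after inverting `s`. -/
theorem nonempty_localizedModule_equiv_tensorProduct (A : Type*) {B P ι : Type*} [CommRing A]
    [CommRing B] [Algebra A B] [AddCommGroup P] [Module B P] [Fintype ι] {p : ι → P}
    {φ : ι → P →ₗ[B] B} (h : ∀ x, ∑ i, φ i x • p i = x) {n : ℕ} {s : B}
    {X : Matrix ι (Fin n) B} {Y : Matrix (Fin n) ι B} (hXY : X * Y = s • dualBasisMatrix p φ)
    (hYX : Y * X = s • 1) :
    Nonempty (LocalizedModule (Submonoid.powers s) P ≃ₗ[Localization (Submonoid.powers s)]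
      LocalizedModule (Submonoid.powers s) (B ⊗[A] (Fin n → A))) := by
  classical
  obtain ⟨a, b, hab, hba⟩ := exists_comp_eq_smul_of_mul_eq_smul h hXY hYX
  let e : B ⊗[A] (Fin n → A) ≃ₗ[B] (Fin n → B) := TensorProduct.piScalarRight A B B (Fin n)
  have hs : s ∈ Submonoid.powers s := Submonoid.mem_powers s
  refine nonempty_localizedModule_equiv (t := s * s) (Submonoid.mul_mem _ hs hs)
    (e.symm.toLinearMap ∘ₗ a) (b ∘ₗ e.toLinearMap) (fun y => ?_) fun x => ?_
  · simp only [LinearMap.comp_apply, LinearEquiv.coe_coe, hab, map_smul,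
      LinearEquiv.symm_apply_apply, mul_smul]
  · simp only [LinearMap.comp_apply, LinearEquiv.coe_coe, hba,
      LinearEquiv.apply_symm_apply, mul_smul]

theorem two_le_idealHeight {A : Type*} [CommRing A] {I : Ideal A}
    (h : ∀ p : Ideal A, p.IsPrime → p.height ≤ 1 → ∃ s ∈ I, s ∉ p) : 2 ≤ idealHeight I := by
  refine le_iInf fun ⟨p, hp⟩ => ?_
  by_contra! H
  have h1 : p.asIdeal.height ≤ 1 := by
    rw [PrimeSpectrum.height_eq_orderHeight]
    exact Order.le_of_lt_add_one H
  obtain ⟨s, hs, hsp⟩ := h p.asIdeal p.2 h1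
  exact hsp (hp hs)

end Extended

/-- Let `R` be a reduced commutative Noetherian ring of dimension `n`, `M` a
`Φ`-simplicial monoid in `C(Φ)`, `A = R[M]` and `P` a finitely generated projective
`A[T]`-module of constant rank `n` whose determinant is extended from `R`.  Let
`J̃ ⊆ R` consist of those `s ∈ R` such that `P_s` is extended from `A_s`
(the Quillen ideal intersected with `R`).  Then `ht(J̃) ≥ 2`. -/
theorem height_quillen_ideal_ge_two
    (R : Type) [CommRing R] [IsNoetherianRing R] [IsReduced R]
    (n : ℕ) (hdim : ringKrullDim R = n)
    (r : ℕ) (M : AddSubmonoid (Fin r → ℕ)) (hM : PhiSimplicial M) (hMC : InClassCPhi M)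
    (P : Type) [AddCommGroup P]
    [Module (Polynomial (AddMonoidAlgebra R M)) P]
    [Module.Finite (Polynomial (AddMonoidAlgebra R M)) P]
    [Module.Projective (Polynomial (AddMonoidAlgebra R M)) P]
    (hrank : ∀ (𝔭 : Ideal (Polynomial (AddMonoidAlgebra R M))) [𝔭.IsPrime],
      Module.finrank (Localization.AtPrime 𝔭) (LocalizedModule 𝔭.primeCompl P) = n)
    (hdet : ∃ (L₀ : Type) (_ : AddCommGroup L₀) (_ : Module R L₀),
      Module.Projective R L₀ ∧ Module.Finite R L₀ ∧
      (∀ (𝔭 : Ideal R) [𝔭.IsPrime],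
        Module.finrank (Localization.AtPrime 𝔭) (LocalizedModule 𝔭.primeCompl L₀) = 1) ∧
      Nonempty ((TensorProduct R (Polynomial (AddMonoidAlgebra R M)) L₀)
        ≃ₗ[Polynomial (AddMonoidAlgebra R M)]
          (ExteriorAlgebra.exteriorPower (Polynomial (AddMonoidAlgebra R M)) n P))) :
    (2 : ℕ∞) ≤ idealHeight (Ideal.span
      {s : R | ∃ (N : Type) (_ : AddCommGroup N) (_ : Module (AddMonoidAlgebra R M) N),
        Nonempty (LocalizedModule
            (Submonoid.powers (Polynomial.C (algebraMap R (AddMonoidAlgebra R M) s))) P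
          ≃ₗ[Localization
            (Submonoid.powers (Polynomial.C (algebraMap R (AddMonoidAlgebra R M) s)))]
          LocalizedModule
            (Submonoid.powers (Polynomial.C (algebraMap R (AddMonoidAlgebra R M) s)))
            (TensorProduct (AddMonoidAlgebra R M)
              (Polynomial (AddMonoidAlgebra R M)) N))}) := by
  obtain ⟨m, p, φ, h⟩ := exists_dualBasis (Polynomial (AddMonoidAlgebra R M)) P
  have key : ∀ 𝔭 : Ideal R, 𝔭.IsPrime → 𝔭.height ≤ 1 → ∃ s ∉ 𝔭,
      ∃ (X : Matrix (Fin m) (Fin n) (Polynomial (AddMonoidAlgebra R M)))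
        (Y : Matrix (Fin n) (Fin m) (Polynomial (AddMonoidAlgebra R M))),
        X * Y = algebraMap R (Polynomial (AddMonoidAlgebra R M)) s • dualBasisMatrix p φ ∧
          Y * X = algebraMap R (Polynomial (AddMonoidAlgebra R M)) s • 1 := by
    intro 𝔭 h𝔭 hht
    rcases n with _ | n
    · refine ⟨1, fun h1 => h𝔭.ne_top ((Ideal.eq_top_iff_one 𝔭).2 h1), 0, 0, ?_, ?_⟩
      · rw [dualBasisMatrix_eq_zero h fun q _ => hrank q, smul_zero, Matrix.zero_mul]
      · exact Subsingleton.elim _ _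
    · obtain ⟨c, hc⟩ := exists_sum_minors_eq_one fun q hq =>
        (idemFree_localization_atPrime h q (hrank q)).exists_minor_notMem
      obtain ⟨L₀, _, _, _, _, hL₀, ⟨ε⟩⟩ := hdet
      obtain ⟨s, hs, a, x₀, hax⟩ := exists_smul_eq_smul_of_finrank_eq_one 𝔭 (hL₀ 𝔭)
      obtain ⟨a', y₀, hay⟩ := exists_smul_eq_smul_of_baseChange ε hax
      obtain ⟨v, w, hvw⟩ := exists_mul_det_eq_mul hay p φ
      exact (InClassCPhi.isShearable hM hMC).exists_mul_eq_smul 𝔭 hht (dualBasisMatrix_mul_self h) hc hs hvw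
  refine two_le_idealHeight fun 𝔭 h𝔭 hht => ?_
  obtain ⟨s, hs, X, Y, hXY, hYX⟩ := key 𝔭 h𝔭 hht
  exact ⟨s, Ideal.subset_span ⟨Fin n → AddMonoidAlgebra R M, inferInstance, inferInstance,
    nonempty_localizedModule_equiv_tensorProduct (AddMonoidAlgebra R M) h hXY hYX⟩, hs⟩
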